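/- Large deviation estimate for the truncated passage time: there exist constants C, c > 0 such that for all x, y ∈ Z^d and all t ≥ C ‖x−y‖∞, P( T(x,y) ≥ t ) ≤ c⁻¹ exp( −c t / log² n ). -/

import Mathlib

open MeasureTheory
open scoped ENNReal NNReal

attribute [local instance] Classical.propDecidable

noncomputable section

namespace Perco

/-- Vertices of the lattice `ℤ^d`. -/
abbrev ZVec (d : ℕ) := Fin d → ℤ

/-- The `ℓ¹` norm of a lattice point (as a natural number). -/
def norm1 (d : ℕ) (x : ZVec d) : ℕ := ∑ i, (x i).natAbs

/-- The `ℓ∞` norm of a lattice point (as a natural number). -/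
def normInf (d : ℕ) (x : ZVec d) : ℕ := Finset.univ.sup fun i => (x i).natAbs

/-- Nearest-neighbour edges of `ℤ^d`, each written `(x_e, y_e)` with `‖x_e‖₁ < ‖y_e‖₁`. -/
def EdgeD (d : ℕ) := {e : ZVec d × ZVec d // norm1 d (e.1 - e.2) = 1 ∧ norm1 d e.1 < norm1 d e.2}

/-- A percolation configuration: each edge is open (`true`) or closed (`false`). -/
abbrev Config (d : ℕ) := EdgeD d → Bool

/-- Adjacency in `ℤ^d`. -/
def Adj (d : ℕ) (x y : ZVec d) : Prop := norm1 d (x - y) = 1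

/-- A (self-avoiding, nearest-neighbour) path, recorded as its list of vertices. -/
def IsPath (d : ℕ) (γ : List (ZVec d)) : Prop :=
  γ ≠ [] ∧ γ.Nodup ∧ γ.Chain' (Adj d)

/-- The (unordered) edge `{x,y}` is open in the configuration `ω`. -/
def EdgeOpen (d : ℕ) (ω : Config d) (x y : ZVec d) : Prop :=
  ∃ e : EdgeD d, (e.val = (x, y) ∨ e.val = (y, x)) ∧ ω e = true

/-- All edges of the path are open. -/
def IsOpenPath (d : ℕ) (ω : Config d) (γ : List (ZVec d)) : Prop :=
  γ.Chain' (EdgeOpen d ω)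

/-- The (unordered) edge `{x,y}` is an edge of the path `γ`. -/
def edgeMemPath (d : ℕ) (x y : ZVec d) (γ : List (ZVec d)) : Prop :=
  (x, y) ∈ γ.zip γ.tail ∨ (y, x) ∈ γ.zip γ.tail

/-- Truncated FPP weight of the edge `{x,y}`: `1` if open, `log² n` if closed. -/
def pairWeight (d n : ℕ) (ω : Config d) (x y : ZVec d) : ℝ :=
  if EdgeOpen d ω x y then 1 else (Real.log n) ^ 2

/-- Total truncated weight of a path. -/
def pathCost (d n : ℕ) (ω : Config d) : List (ZVec d) → ℝ
  | [] => 0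
  | [_] => 0
  | x :: y :: rest => pairWeight d n ω x y + pathCost d n ω (y :: rest)

/-- Truncated first-passage time between `x` and `y`. -/
def passageTime (d n : ℕ) (ω : Config d) (x y : ZVec d) : ℝ :=
  sInf {c : ℝ | ∃ γ : List (ZVec d), IsPath d γ ∧ γ.head? = some x ∧
    γ.getLast? = some y ∧ pathCost d n ω γ = c}

/-- Chemical distance between `x` and `y` using only open paths inside `U`. -/
def chemDistIn (d : ℕ) (ω : Config d) (U : Set (ZVec d)) (x y : ZVec d) : ℕ∞ :=
  sInf {k : ℕ∞ | ∃ γ : List (ZVec d), IsPath d γ ∧ IsOpenPath d ω γ ∧ (∀ v ∈ γ, v ∈ U) ∧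
    γ.head? = some x ∧ γ.getLast? = some y ∧ ((γ.length - 1 : ℕ) : ℕ∞) = k}

/-- Chemical distance in the whole lattice. -/
def chemDist (d : ℕ) (ω : Config d) (x y : ZVec d) : ℕ∞ := chemDistIn d ω Set.univ x y

/-- `x` belongs to an infinite open cluster. -/
def InInfCluster (d : ℕ) (ω : Config d) (x : ZVec d) : Prop :=
  {y | chemDist d ω x y ≠ ⊤}.Infinite

/-- `x*`: a point of the infinite cluster at minimal `ℓ∞`-distance from `x`
(deterministic tie-breaking via choice); `x` itself if there is no infinite cluster. -/
def starPt (d : ℕ) (ω : Config d) (x : ZVec d) : ZVec d :=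
  if h : ∃ y, InInfCluster d ω y ∧ ∀ z, InInfCluster d ω z →
      normInf d (y - x) ≤ normInf d (z - x)
  then h.choose else x

/-- `μ` is the Bernoulli(p) bond-percolation product measure on configurations. -/
def IsBernoulli (d : ℕ) (p : ℝ) (μ : Measure (Config d)) : Prop :=
  IsProbabilityMeasure μ ∧
  ∀ (s : Finset (EdgeD d)) (f : EdgeD d → Bool),
    μ {ω | ∀ e ∈ s, ω e = f e} = ∏ e ∈ s, ENNReal.ofReal (if f e then p else 1 - p)

/-- The critical parameter of Bernoulli bond percolation on `ℤ^d`. -/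
def pc (d : ℕ) : ℝ :=
  sSup {p : ℝ | 0 ≤ p ∧ p ≤ 1 ∧ ∀ μ : Measure (Config d), IsBernoulli d p μ →
    μ {ω | ∃ x, InInfCluster d ω x} = 0}

/-- The point `n·e₁`. -/
def ptE1 (d n : ℕ) : ZVec d := fun i => if (i : ℕ) = 0 then (n : ℤ) else 0

/-- `D*_n = D(0*, (n e₁)*)`, as a real number. -/
def DstarR (d n : ℕ) (ω : Config d) : ℝ :=
  ((chemDist d ω (starPt d ω 0) (starPt d ω (ptE1 d n))).toNat : ℝ)

/-- `T_n = T(0, n e₁)`, the truncated passage time. -/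
def TnR (d n : ℕ) (ω : Config d) : ℝ := passageTime d n ω 0 (ptE1 d n)

/-- The box `Λ_t(z)` with integer radius. -/
def boxZ (d : ℕ) (t : ℕ) (z : ZVec d) : Set (ZVec d) := {y | normInf d (y - z) ≤ t}

/-- The box `Λ_t(z)` with real radius. -/
def boxR (d : ℕ) (t : ℝ) (z : ZVec d) : Set (ZVec d) := {y | (normInf d (y - z) : ℝ) ≤ t}

/-- The annulus `A_N(e) = Λ_{3N}(e) \ Λ_N(e)`. -/
def annulus (d : ℕ) (N : ℕ) (e : EdgeD d) : Set (ZVec d) :=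
  {y | normInf d (y - e.val.1) ≤ 3 * N ∧ N < normInf d (y - e.val.1)}

/-- `π` is a geodesic of the truncated passage time between its endpoints, inside `A`. -/
def IsGeodesicIn (d n : ℕ) (ω : Config d) (A : Set (ZVec d)) (π : List (ZVec d)) : Prop :=
  IsPath d π ∧ (∀ v ∈ π, v ∈ A) ∧
  ∀ π' : List (ZVec d), IsPath d π' → (∀ v ∈ π', v ∈ A) →
    π'.head? = π.head? → π'.getLast? = π.getLast? →
    pathCost d n ω π ≤ pathCost d n ω π'

/-- `γ ∈ 𝔾_*(A)`: a path in `A` obtained from some geodesic in `A` by replacing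
segments by open paths (all edges of `γ` not on the geodesic are open). -/
def GstarIn (d n : ℕ) (ω : Config d) (A : Set (ZVec d)) (γ : List (ZVec d)) : Prop :=
  IsPath d γ ∧ (∀ v ∈ γ, v ∈ A) ∧
  ∃ π : List (ZVec d), IsGeodesicIn d n ω A π ∧
    ∀ x y, edgeMemPath d x y γ → ¬ edgeMemPath d x y π → EdgeOpen d ω x y

/-- `γ` is a crossing path of the annulus `A_N(e)`. -/
def IsCrossing (d : ℕ) (N : ℕ) (e : EdgeD d) (γ : List (ZVec d)) : Prop :=
  IsPath d γ ∧ (∀ v ∈ γ, v ∈ annulus d N e) ∧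
  (∃ v ∈ γ, normInf d (v - e.val.1) = N + 1) ∧ (∃ v ∈ γ, normInf d (v - e.val.1) = 3 * N)

/-- The event `𝒱¹_N(e)`: any two modified geodesics crossing `A_N(e)` are linked by an
open path inside `A_N(e)` of length at most `C_* N`. -/
def V1 (d : ℕ) (Cstar : ℝ) (n : ℕ) (e : EdgeD d) (N : ℕ) (ω : Config d) : Prop :=
  ∀ γ1 γ2 : List (ZVec d),
    GstarIn d n ω (boxR d (Cstar * N) e.val.1) γ1 → IsCrossing d N e γ1 →
    GstarIn d n ω (boxR d (Cstar * N) e.val.1) γ2 → IsCrossing d N e γ2 →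
    ∃ π : List (ZVec d), IsPath d π ∧ IsOpenPath d ω π ∧ (∀ v ∈ π, v ∈ annulus d N e) ∧
      (∃ u, π.head? = some u ∧ u ∈ γ1) ∧ (∃ v, π.getLast? = some v ∧ v ∈ γ2) ∧
      ((π.length : ℝ) - 1 ≤ Cstar * N)

/-- The event `𝒱²_N(e)`: points of `Λ_{3N}(e)` openly connected inside `Λ_{3N}(e)` are
connected inside `Λ_{4N}(e)` by an open path of length at most `C_* N`. -/
def V2 (d : ℕ) (Cstar : ℝ) (e : EdgeD d) (N : ℕ) (ω : Config d) : Prop :=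
  ∀ x y : ZVec d, x ∈ boxZ d (3 * N) e.val.1 → y ∈ boxZ d (3 * N) e.val.1 →
    (∃ γ, IsPath d γ ∧ IsOpenPath d ω γ ∧ (∀ v ∈ γ, v ∈ boxZ d (3 * N) e.val.1) ∧
      γ.head? = some x ∧ γ.getLast? = some y) →
    ∃ γ, IsPath d γ ∧ IsOpenPath d ω γ ∧ (∀ v ∈ γ, v ∈ boxZ d (4 * N) e.val.1) ∧
      γ.head? = some x ∧ γ.getLast? = some y ∧ ((γ.length : ℝ) - 1 ≤ Cstar * N)

/-- The effective radius `R_e` as a natural number (`0` when undefined). -/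
def ReffN (d : ℕ) (Cstar : ℝ) (n : ℕ) (e : EdgeD d) (ω : Config d) : ℕ :=
  sInf {N : ℕ | 1 ≤ N ∧ V1 d Cstar n e N ω ∧ V2 d Cstar e N ω}

/-- The effective radius `R_e`, valued in `ℝ≥0∞` (`∞` when undefined). -/
def ReffENN (d : ℕ) (Cstar : ℝ) (n : ℕ) (e : EdgeD d) (ω : Config d) : ℝ≥0∞ :=
  sInf {r : ℝ≥0∞ | ∃ N : ℕ, r = N ∧ 1 ≤ N ∧ V1 d Cstar n e N ω ∧ V2 d Cstar e N ω}

/-- The truncated effective radius `R̂_e = min (C_* R_e) (log² n)`. -/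
def RhatR (d : ℕ) (Cstar : ℝ) (n : ℕ) (e : EdgeD d) (ω : Config d) : ℝ :=
  (min (ENNReal.ofReal Cstar * ReffENN d Cstar n e ω)
    (ENNReal.ofReal ((Real.log n) ^ 2))).toReal

/-- `diam(γ) ≥ r`. -/
def DiamGE (d : ℕ) (γ : List (ZVec d)) (r : ℝ) : Prop :=
  ∃ i : Fin d, ∃ x ∈ γ, ∃ y ∈ γ, r ≤ |((x i : ℤ) : ℝ) - ((y i : ℤ) : ℝ)|

/-- The boundary `∂Λ_t` (real radius `t`). -/
def bdryR (d : ℕ) (t : ℝ) : Set (ZVec d) :=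
  {x | (normInf d x : ℝ) ≤ t ∧ t - 1 < (normInf d x : ℝ)}

/-- The slab `S(ℓ,t) = {x ∈ Λ_t : 0 ≤ x₁ ≤ ℓ}`. -/
def slab (d : ℕ) (l t : ℝ) : Set (ZVec d) :=
  {x | (normInf d x : ℝ) ≤ t ∧ ∀ i : Fin d, (i : ℕ) = 0 → 0 ≤ x i ∧ ((x i : ℤ) : ℝ) ≤ l}

/-- The open cluster of the vertex `v`. -/
def openClusterOf (d : ℕ) (ω : Config d) (v : ZVec d) : Set (ZVec d) :=
  {y | chemDist d ω v y ≠ ⊤}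

/-- The set `C` crosses the box `Λ_t(z)`: in each direction an open path of `C ∩ Λ_t(z)`
connects the two opposite faces. -/
def CrossesBox (d : ℕ) (ω : Config d) (C : Set (ZVec d)) (t : ℕ) (z : ZVec d) : Prop :=
  ∀ i : Fin d, ∃ γ, IsPath d γ ∧ IsOpenPath d ω γ ∧ (∀ u ∈ γ, u ∈ C ∧ u ∈ boxZ d t z) ∧
    (∃ u ∈ γ, u i = z i - t) ∧ (∃ u ∈ γ, u i = z i + t)

/-- The event `𝓔_N`: some crossing open cluster of `Λ_{2N}` is avoided by a modified
geodesic `π ⊆ Λ_N` of diameter at least `N/2` belonging to `𝔾_*(Λ_{tN})`. -/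
def ENevent (d n : ℕ) (t : ℝ) (N : ℕ) : Set (Config d) :=
  {ω | ∃ v0 : ZVec d, CrossesBox d ω (openClusterOf d ω v0) (2 * N) 0 ∧
    ∃ π : List (ZVec d), IsPath d π ∧ (∀ u ∈ π, u ∈ boxZ d N 0) ∧
      GstarIn d n ω (boxR d (t * N) 0) π ∧ DiamGE d π ((N : ℝ) / 2) ∧
      ∀ u ∈ π, u ∉ openClusterOf d ω v0}

/-- `ρ` is a Garet–Marchand moderate-deviation constant for the chemical distance. -/
def GMprop (d : ℕ) (μ : Measure (Config d)) (ρ : ℝ) : Prop :=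
  1 ≤ ρ ∧ ∃ c : ℝ, 0 < c ∧ ∀ x : ZVec d, ∀ t : ℝ, ρ * (normInf d x : ℝ) ≤ t →
    μ {ω | chemDist d ω 0 x ≠ ⊤ ∧ t ≤ ((chemDist d ω 0 x).toNat : ℝ)}
      ≤ ENNReal.ofReal (c⁻¹ * Real.exp (-c * t)) ∧
    μ {ω | t ≤ ((chemDist d ω (starPt d ω 0) (starPt d ω x)).toNat : ℝ) ∨
        chemDist d ω (starPt d ω 0) (starPt d ω x) = ⊤}
      ≤ ENNReal.ofReal (c⁻¹ * Real.exp (-c * t))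

/-- `cs` is a constant for which the crossing-cluster avoidance lemma holds. -/
def CrossProp (d : ℕ) (μ : Measure (Config d)) (cs : ℝ) : Prop :=
  0 < cs ∧ cs < 1 ∧ ∀ n : ℕ, 2 ≤ n → ∀ t : ℝ, 1 / cs ≤ t → ∀ N : ℕ, 1 ≤ N →
    (N : ℝ) ≤ Real.exp (cs * (Real.log n) ^ 2) →
    μ (ENevent d n t N) ≤ ENNReal.ofReal (cs⁻¹ * Real.exp (-cs * N))

/-- `N_ρ = ⌊N / (16 ρ²)⌋`. -/
def Nrho (ρ : ℝ) (N : ℕ) : ℕ := Nat.floor ((N : ℝ) / (16 * ρ ^ 2))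

/-- The cube of side-length `m` with lower corner `z`. -/
def cube (d : ℕ) (m : ℕ) (z : ZVec d) : Set (ZVec d) :=
  {y | ∀ i, z i ≤ y i ∧ y i ≤ z i + m}

/-- The open cluster of `v` inside `U`. -/
def clusterIn (d : ℕ) (ω : Config d) (U : Set (ZVec d)) (v : ZVec d) : Set (ZVec d) :=
  {y | chemDistIn d ω U v y ≠ ⊤}

/-- `k ≤ r` for `k : ℕ∞` and `r : ℝ` (in particular `k` is finite). -/
def chemLE (k : ℕ∞) (r : ℝ) : Prop := ∃ m : ℕ, k = (m : ℕ∞) ∧ (m : ℝ) ≤ r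

/-- The box `Λ_{3N}(e)` is good (Definition 2.2 of the paper). -/
def GoodBox (d n : ℕ) (ρ Cstar : ℝ) (e : EdgeD d) (N : ℕ) (ω : Config d) : Prop :=
  (∃ v0 ∈ boxZ d (3 * N) e.val.1,
    (∀ z : ZVec d, cube d (Nrho ρ N) z ⊆ boxZ d (3 * N) e.val.1 →
      ∀ i : Fin d, ∃ γ, IsPath d γ ∧ IsOpenPath d ω γ ∧
        (∀ u ∈ γ, u ∈ clusterIn d ω (boxZ d (3 * N) e.val.1) v0 ∧ u ∈ cube d (Nrho ρ N) z) ∧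
        (∃ u ∈ γ, u i = z i) ∧ (∃ u ∈ γ, u i = z i + (Nrho ρ N : ℤ))) ∧
    (∀ π, IsPath d π → (∀ u ∈ π, u ∈ boxZ d (3 * N) e.val.1) →
      GstarIn d n ω (boxR d (Cstar * N) e.val.1) π → DiamGE d π ((Nrho ρ N : ℝ)) →
      ∃ u ∈ π, u ∈ clusterIn d ω (boxZ d (3 * N) e.val.1) v0)) ∧
  (∀ x y : ZVec d, x ∈ boxZ d (3 * N) e.val.1 → y ∈ boxZ d (3 * N) e.val.1 →
    normInf d (x - y) ≤ 2 * Nrho ρ N → chemDist d ω x y ≠ ⊤ →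
    chemDistIn d ω (boxZ d (4 * N) e.val.1) x y = chemDist d ω x y ∧
    chemLE (chemDist d ω x y) (4 * ρ * (Nrho ρ N : ℝ))) ∧
  (∀ x y : ZVec d, x ∈ annulus d N e → y ∈ annulus d N e →
    (∀ b : ZVec d, (normInf d (b - e.val.1) = N ∨ normInf d (b - e.val.1) = 3 * N) →
      (N : ℝ) / 2 ≤ (normInf d (x - b) : ℝ) ∧ (N : ℝ) / 2 ≤ (normInf d (y - b) : ℝ)) →
    normInf d (x - y) ≤ 2 * Nrho ρ N → chemDist d ω x y ≠ ⊤ →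
    chemDistIn d ω (annulus d N e) x y = chemDist d ω x y ∧
    chemLE (chemDist d ω x y) (4 * ρ * (Nrho ρ N : ℝ)))

/-- Evaluate an edge-indexed function at the (unordered) pair `{x,y}`, `0` if not an edge. -/
def edgeFnVal (d : ℕ) (g : EdgeD d → ℝ) (x y : ZVec d) : ℝ :=
  if h : ∃ e : EdgeD d, e.val = (x, y) ∨ e.val = (y, x) then g h.choose else 0

/-- The sum of `g` over the edges of the path `γ`. -/
def pathSum (d : ℕ) (g : EdgeD d → ℝ) (γ : List (ZVec d)) : ℝ :=
  ((γ.zip γ.tail).map fun pr => edgeFnVal d g pr.1 pr.2).sum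

/-- Number of edges of `η` that are not edges of `γ`, i.e. `|η \ γ|`. -/
def diffEdgeCount (d : ℕ) (η γ : List (ZVec d)) : ℕ :=
  ((η.zip η.tail).filter fun pr => decide (¬ edgeMemPath d pr.1 pr.2 γ)).length

/-- Maximal total weight of a lattice animal (path) in `Ξ_L`. -/
def animalMax (d : ℕ) (L : ℕ) (g : EdgeD d → ℝ) : ℝ :=
  sSup {r : ℝ | ∃ γ : List (ZVec d), IsPath d γ ∧ (∀ v ∈ γ, v ∈ boxZ d L 0) ∧
    γ.length ≤ L + 1 ∧ r = pathSum d g γ}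

/-- `m = ⌊n^{1/4}⌋`. -/
def mOf (n : ℕ) : ℕ := Nat.floor ((n : ℝ) ^ ((1 : ℝ) / 4))

/-- The box `Λ_m` as a finite set. -/
def boxFinset (d m : ℕ) : Finset (ZVec d) := Finset.Icc (fun _ => -(m : ℤ)) (fun _ => (m : ℤ))

/-- The spatially averaged passage time `F_m`. -/
def Fm (d n : ℕ) (ω : Config d) : ℝ :=
  (∑ z ∈ boxFinset d (mOf n), passageTime d n ω z (z + ptE1 d n)) / (boxFinset d (mOf n)).card

/-- The σ-algebra generated by the states of the first `i` edges. -/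
def edgeFiltration (d : ℕ) (ε : ℕ ≃ EdgeD d) (i : ℕ) : MeasurableSpace (Config d) :=
  MeasurableSpace.comap (fun ω (j : Fin i) => ω (ε j)) MeasurableSpace.pi

/-- The martingale increment `Δ_i = E[e^{λ F_m} | 𝓕_i] − E[e^{λ F_m} | 𝓕_{i−1}]`. -/
def mgDelta (d n : ℕ) (ε : ℕ ≃ EdgeD d) (lam : ℝ) (μ : Measure (Config d)) (i : ℕ) :
    Config d → ℝ :=
  fun ω => (μ[fun ω' => Real.exp (lam * Fm d n ω') | edgeFiltration d ε i]) ω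
    - (μ[fun ω' => Real.exp (lam * Fm d n ω') | edgeFiltration d ε (i - 1)]) ω

/-- The entropy `Ent[X] = E[X log (X / E[X])]`. -/
def entOf {α : Type*} [MeasurableSpace α] (μ : Measure α) (X : α → ℝ) : ℝ :=
  ∫ ω, X ω * Real.log (X ω / ∫ ω', X ω' ∂μ) ∂μ

end Perco
namespace Perco

section Bits

variable {ι κ : Type*}

/-- The Bernoulli law on `Bool` with success probability `r`. -/
def bern (r : unitInterval) : Measure Bool :=
  ENNReal.ofReal r • Measure.dirac true + ENNReal.ofReal (1 - r) • Measure.dirac false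

lemma bern_singleton (r : unitInterval) (b : Bool) :
    bern r {b} = ENNReal.ofReal (if b then (r : ℝ) else 1 - r) := by
  cases b <;> simp [bern]

instance (r : unitInterval) : IsProbabilityMeasure (bern r) := ⟨by
  have h0 := r.2.1
  have h1 := r.2.2
  simp only [bern, Measure.coe_add, Measure.coe_smul, Pi.add_apply, Pi.smul_apply,
    measure_univ, smul_eq_mul, mul_one]
  rw [← ENNReal.ofReal_add h0 (by linarith)]
  simp⟩

/-- The product measure of independent bits with success probabilities `r`. -/
def bits (r : ι → unitInterval) : Measure (ι → Bool) := Measure.infinitePi fun i => bern (r i)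

instance (r : ι → unitInterval) : IsProbabilityMeasure (bits r) := by
  unfold bits; infer_instance

/-- The event `A` is determined by the bits with index in `S`. -/
def Dep (S : Set ι) (A : Set (ι → Bool)) : Prop :=
  ∀ ω ω', (∀ i ∈ S, ω i = ω' i) → ω ∈ A → ω' ∈ A

lemma Dep.mem_iff {S : Set ι} {A : Set (ι → Bool)} (h : Dep S A) {ω ω' : ι → Bool}
    (hω : ∀ i ∈ S, ω i = ω' i) : ω ∈ A ↔ ω' ∈ A :=
  ⟨h ω ω' hω, h ω' ω fun i hi => (hω i hi).symm⟩

lemma Dep.mono {S T : Set ι} {A : Set (ι → Bool)} (h : Dep S A) (hST : S ⊆ T) : Dep T A :=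
  fun ω ω' hω => h ω ω' fun i hi => hω i (hST hi)

lemma Dep.compl {S : Set ι} {A : Set (ι → Bool)} (h : Dep S A) : Dep S Aᶜ :=
  fun _ _ hω hA hA' => hA ((h.mem_iff hω).2 hA')

lemma Dep.inter {S : Set ι} {A B : Set (ι → Bool)} (hA : Dep S A) (hB : Dep S B) :
    Dep S (A ∩ B) :=
  fun ω ω' hω h => ⟨hA ω ω' hω h.1, hB ω ω' hω h.2⟩

lemma Dep.iInter {α : Sort*} {S : Set ι} {A : α → Set (ι → Bool)} (hA : ∀ a, Dep S (A a)) :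
    Dep S (⋂ a, A a) := by
  intro ω ω' hω h
  rw [Set.mem_iInter] at h ⊢
  exact fun a => hA a ω ω' hω (h a)

lemma Dep.iUnion {α : Sort*} {S : Set ι} {A : α → Set (ι → Bool)} (hA : ∀ a, Dep S (A a)) :
    Dep S (⋃ a, A a) := by
  intro ω ω' hω h
  rw [Set.mem_iUnion] at h ⊢
  exact h.imp fun a => hA a ω ω' hω

lemma Dep.univ (S : Set ι) : Dep S (Set.univ : Set (ι → Bool)) := fun _ _ _ _ => trivial

lemma dep_of_congr {S : Set ι} {p : (ι → Bool) → Prop}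
    (h : ∀ ω ω', (∀ i ∈ S, ω i = ω' i) → (p ω ↔ p ω')) : Dep S {ω | p ω} :=
  fun ω ω' hω hA => (h ω ω' hω).1 hA

lemma dep_bit {S : Set ι} {i : ι} (hi : i ∈ S) (b : Bool) : Dep S {ω | ω i = b} :=
  dep_of_congr fun ω ω' h => by rw [h i hi]

lemma Dep.eq_preimage {S : Finset ι} {A : Set (ι → Bool)} (h : Dep (S : Set ι) A) :
    A = (fun (ω : ι → Bool) (i : S) => ω i) ⁻¹' ((fun (ω : ι → Bool) (i : S) => ω i) '' A) := by
  refine Set.Subset.antisymm (Set.subset_preimage_image _ _) ?_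
  rintro ω ⟨ω', hω', he⟩
  exact h ω' ω (fun i hi => congrFun he ⟨i, hi⟩) hω'

lemma Dep.measurableSet {S : Set ι} (hS : S.Finite) {A : Set (ι → Bool)} (h : Dep S A) :
    MeasurableSet A := by
  lift S to Finset ι using hS
  rw [h.eq_preimage]
  exact (measurable_pi_lambda _ fun i => measurable_pi_apply _) (Set.toFinite _).measurableSet

lemma iIndepFun_bits (r : ι → unitInterval) :
    ProbabilityTheory.iIndepFun (fun (i : ι) (ω : ι → Bool) => ω i) (bits r) :=
  ProbabilityTheory.iIndepFun_infinitePi (X := fun _ b => b) fun _ => measurable_id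

lemma measureReal_inter_of_dep (r : ι → unitInterval) {S T : Set ι} (hS : S.Finite)
    (hT : T.Finite) (hST : Disjoint S T) {A B : Set (ι → Bool)} (hA : Dep S A) (hB : Dep T B) :
    (bits r).real (A ∩ B) = (bits r).real A * (bits r).real B := by
  lift S to Finset ι using hS
  lift T to Finset ι using hT
  rw [Finset.disjoint_coe] at hST
  have := (iIndepFun_bits r).indepFun_finset S T hST fun i => measurable_pi_apply _
  have h2 := this.measure_inter_preimage_eq_mul _ _
    ((Set.toFinite ((fun (ω : ι → Bool) (i : S) => ω i) '' A)).measurableSet)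
    ((Set.toFinite ((fun (ω : ι → Bool) (i : T) => ω i) '' B)).measurableSet)
  rw [← hA.eq_preimage, ← hB.eq_preimage] at h2
  simp only [Measure.real, h2, ENNReal.toReal_mul]

lemma measureReal_bit (r : ι → unitInterval) (i : ι) (b : Bool) :
    (bits r).real {ω | ω i = b} = if b then (r i : ℝ) else 1 - r i := by
  have h0 := (r i).2.1
  have h1 := (r i).2.2
  have h : (bits r) {ω | ω i = b} = bern (r i) {b} := by
    rw [← Measure.infinitePi_map_eval (fun i => bern (r i)) i,
      Measure.map_apply (measurable_pi_apply i) (measurableSet_singleton b)]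
    rfl
  rw [Measure.real, h, bern_singleton, ENNReal.toReal_ofReal]
  split_ifs <;> linarith

lemma measureReal_iInter_of_dep (r : ι → unitInterval) {I : κ → Set ι} (hI : ∀ e, (I e).Finite)
    (hd : Pairwise fun e e' => Disjoint (I e) (I e')) {A : κ → Set (ι → Bool)}
    (hA : ∀ e, Dep (I e) (A e)) (s : Finset κ) :
    (bits r).real (⋂ e ∈ s, A e) = ∏ e ∈ s, (bits r).real (A e) := by
  induction s using Finset.induction_on with
  | empty => simp
  | insert a s ha ih =>
    rw [Finset.set_biInter_insert, Finset.prod_insert ha, ← ih]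
    refine measureReal_inter_of_dep r (hI a) (T := ⋃ e ∈ s, I e)
      (s.finite_toSet.biUnion fun e _ => hI e) ?_ (hA a) ?_
    · rw [Set.disjoint_iUnion₂_right]
      rintro e he
      exact hd (by rintro rfl; exact ha he)
    · refine Dep.iInter fun e => Dep.iInter fun he => (hA e).mono ?_
      exact Set.subset_biUnion_of_mem (u := I) he

lemma eq_bits (r : ι → unitInterval) {ν : Measure (ι → Bool)}
    (h : ∀ (s : Finset ι) (f : ι → Bool),
      ν {ω | ∀ e ∈ s, ω e = f e} = ∏ e ∈ s, ENNReal.ofReal (if f e then (r e : ℝ) else 1 - r e)) :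
    ν = bits r := by
  refine Measure.eq_infinitePi _ fun s t _ => ?_
  by_cases hemp : ∃ i ∈ s, t i = ∅
  · obtain ⟨i, hi, hti⟩ := hemp
    rw [Finset.prod_eq_zero hi (by simp [hti]), Set.pi_eq_empty (by simpa using hi) hti]
    simp
  push Not at hemp
  have h3 : ∀ i ∈ s, t i ≠ Set.univ → ∃ b, t i = {b} := by
    intro i hi hne
    obtain ⟨b, hb⟩ := hemp i hi
    refine ⟨b, Set.Subset.antisymm ?_ (by simpa using hb)⟩
    intro b' hb'
    by_contra hbb
    apply hne
    ext x
    simp only [Set.mem_univ, iff_true]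
    have : x = b ∨ x = b' := by
      cases x <;> cases b <;> cases b' <;> simp_all
    rcases this with rfl | rfl <;> assumption
  let f : ι → Bool := fun i => if h : ∃ b, t i = {b} then h.choose else false
  have hf : ∀ i ∈ s, t i ≠ Set.univ → t i = {f i} := by
    intro i hi hne
    have := h3 i hi hne
    simp only [f, dif_pos this]
    exact this.choose_spec
  have h4 : Set.pi (s : Set ι) t = {ω | ∀ e ∈ s.filter (fun i => t i ≠ Set.univ), ω e = f e} := by
    ext ω
    simp only [Set.mem_pi, SetLike.mem_coe, Finset.mem_filter, Set.mem_ofPred_eq, and_imp]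
    refine forall₂_congr fun i hi => ?_
    by_cases hne : t i = Set.univ
    · simp [hne]
    · have := hf i hi hne
      simp only [ne_eq, hne, not_false_eq_true, forall_const]
      rw [this]; rfl
  rw [h4, h, ← Finset.prod_filter_mul_prod_filter_not s (fun i => t i ≠ Set.univ)]
  rw [Finset.prod_eq_one (s := s.filter fun i => ¬ t i ≠ Set.univ), mul_one]
  · refine Finset.prod_congr rfl fun i hi => ?_
    rw [Finset.mem_filter] at hi
    rw [hf i hi.1 hi.2, bern_singleton]
  · intro i hi
    rw [Finset.mem_filter, not_not] at hi
    rw [hi.2, measure_univ]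

lemma map_bits (r : ι → unitInterval) (r' : κ → unitInterval) {I : κ → Set ι}
    (hI : ∀ e, (I e).Finite) (hd : Pairwise fun e e' => Disjoint (I e) (I e'))
    {F : (ι → Bool) → κ → Bool} (hF : ∀ e, Dep (I e) {ω | F ω e = true})
    (hr : ∀ e, (bits r).real {ω | F ω e = true} = r' e) :
    Measurable F ∧ (bits r).map F = bits r' := by
  have hF' : ∀ e b, Dep (I e) {ω | F ω e = b} := by
    intro e b
    cases b with
    | true => exact hF e
    | false =>
      have : {ω | F ω e = false} = {ω | F ω e = true}ᶜ := by ext; simp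
      rw [this]; exact (hF e).compl
  have hm : Measurable F := measurable_pi_lambda _ fun e =>
    measurable_to_countable' fun b => (hF' e b).measurableSet (hI e)
  refine ⟨hm, eq_bits r' fun s f => ?_⟩
  rw [Measure.map_apply hm]
  · have h1 : F ⁻¹' {ω | ∀ e ∈ s, ω e = f e} = ⋂ e ∈ s, {ω | F ω e = f e} := by
      ext; simp
    rw [h1, ← ENNReal.ofReal_toReal (measure_ne_top (bits r) _)]
    change ENNReal.ofReal ((bits r).real _) = _
    rw [measureReal_iInter_of_dep r hI hd (fun e => hF' e (f e)) s,
      ENNReal.ofReal_prod_of_nonneg fun _ _ => measureReal_nonneg]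
    refine Finset.prod_congr rfl fun e _ => ?_
    congr 1
    cases f e with
    | true => simp [hr]
    | false =>
      have : {ω | F ω e = false} = {ω | F ω e = true}ᶜ := by ext; simp
      simp only [this, Bool.false_eq_true, if_false]
      rw [probReal_compl_eq_one_sub ((hF e).measurableSet (hI e)), hr]
  · have : {ω : κ → Bool | ∀ e ∈ s, ω e = f e} = ⋂ e ∈ s, {ω | ω e = f e} := by ext; simp
    rw [this]
    exact (Dep.iInter fun e => Dep.iInter fun he => dep_bit (S := (s : Set κ)) he _).measurableSet
      s.finite_toSet

lemma map_bits_injective (r : ι → unitInterval) (r' : κ → unitInterval) {σ : κ → ι}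
    (hσ : Function.Injective σ) (hr : ∀ e, r (σ e) = r' e) :
    (bits r).map (fun ω e => ω (σ e)) = bits r' := by
  refine (map_bits r r' (I := fun e => {σ e}) (fun _ => Set.finite_singleton _) ?_
    (F := fun ω e => ω (σ e)) (fun e => dep_bit (Set.mem_singleton _) true) fun e => ?_).2
  · intro e e' he
    simpa using fun h => he (hσ h.symm).symm
  · rw [measureReal_bit, if_pos rfl, hr]

lemma hasSum_measureReal_iUnion {α Ω : Type*} [Countable α] [MeasurableSpace Ω] {μ : Measure Ω}
    [IsFiniteMeasure μ] {f : α → Set Ω} (hd : Pairwise fun s t => Disjoint (f s) (f t))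
    (hf : ∀ s, MeasurableSet (f s)) :
    HasSum (fun s => μ.real (f s)) (μ.real (⋃ s, f s)) := by
  have h := measure_iUnion (μ := μ) hd hf
  have hne : ∑' s, μ (f s) ≠ ⊤ := h ▸ measure_ne_top μ _
  have h2 := ENNReal.hasSum_toReal hne
  rwa [← ENNReal.tsum_toReal_eq fun s => measure_ne_top μ _, ← h] at h2

/-- If the value of `X` is revealed by bits disjoint from those determining `E s`, then `E (X ω)`
keeps its conditional probability bound. -/
lemma reveal_le {α : Type*} [Countable α] (r : ι → unitInterval) (X : (ι → Bool) → α)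
    (E : α → Set (ι → Bool)) (I J : α → Set ι) (hI : ∀ s, (I s).Finite) (hJ : ∀ s, (J s).Finite)
    (hIJ : ∀ s, Disjoint (I s) (J s)) (hX : ∀ s, Dep (I s) {ω | X ω = s})
    (hE : ∀ s, Dep (J s) (E s)) (A : Set α) (ε : ℝ)
    (hε : ∀ ω, X ω ∈ A → (bits r).real (E (X ω)) ≤ ε) :
    (bits r).real {ω | X ω ∈ A ∧ ω ∈ E (X ω)} ≤ ε * (bits r).real {ω | X ω ∈ A} := by
  have hmX : ∀ s, MeasurableSet {ω | X ω = s} := fun s => (hX s).measurableSet (hI s)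
  have h1 : {ω | X ω ∈ A ∧ ω ∈ E (X ω)} = ⋃ s : A, {ω | X ω = s} ∩ E s := by
    ext ω
    simp only [Set.mem_ofPred_eq, Set.mem_iUnion, Set.mem_inter_iff]
    constructor
    · rintro ⟨h, h'⟩; exact ⟨⟨_, h⟩, rfl, h'⟩
    · rintro ⟨⟨s, hs⟩, h, h'⟩; simp only at h; subst h; exact ⟨hs, h'⟩
  have h2 : {ω | X ω ∈ A} = ⋃ s : A, {ω | X ω = s} := by
    ext ω; simp
  have hd : Pairwise fun s t : A => Disjoint {ω | X ω = (s : α)} {ω | X ω = (t : α)} := by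
    intro s t hst
    rw [Set.disjoint_left]
    rintro ω h h'
    exact hst (Subtype.ext (h.symm.trans h'))
  have hd' : Pairwise fun s t : A =>
      Disjoint ({ω | X ω = (s : α)} ∩ E s) ({ω | X ω = (t : α)} ∩ E t) := fun s t hst =>
    (hd hst).mono Set.inter_subset_left Set.inter_subset_left
  have hs1 := hasSum_measureReal_iUnion (μ := bits r) hd fun s => hmX s
  have hs2 := hasSum_measureReal_iUnion (μ := bits r) hd' fun s =>
    (hmX s).inter ((hE s).measurableSet (hJ s))
  rw [h1, h2]
  refine hasSum_le (fun s => ?_) hs2 (hs1.mul_left ε)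
  rw [measureReal_inter_of_dep r (hI s) (hJ s) (hIJ s) (hX s) (hE s), mul_comm]
  by_cases hne : ∃ ω, X ω = s
  · obtain ⟨ω, hω⟩ := hne
    refine mul_le_mul_of_nonneg_right ?_ measureReal_nonneg
    have := hε ω (by rw [hω]; exact s.2)
    rwa [hω] at this
  · have : {ω | X ω = (s : α)} = ∅ := by
      ext ω; simpa using fun h => hne ⟨ω, h⟩
    simp [this]

/-- Lower bound version of `reveal_le`. -/
lemma le_reveal {α : Type*} [Countable α] (r : ι → unitInterval) (X : (ι → Bool) → α)
    (E : α → Set (ι → Bool)) (I J : α → Set ι) (hI : ∀ s, (I s).Finite) (hJ : ∀ s, (J s).Finite)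
    (hIJ : ∀ s, Disjoint (I s) (J s)) (hX : ∀ s, Dep (I s) {ω | X ω = s})
    (hE : ∀ s, Dep (J s) (E s)) (A : Set α) (ε : ℝ)
    (hε : ∀ ω, X ω ∈ A → ε ≤ (bits r).real (E (X ω))) :
    ε * (bits r).real {ω | X ω ∈ A} ≤ (bits r).real {ω | X ω ∈ A ∧ ω ∈ E (X ω)} := by
  have hmX : ∀ s, MeasurableSet {ω | X ω = s} := fun s => (hX s).measurableSet (hI s)
  have hA : MeasurableSet {ω | X ω ∈ A} := by
    have : {ω | X ω ∈ A} = ⋃ s : A, {ω | X ω = s} := by ext ω; simp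
    rw [this]
    exact MeasurableSet.iUnion fun s => hmX s
  have hAE : MeasurableSet {ω | X ω ∈ A ∧ ω ∈ E (X ω)} := by
    have : {ω | X ω ∈ A ∧ ω ∈ E (X ω)} = ⋃ s : A, {ω | X ω = s} ∩ E s := by
      ext ω
      simp only [Set.mem_ofPred_eq, Set.mem_iUnion, Set.mem_inter_iff]
      constructor
      · rintro ⟨h, h'⟩; exact ⟨⟨_, h⟩, rfl, h'⟩
      · rintro ⟨⟨s, hs⟩, h, h'⟩; simp only at h; subst h; exact ⟨hs, h'⟩
    rw [this]
    exact MeasurableSet.iUnion fun s => (hmX s).inter ((hE s).measurableSet (hJ s))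
  have h := reveal_le r X (fun s => (E s)ᶜ) I J hI hJ hIJ hX (fun s => (hE s).compl) A (1 - ε)
    fun ω hω => by
      rw [probReal_compl_eq_one_sub ((hE _).measurableSet (hJ _))]
      linarith [hε ω hω]
  have h3 : (bits r).real {ω | X ω ∈ A} = (bits r).real {ω | X ω ∈ A ∧ ω ∈ E (X ω)} +
      (bits r).real {ω | X ω ∈ A ∧ ω ∈ (E (X ω))ᶜ} := by
    rw [← measureReal_union _ _]
    · congr 1
      ext ω
      by_cases h : ω ∈ E (X ω) <;> simp [h]
    · rw [Set.disjoint_left]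
      exact fun ω h h' => h'.2 h.2
    · have : {ω | X ω ∈ A ∧ ω ∈ (E (X ω))ᶜ} = {ω | X ω ∈ A} \ {ω | X ω ∈ A ∧ ω ∈ E (X ω)} := by
        ext ω
        by_cases h : ω ∈ E (X ω) <;> simp [h]
      rw [this]
      exact hA.diff hAE
  linarith


/-- The Harris inequality for events determined by finitely many bits. -/
lemma harris (r : ι → unitInterval) (S : Finset ι) {A B : Set (ι → Bool)}
    (hA : Dep (S : Set ι) A) (hB : Dep (S : Set ι) B) (hAm : ∀ ω ω', ω ≤ ω' → ω ∈ A → ω' ∈ A)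
    (hBm : ∀ ω ω', ω ≤ ω' → ω ∈ B → ω' ∈ B) :
    (bits r).real A * (bits r).real B ≤ (bits r).real (A ∩ B) := by
  let ext : (S → Bool) → ι → Bool := fun a i => if h : i ∈ S then a ⟨i, h⟩ else false
  let w : (S → Bool) → ℝ := fun a => ∏ i : S, if a i then (r i : ℝ) else 1 - r i
  let ind : Set (ι → Bool) → (S → Bool) → ℝ := fun A a => if ext a ∈ A then 1 else 0
  let cyl : (S → Bool) → Set (ι → Bool) := fun a => ⋂ i ∈ S.attach, {ω | ω i = a i}
  have hcyl : ∀ a ω, ω ∈ cyl a ↔ ∀ i : S, ω i = a i := by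
    intro a ω; simp [cyl]
  have hdcyl : ∀ a, Dep (S : Set ι) (cyl a) := fun a =>
    Dep.iInter fun i => Dep.iInter fun _ => dep_bit i.2 _
  have hr0 : ∀ i, 0 ≤ (r i : ℝ) := fun i => (r i).2.1
  have hr1 : ∀ i, 0 ≤ 1 - (r i : ℝ) := fun i => by linarith [(r i).2.2]
  have hw0 : 0 ≤ w := fun a => Finset.prod_nonneg fun i _ => by split_ifs <;> simp [hr0, hr1]
  have hw : ∀ a, (bits r).real (cyl a) = w a := by
    intro a
    have hb : ∀ i : S, (bits r).real {ω | ω i = a i} = if a i then (r i : ℝ) else 1 - r i :=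
      fun i => measureReal_bit r i (a i)
    simp only [cyl, w, ← hb]
    exact measureReal_iInter_of_dep r (I := fun i : S => {(i : ι)})
      (fun _ => Set.finite_singleton _)
      (fun i j hij => by simpa using hij)
      (A := fun i : S => {ω | ω i = a i}) (fun i => dep_bit (Set.mem_singleton _) _) _
  have key : ∀ A, Dep (S : Set ι) A → (bits r).real A = ∑ a, w a * ind A a := by
    intro A hA
    have h1 : A = ⋃ a ∈ (Finset.univ : Finset (S → Bool)), A ∩ cyl a := by
      ext ω
      simp only [Finset.mem_univ, Set.iUnion_true, Set.mem_iUnion, Set.mem_inter_iff, hcyl]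
      exact ⟨fun h => ⟨fun i => ω i, h, fun _ => rfl⟩, fun ⟨_, h, _⟩ => h⟩
    conv_lhs => rw [h1]
    rw [measureReal_biUnion_finset]
    · refine Finset.sum_congr rfl fun a _ => ?_
      have hx : ∀ ω ∈ cyl a, (ext a ∈ A ↔ ω ∈ A) := fun ω hω => hA.mem_iff fun i hi => by
        have := (hcyl a ω).1 hω ⟨i, hi⟩
        simp only [ext]
        rw [dif_pos (by exact hi)]
        exact this.symm
      by_cases h : ext a ∈ A
      · have : A ∩ cyl a = cyl a := Set.inter_eq_right.2 fun ω hω => (hx ω hω).1 h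
        simp [this, hw, ind, h]
      · have : A ∩ cyl a = ∅ := by
          ext ω
          simp only [Set.mem_inter_iff, Set.mem_empty_iff_false, iff_false, not_and]
          exact fun h1 h2 => h ((hx ω h2).2 h1)
        simp [this, ind, h]
    · intro a _ b _ hab
      refine Set.disjoint_left.2 fun ω h h' => hab (funext fun i => ?_)
      rw [← (hcyl a ω).1 h.2 i, (hcyl b ω).1 h'.2 i]
    · exact fun a _ => (hA.inter (hdcyl a)).measurableSet S.finite_toSet
  have hmono : ∀ A : Set (ι → Bool), (∀ ω ω', ω ≤ ω' → ω ∈ A → ω' ∈ A) → Monotone (ind A) := by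
    intro A hA a b hab
    have hle : ext a ≤ ext b := fun i => by
      simp only [ext]; split_ifs
      · exact hab _
      · exact le_rfl
    simp only [ind]
    by_cases h : ext a ∈ A
    · rw [if_pos h, if_pos (hA _ _ hle h)]
    · rw [if_neg h]; split_ifs <;> norm_num
  have hlat : ∀ a b, w a * w b ≤ w (a ⊓ b) * w (a ⊔ b) := by
    intro a b
    simp only [w, ← Finset.prod_mul_distrib]
    refine (Finset.prod_congr rfl fun i _ => ?_).le
    simp only [Pi.inf_apply, Pi.sup_apply]
    obtain ha | ha := Bool.eq_false_or_eq_true (a i) <;>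
    obtain hb | hb := Bool.eq_false_or_eq_true (b i) <;> simp [ha, hb, mul_comm]
  have hind0 : ∀ A, 0 ≤ ind A := fun A a => by simp only [ind]; split_ifs <;> simp
  have hfkg := fkg (μ := w) (f := ind A) (g := ind B) hw0 (hind0 A) (hind0 B)
    (hmono A hAm) (hmono B hBm) hlat
  have h1 : ∑ a, w a = 1 := by
    have := key Set.univ (Dep.univ _)
    simpa [ind] using this.symm
  rw [key A hA, key B hB, key _ (hA.inter hB)]
  refine hfkg.trans ?_
  rw [h1, one_mul]
  refine (Finset.sum_congr rfl fun a _ => ?_).le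
  simp only [ind, Set.mem_inter_iff]
  by_cases h : ext a ∈ A <;> by_cases h' : ext a ∈ B <;> simp [h, h']

end Bits

section ZeroOne

variable {ι V Ω : Type*}

open Relation Filter

/-- Kolmogorov's zero-one law for events that are unchanged by closing finitely many bits. -/
lemma zero_or_one_of_tail (r : ι → unitInterval) {A : Set (ι → Bool)} (hA : MeasurableSet A)
    (hinv : ∀ F : Set ι, F.Finite → ∀ ω : ι → Bool,
      (fun i => if i ∈ F then false else ω i) ∈ A ↔ ω ∈ A) :
    bits r A = 0 ∨ bits r A = 1 := by
  let s : ι → MeasurableSpace (ι → Bool) := fun i =>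
    MeasurableSpace.comap (fun ω => ω i) inferInstance
  have hind : ProbabilityTheory.iIndep s (bits r) := iIndepFun_bits r
  refine ProbabilityTheory.measure_zero_or_one_of_measurableSet_limsup (s := s) (f := cofinite)
    (p := Set.Finite) (ns := fun F : Finset ι => (F : Set ι))
    (fun i => (measurable_pi_apply i).comap_le) hind (fun t ht => ?_) ?_
    (fun F => F.finite_toSet) (fun i => ⟨{i}, by simp⟩) ?_
  · rw [mem_cofinite, compl_compl]; exact ht
  · intro F G
    exact ⟨F ∪ G, by simp, by simp⟩
  · rw [hasBasis_cofinite.limsup_eq_iInf_iSup]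
    simp only [MeasurableSpace.measurableSet_iInf]
    intro F hF
    have hm : @Measurable _ _ (⨆ a ∈ Fᶜ, s a) MeasurableSpace.pi
        (fun (ω : ι → Bool) (i : ι) => if i ∈ F then false else ω i) := by
      refine @measurable_pi_lambda _ _ _ (⨆ a ∈ Fᶜ, s a) _ _ fun i => ?_
      by_cases hi : i ∈ F
      · simp only [hi, if_true]
        exact @measurable_const _ _ _ (⨆ a ∈ Fᶜ, s a) _
      · simp only [hi, if_false]
        have h1 : s i ≤ ⨆ a ∈ Fᶜ, s a := le_iSup₂_of_le i hi le_rfl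
        exact fun t ht => h1 _ ⟨t, ht, rfl⟩
    have := hm hA
    convert this using 1
    ext ω
    exact (hinv F hF ω).symm

lemma measurableSet_reflTransGen [Countable V] [MeasurableSpace Ω] {rel : Ω → V → V → Prop}
    (h : ∀ x y, MeasurableSet {ω | rel ω x y}) (x y : V) :
    MeasurableSet {ω | ReflTransGen (rel ω) x y} := by
  let Q : ℕ → V → Set Ω := fun n => n.rec (fun y => {_ω | x = y})
    fun _ q z => ⋃ y, q y ∩ {ω | rel ω y z}
  have hQ : ∀ n y, MeasurableSet (Q n y) := by
    intro n
    induction n with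
    | zero => exact fun y => MeasurableSet.const _
    | succ n ih => exact fun z => MeasurableSet.iUnion fun y => (ih y).inter (h y z)
  have : {ω | ReflTransGen (rel ω) x y} = ⋃ n, Q n y := by
    ext ω
    simp only [Set.mem_ofPred_eq, Set.mem_iUnion]
    constructor
    · intro hr
      induction hr with
      | refl => exact ⟨0, rfl⟩
      | tail _ hbc ih =>
        obtain ⟨n, hn⟩ := ih
        exact ⟨n + 1, Set.mem_iUnion.2 ⟨_, hn, hbc⟩⟩
    · rintro ⟨n, hn⟩
      induction n generalizing y with
      | zero => obtain rfl : x = y := hn; exact .refl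
      | succ n ih =>
        obtain ⟨z, hz, hzy⟩ := Set.mem_iUnion.1 hn
        exact (ih z hz).tail hzy
  rw [this]
  exact MeasurableSet.iUnion fun n => hQ n y

lemma measurableSet_infinite_cluster [Countable V] [MeasurableSpace Ω] {rel : Ω → V → V → Prop}
    (h : ∀ x y, MeasurableSet {ω | rel ω x y}) (x : V) :
    MeasurableSet {ω | {y | ReflTransGen (rel ω) x y}.Infinite} := by
  have : {ω | {y | ReflTransGen (rel ω) x y}.Infinite} =
      ⋂ F : Finset V, ⋃ y : V, {ω | y ∉ F ∧ ReflTransGen (rel ω) x y} := by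
    ext ω
    simp only [Set.mem_ofPred_eq, Set.mem_iInter, Set.mem_iUnion]
    constructor
    · intro hi F
      obtain ⟨y, hy, hyF⟩ := hi.exists_notMem_finset F
      exact ⟨y, hyF, hy⟩
    · intro hF hfin
      obtain ⟨y, hy, hr⟩ := hF hfin.toFinset
      exact hy (by simpa using hr)
  rw [this]
  refine MeasurableSet.iInter fun F => MeasurableSet.iUnion fun y => ?_
  exact (MeasurableSet.const _).inter (measurableSet_reflTransGen h x y)

/-- Removing finitely many edges does not destroy all infinite clusters. -/
lemma exists_infinite_cluster_of_remove {rel rel' : V → V → Prop} {S : Set V} (hS : S.Finite)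
    (h : ∀ x y, rel x y → rel' x y ∨ y ∈ S) {x : V}
    (hx : {y | ReflTransGen rel x y}.Infinite) :
    ∃ z, {y | ReflTransGen rel' z y}.Infinite := by
  by_contra! hcon
  apply hx
  have hfin : (⋃ s ∈ insert x S, {y | ReflTransGen rel' s y}).Finite :=
    (hS.insert x).biUnion fun s _ => hcon s
  refine hfin.subset fun y hy => ?_
  simp only [Set.mem_iUnion, Set.mem_ofPred_eq, exists_prop] at hy ⊢
  induction hy with
  | refl => exact ⟨x, Set.mem_insert _ _, .refl⟩
  | tail _ hbc ih =>
    obtain ⟨s, hs, hsb⟩ := ih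
    rcases h _ _ hbc with h1 | h1
    · exact ⟨s, hs, hsb.tail h1⟩
    · exact ⟨_, Set.mem_insert_of_mem _ h1, .refl⟩

/-- A reachable point is reached along a self-avoiding chain. -/
lemma exists_nodup_chain {rel : V → V → Prop} {x y : V} (h : ReflTransGen rel x y) :
    ∃ l : List V, (x :: l).Nodup ∧ (x :: l).IsChain rel ∧ (x :: l).getLast? = some y := by
  induction h using ReflTransGen.head_induction_on with
  | refl => exact ⟨[], by simp⟩
  | @head a c hac _ ih =>
    obtain ⟨l, hnd, hch, hl⟩ := ih
    by_cases ha : a ∈ c :: l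
    · obtain ⟨l1, l2, he⟩ := List.append_of_mem ha
      refine ⟨l2, ?_, ?_, ?_⟩
      · rw [he] at hnd; exact hnd.of_append_right
      · rw [he] at hch; exact hch.right_of_append
      · rw [← hl, he, List.getLast?_append_of_ne_nil _ (by simp)]
    · exact ⟨c :: l, List.nodup_cons.2 ⟨ha, hnd⟩, List.isChain_cons_cons.2 ⟨hac, hch⟩, by
        rw [List.getLast?_cons_cons]; exact hl⟩

end ZeroOne

section Connectivity

open Relation

variable {V : Type*}

/-- `x` and `y` are joined by a chain of `rel`-steps inside `U`. -/
def ConnIn (rel : V → V → Prop) (U : Set V) (x y : V) : Prop :=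
  ReflTransGen (fun a b => rel a b ∧ a ∈ U ∧ b ∈ U) x y

lemma ConnIn.mono {rel : V → V → Prop} {U U' : Set V} (hU : U ⊆ U') {x y : V}
    (h : ConnIn rel U x y) : ConnIn rel U' x y :=
  ReflTransGen.mono (fun _ _ hab => ⟨hab.1, hU hab.2.1, hU hab.2.2⟩) _ _ h

/-- The first exit of a chain from `U`. -/
lemma exists_exit {rel : V → V → Prop} {U : Set V} {x y : V} (h : ReflTransGen rel x y)
    (hx : x ∈ U) (hy : y ∉ U) :
    ∃ u v, ConnIn rel U x u ∧ rel u v ∧ u ∈ U ∧ v ∉ U := by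
  have key : ConnIn rel U x y ∧ y ∈ U ∨ ∃ u v, ConnIn rel U x u ∧ rel u v ∧ u ∈ U ∧ v ∉ U := by
    clear hy
    induction h with
    | refl => exact Or.inl ⟨.refl, hx⟩
    | @tail b c _ hbc ih =>
      rcases ih with ⟨h1, h2⟩ | h
      · by_cases hc : c ∈ U
        · exact Or.inl ⟨h1.tail ⟨hbc, h2, hc⟩, hc⟩
        · exact Or.inr ⟨b, c, h1, hbc, h2, hc⟩
      · exact Or.inr h
  rcases key with ⟨_, h⟩ | h
  · exact absurd h hy
  · exact h

/-- The last exit of a chain in `U` from `R`. -/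
lemma exists_last_exit {rel : V → V → Prop} {U R : Set V} {x y : V} (h : ConnIn rel U x y)
    (hx : x ∈ R) (hy : y ∉ R) :
    ∃ u w, u ∈ R ∩ U ∧ w ∈ U \ R ∧ rel u w ∧ ConnIn rel (U \ R) w y := by
  have key : y ∈ R ∨ ∃ u w, u ∈ R ∩ U ∧ w ∈ U \ R ∧ rel u w ∧ ConnIn rel (U \ R) w y := by
    clear hy
    induction h with
    | refl => exact Or.inl hx
    | @tail b c _ hbc ih =>
      by_cases hc : c ∈ R
      · exact Or.inl hc
      · refine Or.inr ?_
        by_cases hb : b ∈ R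
        · exact ⟨b, c, ⟨hb, hbc.2.1⟩, ⟨hbc.2.2, hc⟩, hbc.1, .refl⟩
        · obtain ⟨u, w, hu, hw, huw, hwb⟩ := ih.resolve_left hb
          exact ⟨u, w, hu, hw, huw, hwb.tail ⟨hbc.1, ⟨hbc.2.1, hb⟩, hbc.2.2, hc⟩⟩
  exact key.resolve_left hy

end Connectivity

section Lattice

open Relation

variable {d : ℕ}

lemma Adj.symm {x y : ZVec d} (h : Adj d x y) : Adj d y x := by
  unfold Adj norm1 at *
  rw [← h]
  refine Finset.sum_congr rfl fun i _ => ?_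
  simp only [Pi.sub_apply]
  omega

lemma natAbs_le_norm1 (x : ZVec d) (i : Fin d) : (x i).natAbs ≤ norm1 d x :=
  Finset.single_le_sum (f := fun i => (x i).natAbs) (fun _ _ => Nat.zero_le _) (Finset.mem_univ i)

lemma Adj.abs_sub_le {x y : ZVec d} (h : Adj d x y) (i : Fin d) : |x i - y i| ≤ 1 := by
  have h1 := natAbs_le_norm1 (x - y) i
  rw [show norm1 d (x - y) = 1 from h] at h1
  simp only [Pi.sub_apply] at h1
  rw [abs_le]
  omega

lemma norm1_cast_zmod_two (x : ZVec d) : (norm1 d x : ZMod 2) = ∑ i, (x i : ZMod 2) := by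
  unfold norm1
  rw [Nat.cast_sum]
  refine Finset.sum_congr rfl fun i _ => ?_
  rcases Int.natAbs_eq (x i) with h | h
  · conv_rhs => rw [h]
    simp
  · conv_rhs => rw [h]
    simp [ZMod.neg_eq_self_mod_two]

lemma Adj.norm1_ne {x y : ZVec d} (h : Adj d x y) : norm1 d x ≠ norm1 d y := by
  intro he
  have h1 : (norm1 d (x - y) : ZMod 2) = norm1 d x - norm1 d y := by
    simp [norm1_cast_zmod_two]
  rw [show norm1 d (x - y) = 1 from h, he] at h1
  simp at h1

lemma Adj.exists_edge {x y : ZVec d} (h : Adj d x y) :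
    ∃ e : EdgeD d, e.val = (x, y) ∨ e.val = (y, x) := by
  rcases lt_or_gt_of_ne h.norm1_ne with h1 | h1
  · exact ⟨⟨(x, y), h, h1⟩, Or.inl rfl⟩
  · exact ⟨⟨(y, x), h.symm, h1⟩, Or.inr rfl⟩

instance : Countable (EdgeD d) := by unfold EdgeD; infer_instance

/-- The unordered pair of endpoints of an edge. -/
def EdgeD.pair (e : EdgeD d) : Sym2 (ZVec d) := s(e.val.1, e.val.2)

lemma EdgeD.pair_injective : Function.Injective (EdgeD.pair (d := d)) := by
  intro e f h
  unfold EdgeD.pair at h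
  rw [Sym2.eq_iff] at h
  rcases h with ⟨h1, h2⟩ | ⟨h1, h2⟩
  · exact Subtype.ext (Prod.ext h1 h2)
  · have := e.2.2
    rw [h1, h2] at this
    exact absurd this f.2.2.not_gt

lemma EdgeD.adj (e : EdgeD d) : Adj d e.val.1 e.val.2 := e.2.1

/-- The colours of the sprinkled layers. -/
abbrev Color := ZMod 8 × ZMod 8

/-- Index set of the layered configuration: for every pair of vertices a bulk bit (`none`) and one
sprinkled bit for each colour. -/
abbrev Bit (d : ℕ) := Sym2 (ZVec d) × Option Color

/-- Success probabilities of the layered configuration. -/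
def layerProb (p₀ δ : unitInterval) (i : Bit d) : unitInterval := if i.2 = none then p₀ else δ

/-- The edge `{x, y}` is open in layer `o`. -/
def Opn (o : Option Color) (ω : Bit d → Bool) (x y : ZVec d) : Prop :=
  Adj d x y ∧ ω (s(x, y), o) = true

lemma Opn.symm {o : Option Color} {ω : Bit d → Bool} {x y : ZVec d} (h : Opn o ω x y) :
    Opn o ω y x := ⟨h.1.symm, by rw [Sym2.eq_swap]; exact h.2⟩

/-- The bits of layer `o` of pairs inside `U`. -/
def bitsIn (o : Option Color) (U : Set (ZVec d)) : Set (Bit d) := {i | i.2 = o ∧ ∀ v ∈ i.1, v ∈ U}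

lemma bitsIn_mono (o : Option Color) {U U' : Set (ZVec d)} (h : U ⊆ U') :
    bitsIn o U ⊆ bitsIn o U' := fun _ hi => ⟨hi.1, fun v hv => h (hi.2 v hv)⟩

lemma finite_bitsIn (o : Option Color) {U : Set (ZVec d)} (hU : U.Finite) :
    (bitsIn o U).Finite := by
  refine ((hU.prod hU).image fun p : ZVec d × ZVec d => (s(p.1, p.2), o)).subset ?_
  rintro ⟨e, o'⟩ ⟨rfl, h⟩
  induction e using Sym2.ind with
  | _ x y => exact ⟨(x, y), ⟨h x (by simp), h y (by simp)⟩, rfl⟩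

lemma mem_bitsIn {o : Option Color} {U : Set (ZVec d)} {x y : ZVec d} (hx : x ∈ U) (hy : y ∈ U) :
    ((s(x, y), o) : Bit d) ∈ bitsIn o U := by
  refine ⟨rfl, fun v hv => ?_⟩
  rcases Sym2.mem_iff.1 hv with rfl | rfl <;> assumption

lemma connIn_congr {o : Option Color} {U : Set (ZVec d)} {ω ω' : Bit d → Bool}
    (h : ∀ i ∈ bitsIn o U, ω i = ω' i) {x y : ZVec d} (hc : ConnIn (Opn o ω) U x y) :
    ConnIn (Opn o ω') U x y := by
  refine ReflTransGen.mono (fun a b hab => ⟨⟨hab.1.1, ?_⟩, hab.2⟩) _ _ hc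
  rw [← h _ (mem_bitsIn hab.2.1 hab.2.2)]
  exact hab.1.2

lemma dep_connIn (o : Option Color) (U : Set (ZVec d)) (x y : ZVec d) :
    Dep (bitsIn o U) {ω | ConnIn (Opn o ω) U x y} := fun _ _ h hc => connIn_congr h hc

lemma connIn_le {o : Option Color} {U : Set (ZVec d)} {ω ω' : Bit d → Bool}
    (h : ω ≤ ω') {x y : ZVec d} (hc : ConnIn (Opn o ω) U x y) :
    ConnIn (Opn o ω') U x y :=
  ReflTransGen.mono (fun _ _ hab => ⟨⟨hab.1.1, Bool.eq_true_of_true_le (hab.1.2 ▸ h _)⟩, hab.2⟩)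
    _ _ hc

lemma IsBernoulli.eq_bits {p : unitInterval} {μ : Measure (Config d)} (h : IsBernoulli d p μ) :
    μ = bits fun _ => p := Perco.eq_bits _ h.2

/-- Restriction of a layered configuration to one layer. -/
def layer (o : Option Color) (ω : Bit d → Bool) : Config d := fun e => ω (e.pair, o)

lemma map_layer_none (p₀ δ : unitInterval) :
    (bits (layerProb p₀ δ)).map (layer (d := d) none) = bits fun _ => p₀ := by
  refine map_bits_injective _ _ (σ := fun e : EdgeD d => (e.pair, none)) ?_ ?_
  · intro e f h
    exact EdgeD.pair_injective (Prod.ext_iff.1 h).1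
  · intro e; simp [layerProb]

lemma measurable_layer (o : Option Color) : Measurable (layer (d := d) o) :=
  measurable_pi_lambda _ fun _ => measurable_pi_apply _

lemma opn_of_edgeOpen_layer {o : Option Color} {ω : Bit d → Bool} {x y : ZVec d}
    (h : EdgeOpen d (layer o ω) x y) : Opn o ω x y := by
  obtain ⟨e, he, ho⟩ := h
  have h1 := e.adj
  have h2 : ω (s(e.val.1, e.val.2), o) = true := ho
  rcases he with he | he
  · rw [he] at h1 h2; exact ⟨h1, h2⟩
  · rw [he] at h1 h2; exact Opn.symm ⟨h1, h2⟩

lemma reflTransGen_of_chemDist_ne_top {ω : Config d} {x y : ZVec d} (h : chemDist d ω x y ≠ ⊤) :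
    ReflTransGen (EdgeOpen d ω) x y := by
  unfold chemDist chemDistIn at h
  by_contra hcon
  apply h
  rw [sInf_eq_top]
  rintro k ⟨γ, hγ, ho, _, hx, hy, _⟩
  exfalso
  apply hcon
  have := List.relationReflTransGen_of_exists_isChain γ ho hγ.1
  rw [List.head?_eq_some_head hγ.1, Option.some_inj] at hx
  rw [List.getLast?_eq_some_getLast hγ.1, Option.some_inj] at hy
  rwa [hx, hy] at this

lemma measurableSet_bit {ι : Type*} (i : ι) : MeasurableSet {ω : ι → Bool | ω i = true} :=
  (dep_bit (Set.mem_singleton i) true).measurableSet (Set.finite_singleton i)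

lemma measurableSet_edgeOpen (x y : ZVec d) : MeasurableSet {ω : Config d | EdgeOpen d ω x y} := by
  have : {ω : Config d | EdgeOpen d ω x y} =
      ⋃ e : EdgeD d, {ω | (e.val = (x, y) ∨ e.val = (y, x)) ∧ ω e = true} := by
    ext; simp [EdgeOpen]
  rw [this]
  exact MeasurableSet.iUnion fun e => (MeasurableSet.const _).inter (measurableSet_bit e)

/-- The event that layer `none` has an infinite cluster. -/
def infEvent (d : ℕ) : Set (Bit d → Bool) :=
  {ω | ∃ x, {y | ReflTransGen (Opn none ω) x y}.Infinite}

lemma measurableSet_opn (o : Option Color) (x y : ZVec d) :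
    MeasurableSet {ω : Bit d → Bool | Opn o ω x y} :=
  (MeasurableSet.const _).inter (measurableSet_bit _)

lemma measurableSet_infEvent : MeasurableSet (infEvent d) := by
  have : infEvent d = ⋃ x, {ω | {y | ReflTransGen (Opn none ω) x y}.Infinite} := by
    ext; simp [infEvent]
  rw [this]
  exact MeasurableSet.iUnion fun x => measurableSet_infinite_cluster (measurableSet_opn none) x

lemma measure_infEvent_ne_zero {p₀ : unitInterval} (δ : unitInterval) (hp : pc d < p₀) :
    bits (layerProb p₀ δ) (infEvent d) ≠ 0 := by
  have h1 : (p₀ : ℝ) ∉ {p : ℝ | 0 ≤ p ∧ p ≤ 1 ∧ ∀ μ : Measure (Config d), IsBernoulli d p μ →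
      μ {ω | ∃ x, InInfCluster d ω x} = 0} :=
    notMem_of_csSup_lt hp ⟨1, fun p hp => hp.2.1⟩
  simp only [Set.mem_ofPred_eq, not_and, not_forall] at h1
  obtain ⟨μ, hμ, hne⟩ := h1 p₀.2.1 p₀.2.2
  intro h0
  apply hne
  let E : Set (Config d) := ⋃ x, {ω | {y | ReflTransGen (EdgeOpen d ω) x y}.Infinite}
  have hE : MeasurableSet E := MeasurableSet.iUnion fun x =>
    measurableSet_infinite_cluster measurableSet_edgeOpen x
  refine measure_mono_null (t := E) ?_ ?_
  · rintro ω ⟨x, hx⟩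
    exact Set.mem_iUnion.2 ⟨x, hx.mono fun y hy => reflTransGen_of_chemDist_ne_top hy⟩
  · rw [hμ.eq_bits, ← map_layer_none p₀ δ, Measure.map_apply (measurable_layer none) hE]
    refine measure_mono_null ?_ h0
    intro ω hω
    obtain ⟨x, hx⟩ := Set.mem_iUnion.1 hω
    exact ⟨x, hx.mono fun y hy =>
      ReflTransGen.mono (fun _ _ h => opn_of_edgeOpen_layer h) _ _ hy⟩

lemma measure_infEvent {p₀ : unitInterval} (δ : unitInterval) (hp : pc d < p₀) :
    bits (layerProb p₀ δ) (infEvent d) = 1 := by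
  refine (zero_or_one_of_tail _ measurableSet_infEvent ?_).resolve_left
    (measure_infEvent_ne_zero δ hp)
  intro F hF ω
  constructor
  · rintro ⟨x, hx⟩
    refine ⟨x, hx.mono fun y hy => ReflTransGen.mono (fun a b h => ⟨h.1, ?_⟩) _ _ hy⟩
    have := h.2
    simp only at this
    split_ifs at this
    exact this
  · rintro ⟨x, hx⟩
    refine exists_infinite_cluster_of_remove (S := ⋃ i ∈ F, {v | v ∈ i.1}) ?_ ?_ hx
    · refine hF.biUnion fun i _ => ?_
      induction i.1 using Sym2.ind with
      | _ a b => exact (Set.toFinite {a, b}).subset fun v hv => by simpa using hv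
    · intro a b hab
      by_cases h : (s(a, b), none) ∈ F
      · refine Or.inr (Set.mem_biUnion h ?_)
        simp
      · refine Or.inl ⟨hab.1, ?_⟩
        simp only [h, if_false]
        exact hab.2

end Lattice

section Contacts

open Relation

variable {d : ℕ}

/-- The box of radius `r` around `b`. -/
def Bx (b : ZVec d) (r : ℕ) : Set (ZVec d) := {v | ∀ l, |v l - b l| ≤ r}

lemma finite_Bx (b : ZVec d) (r : ℕ) : (Bx b r).Finite := by
  refine (Set.finite_Icc (fun l => b l - r) (fun l => b l + r)).subset fun v hv => ?_
  constructor <;> intro l <;> have := abs_le.1 (hv l) <;> simp only <;> omega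

lemma self_mem_Bx (b : ZVec d) (r : ℕ) : b ∈ Bx b r := fun l => by simp

lemma Bx_mono (b : ZVec d) {r r' : ℕ} (h : r ≤ r') : Bx b r ⊆ Bx b r' := fun v hv l =>
  (hv l).trans (by exact_mod_cast h)

/-- Vertices in the boundary layer of the box of radius `n` around `b` that are connected to the
box of radius `m` inside the former box. -/
def contacts (b : ZVec d) (m n : ℕ) (ω : Bit d → Bool) : Finset (ZVec d) :=
  (finite_Bx b n).toFinset.filter fun v => (∃ l, |v l - b l| = n) ∧
    ∃ u ∈ Bx b m, ConnIn (Opn none ω) (Bx b n) u v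

lemma mem_contacts {b : ZVec d} {m n : ℕ} {ω : Bit d → Bool} {v : ZVec d} :
    v ∈ contacts b m n ω ↔ v ∈ Bx b n ∧ (∃ l, |v l - b l| = n) ∧
      ∃ u ∈ Bx b m, ConnIn (Opn none ω) (Bx b n) u v := by
  simp [contacts]

lemma contacts_subset {b : ZVec d} {m n : ℕ} {ω ω' : Bit d → Bool}
    (h : ∀ u v, ConnIn (Opn none ω) (Bx b n) u v → ConnIn (Opn none ω') (Bx b n) u v) :
    contacts b m n ω ⊆ contacts b m n ω' := by
  intro v hv
  rw [mem_contacts] at hv ⊢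
  exact ⟨hv.1, hv.2.1, hv.2.2.imp fun u hu => ⟨hu.1, h _ _ hu.2⟩⟩

lemma contacts_congr {b : ZVec d} {m n : ℕ} {ω ω' : Bit d → Bool}
    (h : ∀ i ∈ bitsIn none (Bx b n), ω i = ω' i) : contacts b m n ω = contacts b m n ω' :=
  Finset.Subset.antisymm (contacts_subset fun _ _ => connIn_congr h)
    (contacts_subset fun _ _ => connIn_congr fun i hi => (h i hi).symm)

lemma mem_contacts_of_exit {b : ZVec d} {m n : ℕ} (hmn : m ≤ n) {ω : Bit d → Bool}
    {u v : ZVec d} (hu : u ∈ Bx b m) (hv : v ∉ Bx b n) (h : ReflTransGen (Opn none ω) u v) :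
    ∃ a c, a ∈ contacts b m n ω ∧ c ∉ Bx b n ∧ Opn none ω a c := by
  obtain ⟨a, c, h1, h2, h3, h4⟩ := exists_exit h (Bx_mono b hmn hu) hv
  refine ⟨a, c, mem_contacts.2 ⟨h3, ?_, u, hu, h1⟩, h4, h2⟩
  simp only [Bx, Set.mem_ofPred_eq, not_forall, not_le] at h4
  obtain ⟨l, hl⟩ := h4
  refine ⟨l, ?_⟩
  have h5 := h3 l
  have h6 := h2.1.abs_sub_le l
  rw [abs_le] at h5 h6
  rw [lt_abs] at hl
  rcases hl with hl | hl
  · rw [abs_of_nonneg] <;> omega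
  · rw [abs_of_nonpos] <;> omega

lemma exists_hit {p₀ : unitInterval} (δ : unitInterval) (hp : pc d < p₀) {η : ℝ} (hη : 0 < η) :
    ∃ m : ℕ, ∀ n, m ≤ n →
      1 - η ≤ (bits (layerProb p₀ δ)).real {ω | (contacts (0 : ZVec d) m n ω).Nonempty} := by
  let E : ℕ → Set (Bit d → Bool) := fun m =>
    ⋃ x ∈ Bx (0 : ZVec d) m, {ω | {y | ReflTransGen (Opn none ω) x y}.Infinite}
  have hmono : Monotone E := fun m m' h => Set.biUnion_subset_biUnion_left (Bx_mono 0 h)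
  have hU : ⋃ m, E m = infEvent d := by
    ext ω
    simp only [E, Set.mem_iUnion, infEvent, Set.mem_ofPred_eq, exists_prop]
    constructor
    · rintro ⟨m, x, _, h⟩; exact ⟨x, h⟩
    · rintro ⟨x, h⟩
      refine ⟨norm1 d x, x, fun l => ?_, h⟩
      have := natAbs_le_norm1 x l
      rw [Pi.zero_apply, sub_zero, Int.abs_eq_natAbs]
      exact_mod_cast this
  have ht := tendsto_measure_iUnion_atTop (μ := bits (layerProb p₀ δ)) hmono
  rw [hU, measure_infEvent δ hp] at ht
  have ht' : Filter.Tendsto (fun m => (bits (layerProb p₀ δ)).real (E m)) Filter.atTop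
      (nhds 1) := by
    exact (ENNReal.tendsto_toReal ENNReal.one_ne_top).comp ht
  obtain ⟨m, hm⟩ := (ht'.eventually (lt_mem_nhds (show 1 - η < 1 by linarith))).exists
  refine ⟨m, fun n hmn => hm.le.trans (measureReal_mono ?_)⟩
  intro ω hω
  simp only [E, Set.mem_iUnion, exists_prop] at hω
  obtain ⟨x, hx, hinf⟩ := hω
  obtain ⟨y, hy, hyn⟩ := hinf.exists_notMem_finset (finite_Bx 0 n).toFinset
  obtain ⟨a, _, ha, _⟩ := mem_contacts_of_exit hmn hx (by simpa using hyn) hy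
  exact ⟨a, ha⟩

/-- Probability that all bits of a finite set of bits are closed. -/
lemma measureReal_closed {ι : Type*} (r : ι → unitInterval) (J : Finset ι) (b : Bool) :
    (bits r).real {ω | ∀ i ∈ J, ω i = b} = ∏ i ∈ J, if b then (r i : ℝ) else 1 - r i := by
  have h := measureReal_iInter_of_dep r (I := fun i : ι => {i}) (fun _ => Set.finite_singleton _)
    (fun i j hij => by simpa using hij) (A := fun i => {ω | ω i = b})
    (fun i => dep_bit (Set.mem_singleton _) _) J
  simp only [measureReal_bit] at h
  rw [← h]
  congr 1
  ext ω; simp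

lemma one_sub_pow_le_closed {ι : Type*} (r : ι → unitInterval) (J : Finset ι) {q : unitInterval}
    (hq : ∀ i ∈ J, r i = q) {k : ℕ} (hk : J.card ≤ k) :
    (1 - (q : ℝ)) ^ k ≤ (bits r).real {ω | ∀ i ∈ J, ω i = false} := by
  rw [measureReal_closed, Finset.prod_congr rfl (g := fun _ => 1 - (q : ℝ)), Finset.prod_const]
  · exact pow_le_pow_of_le_one (by linarith [q.2.2]) (by linarith [q.2.1]) hk
  · intro i hi; simp [hq i hi]

lemma dep_forall_mem {ι : Type*} (J : Finset ι) (b : Bool) :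
    Dep (J : Set ι) {ω : ι → Bool | ∀ i ∈ J, ω i = b} :=
  dep_of_congr fun _ _ h => forall₂_congr fun i hi => by rw [h i hi]

lemma few_contacts_le {p₀ δ : unitInterval} {m n : ℕ} (hmn : m ≤ n) (M : ℕ) :
    (1 - (p₀ : ℝ)) ^ (M * (finite_Bx (0 : ZVec d) 1).toFinset.card) *
      (bits (layerProb p₀ δ)).real {ω | (contacts (0 : ZVec d) m n ω).Nonempty ∧
        (contacts (0 : ZVec d) m n ω).card < M} ≤
    (bits (layerProb p₀ δ)).real {ω | (contacts (0 : ZVec d) m n ω).Nonempty} -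
    (bits (layerProb p₀ δ)).real {ω | (contacts (0 : ZVec d) m (n + 1) ω).Nonempty} := by
  let nb := (finite_Bx (0 : ZVec d) 1).toFinset
  let J : Finset (ZVec d) → Finset (Bit d) := fun z =>
    ((z ×ˢ nb).filter fun q => q.1 + q.2 ∉ Bx (0 : ZVec d) n).image
      fun q => (s(q.1, q.1 + q.2), none)
  have hJnone : ∀ z, ∀ i ∈ J z, i.2 = none ∧ ∃ v ∈ i.1, v ∉ Bx (0 : ZVec d) n := by
    intro z i hi
    simp only [J, Finset.mem_image, Finset.mem_filter] at hi
    obtain ⟨q, hq, rfl⟩ := hi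
    exact ⟨rfl, _, by simp, hq.2⟩
  have hX : ∀ z, Dep (bitsIn none (Bx (0 : ZVec d) n)) {ω | contacts (0 : ZVec d) m n ω = z} :=
    fun z => dep_of_congr fun ω ω' h => by rw [contacts_congr h]
  have hle := le_reveal (layerProb p₀ δ) (contacts (0 : ZVec d) m n)
    (fun z => {ω | ∀ i ∈ J z, ω i = false}) (fun _ => bitsIn none (Bx 0 n)) (fun z => J z)
    (fun _ => finite_bitsIn none (finite_Bx 0 n)) (fun z => (J z).finite_toSet) ?_ hX
    (fun z => dep_forall_mem _ _) {z | z.Nonempty ∧ z.card < M}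
    ((1 - (p₀ : ℝ)) ^ (M * nb.card)) ?_
  · refine hle.trans ?_
    have hsub : {ω : Bit d → Bool | (contacts (0 : ZVec d) m (n + 1) ω).Nonempty} ⊆
        {ω | (contacts (0 : ZVec d) m n ω).Nonempty} \
        {ω | contacts (0 : ZVec d) m n ω ∈ {z : Finset (ZVec d) | z.Nonempty ∧ z.card < M} ∧
          ω ∈ {ω | ∀ i ∈ J (contacts (0 : ZVec d) m n ω), ω i = false}} := by
      rintro ω ⟨v, hv⟩
      rw [mem_contacts] at hv
      obtain ⟨_, ⟨l, hl⟩, u, hu, hc⟩ := hv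
      have hvn : v ∉ Bx (0 : ZVec d) n := fun h => by
        have := h l
        rw [hl] at this
        push_cast at this
        omega
      obtain ⟨a, c, ha, hcn, hac⟩ := mem_contacts_of_exit hmn hu hvn
        (ReflTransGen.mono (fun _ _ h => h.1) _ _ hc)
      refine ⟨⟨a, ha⟩, fun h => ?_⟩
      have h1 := h.2 (s(a, c), none) ?_
      · rw [hac.2] at h1; exact absurd h1 (by simp)
      · simp only [J, Finset.mem_image, Finset.mem_filter, Finset.mem_product]
        refine ⟨(a, c - a), ⟨⟨ha, ?_⟩, by simpa using hcn⟩, by simp⟩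
        simp only [nb, Set.Finite.mem_toFinset]
        intro l
        simpa using hac.1.symm.abs_sub_le l
    have hd1 : Dep (bitsIn none (Bx (0 : ZVec d) n) ∪
        ⋃ z ∈ ((finite_Bx (0 : ZVec d) n).toFinset).powerset, (J z : Set (Bit d)))
        {ω | contacts (0 : ZVec d) m n ω ∈ {z : Finset (ZVec d) | z.Nonempty ∧ z.card < M} ∧
          ω ∈ {ω | ∀ i ∈ J (contacts (0 : ZVec d) m n ω), ω i = false}} := by
      refine dep_of_congr fun ω ω' h => ?_
      have he : contacts (0 : ZVec d) m n ω = contacts (0 : ZVec d) m n ω' :=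
        contacts_congr fun i hi => h i (Or.inl hi)
      change (_ ∧ ∀ i ∈ J _, ω i = false) ↔ (_ ∧ ∀ i ∈ J _, ω' i = false)
      rw [← he]
      refine and_congr Iff.rfl ?_
      refine forall₂_congr fun i hi => ?_
      rw [h i]
      refine Or.inr (Set.mem_biUnion (x := contacts (0 : ZVec d) m n ω) ?_ hi)
      exact Finset.mem_powerset.2 (Finset.filter_subset _ _)
    have hm1 := hd1.measurableSet ((finite_bitsIn none (finite_Bx 0 n)).union
      ((Finset.finite_toSet _).biUnion fun z _ => (J z).finite_toSet))
    have h3 := measureReal_mono (μ := bits (layerProb p₀ δ)) hsub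
    rw [measureReal_sdiff (show _ ⊆ {ω | (contacts (0 : ZVec d) m n ω).Nonempty} from
      fun ω hω => hω.1.1) hm1] at h3
    exact le_sub_comm.1 h3
  · intro z
    rw [Set.disjoint_left]
    intro i hi hiJ
    obtain ⟨_, v, hv, hvn⟩ := hJnone z i hiJ
    exact hvn (hi.2 v hv)
  · intro ω hω
    refine one_sub_pow_le_closed _ _ (fun i hi => ?_) ?_
    · simp [layerProb, (hJnone _ i hi).1]
    · refine Finset.card_image_le.trans ((Finset.card_filter_le _ _).trans ?_)
      rw [Finset.card_product]
      exact Nat.mul_le_mul_right _ hω.2.le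

lemma exists_many_contacts {p₀ : unitInterval} (δ : unitInterval) (hp : pc d < p₀)
    (hp1 : (p₀ : ℝ) < 1)
    {η : ℝ} (hη : 0 < η) : ∃ m : ℕ, ∀ M N : ℕ, ∃ n, m ≤ n ∧ N ≤ n ∧
      1 - η ≤ (bits (layerProb p₀ δ)).real {ω | M ≤ (contacts (0 : ZVec d) m n ω).card} := by
  obtain ⟨m, hm⟩ := exists_hit (d := d) δ hp (half_pos hη)
  refine ⟨m, fun M N => ?_⟩
  let κ := (finite_Bx (0 : ZVec d) 1).toFinset.card
  let τ : ℝ := (1 - (p₀ : ℝ)) ^ (M * κ)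
  have hτ : 0 < τ := pow_pos (by linarith) _
  let a : ℕ → ℝ := fun n =>
    (bits (layerProb p₀ δ)).real {ω | (contacts (0 : ZVec d) m n ω).Nonempty}
  have hex : ∃ n, max m N ≤ n ∧ a n - a (n + 1) ≤ τ * (η / 2) := by
    by_contra! hcon
    have h1 : ∀ k : ℕ, a (max m N + k) ≤ 1 - k * (τ * (η / 2)) := by
      intro k
      induction k with
      | zero => simpa using measureReal_le_one
      | succ k ih =>
        have := hcon (max m N + k) (by omega)
        push_cast
        rw [← add_assoc]
        linarith
    obtain ⟨k, hk⟩ := exists_nat_gt (1 / (τ * (η / 2)))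
    have h2 := h1 k
    have h3 : 0 ≤ a (max m N + k) := measureReal_nonneg
    rw [div_lt_iff₀ (by positivity)] at hk
    linarith
  obtain ⟨n, hn, hτn⟩ := hex
  refine ⟨n, by omega, by omega, ?_⟩
  have h1 := few_contacts_le (d := d) (p₀ := p₀) (δ := δ) (show m ≤ n by omega) M
  have h2 : (bits (layerProb p₀ δ)).real {ω | (contacts (0 : ZVec d) m n ω).Nonempty ∧
        (contacts (0 : ZVec d) m n ω).card < M} ≤ η / 2 := by
    refine le_of_mul_le_mul_left (h1.trans hτn) hτ
  have h3 := hm n (by omega)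
  have h4 : (bits (layerProb p₀ δ)).real {ω | (contacts (0 : ZVec d) m n ω).Nonempty} ≤
      (bits (layerProb p₀ δ)).real {ω | (contacts (0 : ZVec d) m n ω).Nonempty ∧
        (contacts (0 : ZVec d) m n ω).card < M} +
      (bits (layerProb p₀ δ)).real {ω | M ≤ (contacts (0 : ZVec d) m n ω).card} := by
    refine (measureReal_mono ?_).trans (measureReal_union_le _ _)
    intro ω hω
    by_cases h : M ≤ (contacts (0 : ZVec d) m n ω).card
    · exact Or.inr h
    · exact Or.inl ⟨hω, not_le.1 h⟩
  linarith

end Contacts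

section Targets

open Relation

variable {d : ℕ}

/-- The part of the face of the box of radius `n` around `b` in direction `i`, orthant `σ`. -/
def Tgt (n : ℕ) (b : ZVec d) (i : Fin d) (σ : Fin d → ℤˣ) : Set (ZVec d) :=
  {v | σ i * (v i - b i) = n ∧ ∀ l, 0 ≤ σ l * (v l - b l) ∧ σ l * (v l - b l) ≤ n}

/-- The contact vertices in a given target. -/
def tgtContacts (b : ZVec d) (m n : ℕ) (i : Fin d) (σ : Fin d → ℤˣ) (ω : Bit d → Bool) :
    Finset (ZVec d) :=
  (contacts b m n ω).filter (· ∈ Tgt n b i σ)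

lemma abs_units_mul (s : ℤˣ) (a : ℤ) : |(s : ℤ) * a| = |a| := by
  rcases Int.units_eq_one_or s with rfl | rfl <;> simp

lemma units_mul_units_mul (s : ℤˣ) (a : ℤ) : (s : ℤ) * (s * a) = a := by
  rcases Int.units_eq_one_or s with rfl | rfl <;> simp

/-- The lattice isometry taking a target around `b` to a target around `b'`. -/
def moveTgt (b b' : ZVec d) (i i' : Fin d) (σ σ' : Fin d → ℤˣ) (u : ZVec d) : ZVec d :=
  fun l => b' l + σ' l * (σ (Equiv.swap i i' l) * (u (Equiv.swap i i' l) - b (Equiv.swap i i' l)))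

lemma moveTgt_sub (b b' : ZVec d) (i i' : Fin d) (σ σ' : Fin d → ℤˣ) (u : ZVec d) (l : Fin d) :
    σ' l * (moveTgt b b' i i' σ σ' u l - b' l) =
      σ (Equiv.swap i i' l) * (u (Equiv.swap i i' l) - b (Equiv.swap i i' l)) := by
  simp only [moveTgt, add_sub_cancel_left, units_mul_units_mul]

lemma abs_moveTgt_sub (b b' : ZVec d) (i i' : Fin d) (σ σ' : Fin d → ℤˣ) (u : ZVec d)
    (l : Fin d) : |moveTgt b b' i i' σ σ' u l - b' l| =
      |u (Equiv.swap i i' l) - b (Equiv.swap i i' l)| := by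
  rw [← abs_units_mul (σ' l), moveTgt_sub, abs_units_mul]

lemma moveTgt_mem_Bx {b : ZVec d} (b' : ZVec d) (i i' : Fin d) (σ σ' : Fin d → ℤˣ) {u : ZVec d}
    {r : ℕ} (h : u ∈ Bx b r) : moveTgt b b' i i' σ σ' u ∈ Bx b' r := fun l => by
  rw [abs_moveTgt_sub]; exact h _

lemma adj_moveTgt (b b' : ZVec d) (i i' : Fin d) (σ σ' : Fin d → ℤˣ) {u v : ZVec d}
    (h : Adj d u v) : Adj d (moveTgt b b' i i' σ σ' u) (moveTgt b b' i i' σ σ' v) := by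
  unfold Adj norm1 at *
  rw [← h, ← Equiv.sum_comp (Equiv.swap i i') fun l => ((u - v) l).natAbs]
  refine Finset.sum_congr rfl fun l _ => ?_
  have : (moveTgt b b' i i' σ σ' u - moveTgt b b' i i' σ σ' v) l = σ' l * (σ (Equiv.swap i i' l) *
      (u (Equiv.swap i i' l) - v (Equiv.swap i i' l))) := by
    simp only [moveTgt, Pi.sub_apply]; ring
  rw [this, Int.natAbs_mul, Int.natAbs_mul]
  simp

lemma moveTgt_injective (b b' : ZVec d) (i i' : Fin d) (σ σ' : Fin d → ℤˣ) :
    Function.Injective (moveTgt b b' i i' σ σ') := by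
  intro u v h
  funext l
  have h1 := moveTgt_sub b b' i i' σ σ' u (Equiv.swap i i' l)
  have h2 := moveTgt_sub b b' i i' σ σ' v (Equiv.swap i i' l)
  rw [h, h2] at h1
  simp only [Equiv.swap_apply_self] at h1
  have h3 := mul_left_cancel₀ (Units.ne_zero (σ l)) h1
  linarith

lemma measureReal_tgtContacts_le (r₀ δ : unitInterval) (b b' : ZVec d) (m n : ℕ) (i i' : Fin d)
    (σ σ' : Fin d → ℤˣ) (M : ℕ) :
    (bits (layerProb r₀ δ)).real {ω | M ≤ (tgtContacts b m n i σ ω).card} ≤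
      (bits (layerProb r₀ δ)).real {ω | M ≤ (tgtContacts b' m n i' σ' ω).card} := by
  let φ := moveTgt b b' i i' σ σ'
  let s : Bit d → Bit d := fun e => (Sym2.map φ e.1, e.2)
  have hs : Function.Injective s := by
    rintro ⟨e, o⟩ ⟨e', o'⟩ h
    simp only [s, Prod.mk.injEq] at h
    rw [Sym2.map.injective (moveTgt_injective b b' i i' σ σ') h.1, h.2]
  have hmap := map_bits_injective (layerProb r₀ δ) (layerProb r₀ δ) hs fun e => rfl
  have hcongr : ∀ ω ω' : Bit d → Bool, (∀ i ∈ bitsIn none (Bx b n), ω i = ω' i) →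
      tgtContacts b m n i σ ω = tgtContacts b m n i σ ω' := fun ω ω' h => by
    rw [tgtContacts, contacts_congr h, tgtContacts]
  have hm : MeasurableSet {ω | M ≤ (tgtContacts b m n i σ ω).card} :=
    (dep_of_congr fun ω ω' h => by rw [hcongr ω ω' h]).measurableSet
      (finite_bitsIn none (finite_Bx b n))
  conv_lhs => rw [← hmap]
  rw [map_measureReal_apply (measurable_pi_lambda _ fun _ => measurable_pi_apply _) hm]
  refine measureReal_mono fun ω hω => ?_
  refine le_trans (b := (tgtContacts b m n i σ fun e => ω (s e)).card) hω ?_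
  refine Finset.card_le_card_of_injOn φ ?_ (moveTgt_injective b b' i i' σ σ').injOn
  intro v hv
  simp only [Finset.mem_coe, tgtContacts, Finset.mem_filter, mem_contacts] at hv ⊢
  obtain ⟨⟨h1, ⟨l, hl⟩, u, hu, huv⟩, hT⟩ := hv
  refine ⟨⟨moveTgt_mem_Bx b' i i' σ σ' h1, ⟨Equiv.swap i i' l, ?_⟩, φ u,
    moveTgt_mem_Bx b' i i' σ σ' hu, ?_⟩, ?_, fun k => ?_⟩
  · rw [abs_moveTgt_sub, Equiv.swap_apply_self, hl]
  · refine ReflTransGen.lift φ (fun a c hac => ?_) _ _ huv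
    exact ⟨⟨adj_moveTgt b b' i i' σ σ' hac.1.1, hac.1.2⟩,
      moveTgt_mem_Bx b' i i' σ σ' hac.2.1, moveTgt_mem_Bx b' i i' σ σ' hac.2.2⟩
  · rw [moveTgt_sub, Equiv.swap_apply_right, hT.1]
  · rw [moveTgt_sub]; exact hT.2 _

lemma prod_one_sub_le {ι κ : Type*} (r : ι → unitInterval) (S : Finset ι) (s : Finset κ)
    (A : κ → Set (ι → Bool)) (hd : ∀ k, Dep (S : Set ι) (A k))
    (hA : ∀ k ω ω', ω ≤ ω' → ω ∈ A k → ω' ∈ A k) :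
    ∏ k ∈ s, (1 - (bits r).real (A k)) ≤ 1 - (bits r).real (⋃ k ∈ s, A k) := by
  induction s using Finset.induction_on with
  | empty => simp
  | insert a s has ih =>
    rw [Finset.prod_insert has, Finset.set_biUnion_insert]
    have hdU : Dep (S : Set ι) (⋃ k ∈ s, A k) := Dep.iUnion fun k => Dep.iUnion fun _ => hd k
    have h1 := harris r S (hd a) hdU (hA a) fun ω ω' h hω => by
      simp only [Set.mem_iUnion] at hω ⊢
      exact hω.imp fun k hk => hk.imp fun hks hk' => hA k ω ω' h hk'
    have h2 := measureReal_union_add_inter (μ := bits r) (s := A a)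
      (hdU.measurableSet S.finite_toSet) (measure_ne_top _ _) (measure_ne_top _ _)
    have h3 : (bits r).real (A a) ≤ 1 := measureReal_le_one
    nlinarith

/-- Every target around every vertex receives many contacts with high probability. -/
lemma exists_many_tgtContacts {p₀ : unitInterval} (δ : unitInterval) (hp : pc d < p₀)
    (hp1 : (p₀ : ℝ) < 1) {η : ℝ} (hη : 0 < η) : ∃ m : ℕ, ∀ M N : ℕ, ∃ n, m ≤ n ∧ N ≤ n ∧
      ∀ (b : ZVec d) i σ, 1 - η ≤
        (bits (layerProb p₀ δ)).real {ω | M ≤ (tgtContacts b m n i σ ω).card} := by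
  let K := Fintype.card (Fin d × (Fin d → ℤˣ))
  obtain ⟨m, hm⟩ := exists_many_contacts (d := d) δ hp hp1 (pow_pos hη K)
  refine ⟨m, fun M N => ?_⟩
  obtain ⟨n, hmn, hNn, hn⟩ := hm (K * M + 1) N
  refine ⟨n, hmn, hNn, fun b i σ => ?_⟩
  let A : Fin d × (Fin d → ℤˣ) → Set (Bit d → Bool) := fun k =>
    {ω | M ≤ (tgtContacts (0 : ZVec d) m n k.1 k.2 ω).card}
  have hsub : ∀ ω ω' : Bit d → Bool, (∀ u v, ConnIn (Opn none ω) (Bx 0 n) u v →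
      ConnIn (Opn none ω') (Bx 0 n) u v) → ∀ k, ω ∈ A k → ω' ∈ A k := fun ω ω' h k hk =>
    le_trans (b := (tgtContacts (0 : ZVec d) m n k.1 k.2 ω).card) hk
      (Finset.card_le_card (Finset.filter_subset_filter _ (contacts_subset h)))
  have hS := finite_bitsIn (d := d) none (finite_Bx 0 n)
  have hprod := prod_one_sub_le (layerProb p₀ δ) hS.toFinset Finset.univ A
    (fun k ω ω' h => hsub ω ω' (fun u v => connIn_congr fun i hi => h i (by simpa using hi)) k)
    (fun k ω ω' h => hsub ω ω' (fun u v => connIn_le h) k)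
  have hunion : {ω | K * M + 1 ≤ (contacts (0 : ZVec d) m n ω).card} ⊆
      ⋃ k ∈ (Finset.univ : Finset (Fin d × (Fin d → ℤˣ))), A k := by
    intro ω hω
    simp only [Finset.mem_univ, Set.iUnion_true, Set.mem_iUnion]
    by_contra! hcon
    have hc : contacts (0 : ZVec d) m n ω ⊆ (Finset.univ : Finset (Fin d × (Fin d → ℤˣ))).biUnion
        fun k => tgtContacts (0 : ZVec d) m n k.1 k.2 ω := by
      intro v hv
      obtain ⟨h1, ⟨l, hl⟩, _⟩ := mem_contacts.1 hv
      let τ : Fin d → ℤˣ := fun l => if 0 ≤ v l then 1 else -1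
      have hτ : ∀ l, (τ l : ℤ) * v l = |v l| := fun l => by
        by_cases h : 0 ≤ v l
        · simp [τ, h, abs_of_nonneg h]
        · simp [τ, h, abs_of_neg (not_le.1 h)]
      refine Finset.mem_biUnion.2 ⟨(l, τ), Finset.mem_univ _, Finset.mem_filter.2 ⟨hv, ?_⟩⟩
      refine ⟨?_, fun k => ?_⟩
      · simpa [hτ] using hl
      · have := h1 k
        simp only [Pi.zero_apply, sub_zero] at this ⊢
        rw [hτ]
        exact ⟨abs_nonneg _, this⟩
    have h2 := (Finset.card_le_card hc).trans
      (Finset.card_biUnion_le_card_mul _ _ M fun k _ => (not_le.1 (hcon k)).le)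
    rw [Finset.card_univ] at h2
    exact absurd (show K * M + 1 ≤ _ from hω) (not_le.2 (Nat.lt_succ_of_le h2))
  have h1 := hn.trans (measureReal_mono hunion (measure_ne_top _ _))
  have h2 : (1 - (bits (layerProb p₀ δ)).real
      {ω | M ≤ (tgtContacts b m n i σ ω).card}) ^ K ≤ η ^ K := by
    refine le_trans ?_ (hprod.trans (by linarith))
    rw [show K = Finset.card (Finset.univ : Finset (Fin d × (Fin d → ℤˣ))) from rfl,
      ← Finset.prod_const]
    refine Finset.prod_le_prod (fun _ _ => ?_) fun k _ => ?_
    · linarith [measureReal_le_one (μ := bits (layerProb p₀ δ))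
        (s := {ω | M ≤ (tgtContacts b m n i σ ω).card})]
    · linarith [measureReal_tgtContacts_le p₀ δ 0 b m n k.1 i k.2 σ M]
  have : Nonempty (Fin d × (Fin d → ℤˣ)) := ⟨(i, σ)⟩
  have hK : K ≠ 0 := Fintype.card_ne_zero
  linarith [le_of_pow_le_pow_left₀ hK hη.le h2]

end Targets

section Seeds

open Relation

variable {d : ℕ}

lemma card_Bx (b : ZVec d) (r : ℕ) : (finite_Bx b r).toFinset.card = (2 * r + 1) ^ d := by
  have : (finite_Bx b r).toFinset = Finset.Icc (fun l => b l - r) (fun l => b l + r) := by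
    ext v
    simp only [Set.Finite.mem_toFinset, Finset.mem_Icc, Pi.le_def, ← forall_and, Bx,
      Set.mem_ofPred_eq, abs_le]
    exact forall_congr' fun l => by constructor <;> intro h <;> constructor <;> omega
  rw [this, Pi.card_Icc]
  simp only [Int.card_Icc]
  rw [Finset.prod_congr rfl (g := fun _ => 2 * r + 1), Finset.prod_const, Finset.card_univ,
    Fintype.card_fin]
  intro l _
  omega

/-- Centre of the seed attached to `v` in direction `i`. -/
def nxt (m : ℕ) (i : Fin d) (σ : Fin d → ℤˣ) (v : ZVec d) : ZVec d :=
  fun l => v l + if l = i then (σ i : ℤ) * (m + 1) else 0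

/-- The bits of colour `c` that have to be open for the seed attached to `v` to be open. -/
def seedBits (c : Color) (m : ℕ) (i : Fin d) (σ : Fin d → ℤˣ) (v : ZVec d) : Set (Bit d) :=
  {e ∈ bitsIn (some c) (insert v (Bx (nxt m i σ v) m)) | ∃ u ∈ e.1, u ∈ Bx (nxt m i σ v) m}

/-- The seed attached to `v` is open. -/
def SeedOpen (c : Color) (m : ℕ) (i : Fin d) (σ : Fin d → ℤˣ) (v : ZVec d) (ω : Bit d → Bool) :
    Prop := ∀ e ∈ seedBits c m i σ v, ω e = true

lemma finite_seedBits (c : Color) (m : ℕ) (i : Fin d) (σ : Fin d → ℤˣ) (v : ZVec d) :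
    (seedBits c m i σ v).Finite :=
  (finite_bitsIn _ ((finite_Bx _ _).insert _)).subset fun _ he => he.1

lemma seedOpen_congr {c : Color} {m : ℕ} {i : Fin d} {σ : Fin d → ℤˣ} {v : ZVec d}
    {ω ω' : Bit d → Bool} (h : ∀ e ∈ seedBits c m i σ v, ω e = ω' e) :
    SeedOpen c m i σ v ω ↔ SeedOpen c m i σ v ω' :=
  forall₂_congr fun e he => by rw [h e he]

lemma abs_nxt_sub (m : ℕ) (i : Fin d) (σ : Fin d → ℤˣ) (v : ZVec d) (l : Fin d) :
    |nxt m i σ v l - v l| ≤ m + 1 := by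
  simp only [nxt, add_sub_cancel_left]
  split_ifs
  · rw [abs_units_mul, abs_of_nonneg (by positivity)]
  · simp only [abs_zero]; positivity

lemma seedSet_subset (m : ℕ) (i : Fin d) (σ : Fin d → ℤˣ) (v : ZVec d) :
    insert v (Bx (nxt m i σ v) m) ⊆ Bx (nxt m i σ v) (m + 1) := by
  refine Set.insert_subset (fun l => ?_) (Bx_mono _ (by omega))
  rw [abs_sub_comm]
  exact_mod_cast abs_nxt_sub m i σ v l

lemma card_seedBits_le (c : Color) (m : ℕ) (i : Fin d) (σ : Fin d → ℤˣ) (v : ZVec d) :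
    (finite_seedBits c m i σ v).toFinset.card ≤ (2 * (m + 1) + 1) ^ d * (2 * (m + 1) + 1) ^ d := by
  rw [← card_Bx (nxt m i σ v) (m + 1), ← Finset.card_product]
  refine (Finset.card_le_card (t := Finset.image (fun q => (s(q.1, q.2), some c)) _) ?_).trans
    Finset.card_image_le
  rintro ⟨e, o⟩ he
  simp only [Set.Finite.mem_toFinset] at he
  obtain ⟨⟨rfl, h⟩, _⟩ := he
  induction e using Sym2.ind with
  | _ x y =>
    refine Finset.mem_image.2 ⟨(x, y), ?_, rfl⟩
    simp only [Finset.mem_product, Set.Finite.mem_toFinset]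
    exact ⟨seedSet_subset m i σ v (h x (by simp)), seedSet_subset m i σ v (h y (by simp))⟩

lemma disjoint_bitsIn {o : Option Color} {U U' : Set (ZVec d)} (h : Disjoint U U') :
    Disjoint (bitsIn o U) (bitsIn o U') := by
  rw [Set.disjoint_left]
  rintro ⟨e, o'⟩ h1 h2
  induction e using Sym2.ind with
  | _ x y => exact Set.disjoint_left.1 h (h1.2 x (by simp)) (h2.2 x (by simp))

lemma disjoint_Bx {b b' : ZVec d} {r : ℕ} {l : Fin d} (h : 2 * r < |b l - b' l|) :
    Disjoint (Bx b r) (Bx b' r) := by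
  rw [Set.disjoint_left]
  intro x hx hx'
  have h1 := hx l
  have h2 := hx' l
  rw [abs_le] at h1 h2
  rw [lt_abs] at h
  omega

lemma disjoint_seedBits {c : Color} {m : ℕ} {i : Fin d} {σ : Fin d → ℤˣ} {v v' : ZVec d}
    {l : Fin d} (h : 2 * (m + 1) < |v l - v' l|) :
    Disjoint (seedBits c m i σ v) (seedBits c m i σ v') := by
  refine Disjoint.mono (fun _ he => he.1) (fun _ he => he.1) (disjoint_bitsIn ?_)
  refine Disjoint.mono (seedSet_subset m i σ v) (seedSet_subset m i σ v')
    (disjoint_Bx (l := l) ?_)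
  push_cast
  simpa [nxt] using h

lemma measureReal_seedOpen_ge {p₀ δ : unitInterval} (c : Color) (m : ℕ) (i : Fin d)
    (σ : Fin d → ℤˣ) (v : ZVec d) :
    (δ : ℝ) ^ ((2 * (m + 1) + 1) ^ d * (2 * (m + 1) + 1) ^ d) ≤
      (bits (layerProb p₀ δ)).real {ω | SeedOpen c m i σ v ω} := by
  have h := measureReal_closed (layerProb p₀ δ) (finite_seedBits c m i σ v).toFinset true
  simp only [Set.Finite.mem_toFinset, if_true] at h
  change _ ≤ (bits (layerProb p₀ δ)).real {ω | ∀ e ∈ seedBits c m i σ v, ω e = true}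
  rw [h, Finset.prod_congr rfl (g := fun _ => (δ : ℝ)), Finset.prod_const]
  · exact pow_le_pow_of_le_one δ.2.1 δ.2.2 (card_seedBits_le c m i σ v)
  · intro e he
    simp only [Set.Finite.mem_toFinset] at he
    simp [layerProb, he.1.1]

lemma no_seed_le {p₀ δ : unitInterval} (c : Color) (m : ℕ) (i : Fin d) (σ : Fin d → ℤˣ)
    (z : Finset (ZVec d)) (M : ℕ) (hz : (2 * (m + 1) + 1) ^ d * M ≤ z.card) :
    (bits (layerProb p₀ δ)).real {ω | ∀ v ∈ z, ¬ SeedOpen c m i σ v ω} ≤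
      (1 - (δ : ℝ) ^ ((2 * (m + 1) + 1) ^ d * (2 * (m + 1) + 1) ^ d)) ^ M := by
  have : NeZero (2 * (m + 1) + 1) := ⟨by omega⟩
  obtain ⟨y, -, hy⟩ := Finset.exists_le_card_fiber_of_mul_le_card_of_maps_to (s := z)
    (t := (Finset.univ : Finset (Fin d → ZMod (2 * (m + 1) + 1))))
    (f := fun v l => (v l : ZMod (2 * (m + 1) + 1))) (n := M) (fun _ _ => Finset.mem_univ _)
    ⟨0, Finset.mem_univ _⟩ (by simpa [ZMod.card] using hz)
  obtain ⟨w, hw, hwc⟩ := Finset.exists_subset_card_eq hy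
  have hprod := measureReal_iInter_of_dep (layerProb p₀ δ) (κ := w)
    (I := fun v => seedBits c m i σ v) (fun v => finite_seedBits c m i σ v) ?_
    (A := fun v => {ω | SeedOpen c m i σ v ω}ᶜ)
    (fun v => Dep.compl (dep_of_congr fun ω ω' h => seedOpen_congr h)) Finset.univ
  · refine (measureReal_mono ?_).trans (hprod.le.trans ?_)
    · intro ω hω
      simp only [Set.mem_iInter]
      intro v _
      exact hω v (Finset.mem_filter.1 (hw v.2)).1
    · refine (Finset.prod_le_prod (g := fun _ =>
        (1 - (δ : ℝ) ^ ((2 * (m + 1) + 1) ^ d * (2 * (m + 1) + 1) ^ d)))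
        (fun _ _ => measureReal_nonneg) fun v _ => ?_).trans ?_
      · rw [probReal_compl_eq_one_sub]
        · linarith [measureReal_seedOpen_ge (p₀ := p₀) (δ := δ) c m i σ v.1]
        · exact (dep_of_congr fun ω ω' h => seedOpen_congr h).measurableSet
            (finite_seedBits c m i σ v.1)
      · rw [Finset.prod_const, Finset.card_univ, Fintype.card_coe, hwc]
  · intro v v' hvv
    have h1 : v.1 ≠ v'.1 := fun h => hvv (Subtype.ext h)
    obtain ⟨l, hl⟩ := Function.ne_iff.1 h1
    have h2 := (Finset.mem_filter.1 (hw v.2)).2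
    have h3 := (Finset.mem_filter.1 (hw v'.2)).2
    have h4 := congrFun (h2.trans h3.symm) l
    rw [← sub_eq_zero, ← Int.cast_sub, ZMod.intCast_zmod_eq_zero_iff_dvd] at h4
    refine disjoint_seedBits (l := l) ?_
    have := Int.le_of_dvd (abs_pos.2 (sub_ne_zero.2 hl)) ((dvd_abs _ _).2 h4)
    push_cast at this
    omega

/-- Every box is connected to an open seed in every target with high probability. -/
lemma exists_seeded_contact {p₀ δ : unitInterval} (hp : pc d < p₀) (hp1 : (p₀ : ℝ) < 1)
    (hδ : 0 < (δ : ℝ)) {η : ℝ} (hη : 0 < η) :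
    ∃ m n : ℕ, ∀ (c : Color) (b : ZVec d) i σ, (bits (layerProb p₀ δ)).real
      {ω | ∃ v ∈ tgtContacts b m n i σ ω, SeedOpen c m i σ v ω}ᶜ ≤ η := by
  obtain ⟨m, hm⟩ := exists_many_tgtContacts (d := d) δ hp hp1 (half_pos hη)
  let κ := (2 * (m + 1) + 1) ^ d * (2 * (m + 1) + 1) ^ d
  have hδκ : 0 < (δ : ℝ) ^ κ := pow_pos hδ κ
  have hδκ1 : (δ : ℝ) ^ κ ≤ 1 := pow_le_one₀ δ.2.1 δ.2.2
  obtain ⟨M, hM⟩ := exists_pow_lt_of_lt_one (half_pos hη) (show 1 - (δ : ℝ) ^ κ < 1 by linarith)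
  obtain ⟨n, -, -, hn⟩ := hm ((2 * (m + 1) + 1) ^ d * M) 0
  refine ⟨m, n, fun c b i σ => ?_⟩
  have hX : ∀ z, Dep (bitsIn none (Bx b n)) {ω | tgtContacts b m n i σ ω = z} :=
    fun z => dep_of_congr fun ω ω' h => by
      rw [tgtContacts, contacts_congr h, tgtContacts]
  have hrev := reveal_le (layerProb p₀ δ) (tgtContacts b m n i σ)
    (fun z => {ω | ∀ v ∈ z, ¬ SeedOpen c m i σ v ω}) (fun _ => bitsIn none (Bx b n))
    (fun z => ⋃ v ∈ z, seedBits c m i σ v)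
    (fun _ => finite_bitsIn none (finite_Bx b n))
    (fun z => z.finite_toSet.biUnion fun v _ => finite_seedBits c m i σ v) ?_ hX ?_
    {z | (2 * (m + 1) + 1) ^ d * M ≤ z.card} (η / 2) ?_
  · have h1 := hn b i σ
    have hmA : MeasurableSet {ω | (2 * (m + 1) + 1) ^ d * M ≤ (tgtContacts b m n i σ ω).card} :=
      (dep_of_congr fun ω ω' h => by
        rw [tgtContacts, contacts_congr h, tgtContacts]).measurableSet
        (finite_bitsIn none (finite_Bx b n))
    have h2 := probReal_compl_eq_one_sub (μ := bits (layerProb p₀ δ)) hmA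
    refine (measureReal_mono (s₂ := {ω | (2 * (m + 1) + 1) ^ d * M ≤
      (tgtContacts b m n i σ ω).card}ᶜ ∪ _) ?_ (measure_ne_top _ _)).trans
      ((measureReal_union_le _ _).trans ((add_le_add h2.le hrev).trans ?_))
    · intro ω hω
      by_cases h : (2 * (m + 1) + 1) ^ d * M ≤ (tgtContacts b m n i σ ω).card
      · exact Or.inr ⟨h, fun v hv hs => hω ⟨v, hv, hs⟩⟩
      · exact Or.inl h
    · have h3 : (bits (layerProb p₀ δ)).real
        {ω | tgtContacts b m n i σ ω ∈ {z | (2 * (m + 1) + 1) ^ d * M ≤ z.card}} ≤ 1 :=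
        measureReal_le_one
      nlinarith
  · intro z
    rw [Set.disjoint_left]
    intro e he he'
    simp only [Set.mem_iUnion] at he'
    obtain ⟨v, _, he'⟩ := he'
    exact absurd (he.1.symm.trans he'.1.1) (by simp)
  · intro z
    refine dep_of_congr fun ω ω' h => forall₂_congr fun v hv => not_congr (seedOpen_congr ?_)
    exact fun e he => h e (Set.mem_biUnion hv he)
  · intro ω hω
    exact (no_seed_le c m i σ _ M hω).trans hM.le

end Seeds

section Step

open Relation

variable {d : ℕ}

/-- The vertices reached from `R` by crossing one sprinkled edge of colour `c` out of `R` and then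
following a bulk path in `B \ R`. -/
def grow (c : Color) (B R : Set (ZVec d)) (ω : Bit d → Bool) : Set (ZVec d) :=
  {w | ∃ u ∈ R ∩ B, ∃ w₀ ∈ B \ R, Opn (some c) ω u w₀ ∧ ConnIn (Opn none ω) (B \ R) w₀ w}

/-- The seeded target vertices in `R` or reached from `R`. -/
def goals (c : Color) (m n : ℕ) (b : ZVec d) (i : Fin d) (σ : Fin d → ℤˣ) (R : Set (ZVec d))
    (ω : Bit d → Bool) : Set (ZVec d) :=
  {v | v ∈ Tgt n b i σ ∧ SeedOpen c m i σ v ω ∧ (v ∈ R ∨ v ∈ grow c (Bx b n) R ω)}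

lemma Tgt_subset_Bx (n : ℕ) (b : ZVec d) (i : Fin d) (σ : Fin d → ℤˣ) :
    Tgt n b i σ ⊆ Bx b n := fun v hv l => by
  rw [← abs_units_mul (σ l), abs_of_nonneg (hv.2 l).1]
  exact (hv.2 l).2

lemma ConnIn.right_mem {V : Type*} {rel : V → V → Prop} {U : Set V} {x y : V}
    (h : ConnIn rel U x y) (hx : x ∈ U) : y ∈ U := by
  induction h with
  | refl => exact hx
  | tail _ h _ => exact h.2.2

lemma grow_subset (c : Color) (B R : Set (ZVec d)) (ω : Bit d → Bool) : grow c B R ω ⊆ B \ R := by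
  rintro w ⟨u, -, w₀, hw₀, -, h⟩
  exact h.right_mem hw₀

lemma grow_congr {c : Color} {B R : Set (ZVec d)} {ω ω' : Bit d → Bool}
    (h : ∀ e ∈ bitsIn none (B \ R) ∪ bitsIn (some c) B, ω e = ω' e) :
    grow c B R ω = grow c B R ω' := by
  ext w
  refine exists_congr fun u => and_congr_right fun hu => exists_congr fun w₀ =>
    and_congr_right fun hw₀ => and_congr ?_ ((dep_connIn none (B \ R) w₀ w).mem_iff fun e he =>
      h e (Or.inl he))
  unfold Opn
  rw [h _ (Or.inr (mem_bitsIn hu.2 hw₀.1))]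

lemma notMem_Bx_of_mem_seed {m n : ℕ} {b : ZVec d} {i : Fin d} {σ : Fin d → ℤˣ} {v u : ZVec d}
    (hv : v ∈ Tgt n b i σ) (hu : u ∈ Bx (nxt m i σ v) m) : u ∉ Bx b n := fun h => by
  have h1 := hu i
  have h2 := h i
  have h3 := hv.1
  simp only [nxt, if_true] at h1
  rw [← abs_units_mul (σ i), abs_le] at h1 h2
  have h4 : (σ i : ℤ) * (u i - (v i + σ i * (m + 1))) =
      σ i * (u i - b i) - σ i * (v i - b i) - (m + 1) := by
    rw [mul_sub, mul_add, units_mul_units_mul]; ring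
  rw [h4] at h1
  omega

lemma seedBits_subset {c : Color} {m n : ℕ} {b : ZVec d} {i : Fin d} {σ : Fin d → ℤˣ} {v : ZVec d}
    (hv : v ∈ Bx b n) : seedBits c m i σ v ⊆ bitsIn (some c) (Bx b (2 * (n + m + 1))) := by
  intro e he
  refine ⟨he.1.1, fun u hu l => ?_⟩
  have h1 := hv l
  have h2 := abs_nxt_sub m i σ v l
  have h3 := seedSet_subset m i σ v (he.1.2 u hu) l
  rw [abs_le] at *
  push_cast at *
  omega

lemma goals_congr {c : Color} {m n : ℕ} {b : ZVec d} {i : Fin d} {σ : Fin d → ℤˣ}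
    {R : Set (ZVec d)} {ω ω' : Bit d → Bool}
    (h : ∀ e ∈ bitsIn none (Bx b n \ R) ∪ bitsIn (some c) (Bx b (2 * (n + m + 1))), ω e = ω' e) :
    goals c m n b i σ R ω = goals c m n b i σ R ω' := by
  have hg : grow c (Bx b n) R ω = grow c (Bx b n) R ω' := grow_congr fun e he =>
    h e (he.imp id fun he' => bitsIn_mono _ (Bx_mono b (by omega)) he')
  ext v
  refine and_congr_right fun hv => and_congr (seedOpen_congr fun e he => h e (Or.inr ?_))
    (by rw [hg])
  exact seedBits_subset (Tgt_subset_Bx n b i σ hv) he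

/-- Candidate edges for the sprinkling step. -/
def gates (c : Color) (m n : ℕ) (b : ZVec d) (i : Fin d) (σ : Fin d → ℤˣ) (R : Set (ZVec d))
    (ω : Bit d → Bool) : Finset (ZVec d × ZVec d) :=
  ((finite_Bx b n).toFinset ×ˢ (finite_Bx b n).toFinset).filter fun q =>
    q.1 ∈ R ∧ q.2 ∉ R ∧ Adj d q.1 q.2 ∧ ∃ v ∈ Tgt n b i σ, v ∉ R ∧ SeedOpen c m i σ v ω ∧
      ConnIn (Opn none ω) (Bx b n \ R) q.2 v

/-- A seeded target vertex lies in `R`. -/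
def Hit (c : Color) (m n : ℕ) (b : ZVec d) (i : Fin d) (σ : Fin d → ℤˣ) (R : Set (ZVec d))
    (ω : Bit d → Bool) : Prop := ∃ v ∈ Tgt n b i σ, v ∈ R ∧ SeedOpen c m i σ v ω

/-- The bits of layer `o` of the pairs in `z` leaving `R`. -/
def gateBits (o : Option Color) (b : ZVec d) (n : ℕ) (R : Set (ZVec d))
    (z : Finset (ZVec d × ZVec d)) : Finset (Bit d) :=
  (z.filter fun q => q.1 ∈ R ∧ q.2 ∉ R ∧ q.1 ∈ Bx b n ∧ q.2 ∈ Bx b n).image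
    fun q => (s(q.1, q.2), o)

/-- The bits determining `gates` and `Hit`. -/
def gateBase (c : Color) (m n : ℕ) (b : ZVec d) (i : Fin d) (σ : Fin d → ℤˣ)
    (R : Set (ZVec d)) : Set (Bit d) :=
  bitsIn none (Bx b n \ R) ∪ ⋃ v ∈ Tgt n b i σ, seedBits c m i σ v

lemma finite_gateBase (c : Color) (m n : ℕ) (b : ZVec d) (i : Fin d) (σ : Fin d → ℤˣ)
    (R : Set (ZVec d)) : (gateBase c m n b i σ R).Finite :=
  (finite_bitsIn _ ((finite_Bx b n).sdiff)).union
    (((finite_Bx b n).subset (Tgt_subset_Bx n b i σ)).biUnion fun v _ => finite_seedBits c m i σ v)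

lemma disjoint_gateBits (o : Option Color) (c : Color) (m n : ℕ) (b : ZVec d) (i : Fin d)
    (σ : Fin d → ℤˣ) (R : Set (ZVec d)) (z : Finset (ZVec d × ZVec d)) :
    Disjoint (gateBase c m n b i σ R) (gateBits o b n R z) := by
  rw [Set.disjoint_left]
  intro e he he'
  simp only [gateBits, Finset.coe_image, Set.mem_image, Finset.mem_coe, Finset.mem_filter] at he'
  obtain ⟨q, ⟨-, h1, h2, h3, h4⟩, rfl⟩ := he'
  rcases he with he | he
  · exact (he.2 q.1 (by simp)).2 h1
  · simp only [Set.mem_iUnion] at he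
    obtain ⟨v, hv, he⟩ := he
    obtain ⟨u, hu, hus⟩ := he.2
    refine notMem_Bx_of_mem_seed hv hus ?_
    rcases Sym2.mem_iff.1 hu with rfl | rfl <;> assumption

lemma gates_hit_congr {c : Color} {m n : ℕ} {b : ZVec d} {i : Fin d} {σ : Fin d → ℤˣ}
    {R : Set (ZVec d)} {ω ω' : Bit d → Bool} (h : ∀ e ∈ gateBase c m n b i σ R, ω e = ω' e) :
    gates c m n b i σ R ω = gates c m n b i σ R ω' ∧
      (Hit c m n b i σ R ω ↔ Hit c m n b i σ R ω') := by
  have hs : ∀ v ∈ Tgt n b i σ, (SeedOpen c m i σ v ω ↔ SeedOpen c m i σ v ω') := fun v hv =>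
    seedOpen_congr fun e he => h e (Or.inr (Set.mem_biUnion hv he))
  constructor
  · refine Finset.filter_congr fun q _ => ?_
    refine and_congr_right fun _ => and_congr_right fun _ => and_congr_right fun _ =>
      exists_congr fun v => and_congr_right fun hv => and_congr_right fun _ =>
      and_congr (hs v hv) ((dep_connIn none _ q.2 v).mem_iff fun e he => h e (Or.inl he))
  · exact exists_congr fun v => and_congr_right fun hv => and_congr_right fun _ => hs v hv

lemma gateBits_gates (o : Option Color) (c : Color) (m n : ℕ) (b : ZVec d) (i : Fin d)
    (σ : Fin d → ℤˣ) (R : Set (ZVec d)) (ω : Bit d → Bool) :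
    gateBits o b n R (gates c m n b i σ R ω) =
      (gates c m n b i σ R ω).image fun q => (s(q.1, q.2), o) := by
  rw [gateBits, Finset.filter_true_of_mem]
  intro q hq
  simp only [gates, Finset.mem_filter, Finset.mem_product, Set.Finite.mem_toFinset] at hq
  exact ⟨hq.2.1, hq.2.2.1, hq.1⟩

lemma card_gateBits_gates (o : Option Color) (c : Color) (m n : ℕ) (b : ZVec d) (i : Fin d)
    (σ : Fin d → ℤˣ) (R : Set (ZVec d)) (ω : Bit d → Bool) :
    (gateBits o b n R (gates c m n b i σ R ω)).card = (gates c m n b i σ R ω).card := by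
  rw [gateBits_gates, Finset.card_image_of_injOn]
  intro q hq q' hq' h
  simp only [gates, Finset.coe_filter, Set.mem_ofPred_eq] at hq hq'
  simp only [Prod.mk.injEq, and_true, Sym2.eq_iff] at h
  rcases h with h | h
  · exact Prod.ext h.1 h.2
  · exact absurd (h.1 ▸ hq.2.1) hq'.2.2.1

lemma measureReal_goals_eq_empty_le {p₀ δ : unitInterval} (hp1 : (p₀ : ℝ) < 1) {m n : ℕ}
    {c : Color} {b : ZVec d} {i : Fin d} {σ : Fin d → ℤˣ} {η : ℝ}
    (h : (bits (layerProb p₀ δ)).real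
      {ω | ∃ v ∈ tgtContacts b m n i σ ω, SeedOpen c m i σ v ω}ᶜ ≤ η)
    {R : Set (ZVec d)} (hR : Bx b m ⊆ R) (k : ℕ) :
    (bits (layerProb p₀ δ)).real {ω | goals c m n b i σ R ω = ∅} ≤
      η / (1 - (p₀ : ℝ)) ^ k + (1 - (δ : ℝ)) ^ k := by
  let X : (Bit d → Bool) → Finset (ZVec d × ZVec d) × Prop := fun ω =>
    (gates c m n b i σ R ω, Hit c m n b i σ R ω)
  have hX : ∀ z, Dep (gateBase c m n b i σ R) {ω | X ω = z} := fun z =>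
    dep_of_congr fun ω ω' h => by
      have := gates_hit_congr h
      simp only [X, this.1, this.2]
  have hfew := le_reveal (layerProb p₀ δ) X
    (fun z => {ω | ∀ e ∈ gateBits none b n R z.1, ω e = false})
    (fun _ => gateBase c m n b i σ R) (fun z => gateBits none b n R z.1)
    (fun _ => finite_gateBase c m n b i σ R) (fun z => Finset.finite_toSet _)
    (fun z => disjoint_gateBits none c m n b i σ R z.1) hX (fun z => dep_forall_mem _ _)
    {z | ¬ z.2 ∧ z.1.card ≤ k} ((1 - (p₀ : ℝ)) ^ k) fun ω hω =>
      one_sub_pow_le_closed _ _ (fun e he => ?_)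
        ((card_gateBits_gates _ _ _ _ _ _ _ _ _).trans_le hω.2)
  · have hmany := reveal_le (layerProb p₀ δ) X
      (fun z => {ω | ∀ e ∈ gateBits (some c) b n R z.1, ω e = false})
      (fun _ => gateBase c m n b i σ R) (fun z => gateBits (some c) b n R z.1)
      (fun _ => finite_gateBase c m n b i σ R) (fun z => Finset.finite_toSet _)
      (fun z => disjoint_gateBits (some c) c m n b i σ R z.1) hX (fun z => dep_forall_mem _ _)
      {z | ¬ z.2 ∧ k ≤ z.1.card} ((1 - (δ : ℝ)) ^ k) fun ω hω => ?_
    · have hpos : 0 < (1 - (p₀ : ℝ)) ^ k := pow_pos (by linarith) _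
      have h1 : (bits (layerProb p₀ δ)).real {ω | X ω ∈ {z | ¬ z.2 ∧ z.1.card ≤ k}} ≤
          η / (1 - (p₀ : ℝ)) ^ k := by
        rw [le_div_iff₀ hpos, mul_comm]
        refine hfew.trans (le_trans (measureReal_mono ?_ (measure_ne_top _ _)) h)
        rintro ω ⟨⟨hY, -⟩, hclosed⟩ ⟨v, hv, hs⟩
        obtain ⟨hv, hT⟩ := Finset.mem_filter.1 hv
        obtain ⟨_, _, u₀, hu₀, hc⟩ := mem_contacts.1 hv
        have hvR : v ∉ R := fun hvR => hY ⟨v, hT, hvR, hs⟩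
        obtain ⟨u, w, hu, hw, huw, hwv⟩ := exists_last_exit hc (hR hu₀) hvR
        have := hclosed (s(u, w), none) ?_
        · rw [huw.2] at this; exact absurd this (by simp)
        · rw [gateBits_gates]
          refine Finset.mem_image.2 ⟨(u, w), ?_, rfl⟩
          simp only [gates, Finset.mem_filter, Finset.mem_product, Set.Finite.mem_toFinset]
          exact ⟨⟨hu.2, hw.1⟩, hu.1, hw.2, huw.1, v, hT, hvR, hs, hwv⟩
      refine (measureReal_mono (s₂ := {ω | X ω ∈ {z | ¬ z.2 ∧ z.1.card ≤ k}} ∪ _) ?_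
        (measure_ne_top _ _)).trans ((measureReal_union_le _ _).trans
          (add_le_add h1 (hmany.trans (mul_le_of_le_one_right ?_ measureReal_le_one))))
      · intro ω hω
        have hω : goals c m n b i σ R ω = ∅ := hω
        have hY : ¬ Hit c m n b i σ R ω := by
          rintro ⟨v, hT, hvR, hs⟩
          exact (Set.eq_empty_iff_forall_notMem.1 hω) v ⟨hT, hs, Or.inl hvR⟩
        rcases le_total (gates c m n b i σ R ω).card k with hk | hk
        · exact Or.inl ⟨hY, hk⟩
        · refine Or.inr ⟨⟨hY, hk⟩, fun e he => ?_⟩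
          have he : e ∈ gateBits (some c) b n R (gates c m n b i σ R ω) := he
          rw [gateBits_gates] at he
          obtain ⟨q, hq, rfl⟩ := Finset.mem_image.1 he
          simp only [gates, Finset.mem_filter, Finset.mem_product, Set.Finite.mem_toFinset] at hq
          obtain ⟨⟨hq1, hq2⟩, hqR, hqR', ha, v, hT, hvR, hs, hc⟩ := hq
          by_contra hopen
          rw [Bool.not_eq_false] at hopen
          exact (Set.eq_empty_iff_forall_notMem.1 hω) v ⟨hT, hs, Or.inr ⟨q.1, ⟨hqR, hq1⟩, q.2,
            ⟨hq2, hqR'⟩, ⟨ha, hopen⟩, hc⟩⟩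
      · exact pow_nonneg (by linarith [δ.2.2]) _
    · change (bits (layerProb p₀ δ)).real {ω' | ∀ e ∈ gateBits (some c) b n R
        (gates c m n b i σ R ω), ω' e = false} ≤ _
      rw [measureReal_closed, Finset.prod_congr rfl (g := fun _ => 1 - (δ : ℝ)), Finset.prod_const,
        card_gateBits_gates]
      · exact pow_le_pow_of_le_one (by linarith [δ.2.2]) (by linarith [δ.2.1]) hω.2
      · intro e he
        obtain ⟨q, -, rfl⟩ := Finset.mem_image.1 he
        simp [layerProb]
  · obtain ⟨q, -, rfl⟩ := Finset.mem_image.1 he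
    simp [layerProb]

/-- The Grimmett–Marstrand step. -/
lemma exists_step {p₀ δ : unitInterval} (hp : pc d < p₀) (hp1 : (p₀ : ℝ) < 1)
    (hδ : 0 < (δ : ℝ)) {ε : ℝ} (hε : 0 < ε) :
    ∃ m n : ℕ, ∀ (c : Color) (b : ZVec d) i σ (R : Set (ZVec d)), Bx b m ⊆ R →
      (bits (layerProb p₀ δ)).real {ω | goals c m n b i σ R ω = ∅} ≤ ε := by
  obtain ⟨k, hk⟩ := exists_pow_lt_of_lt_one (half_pos hε) (show 1 - (δ : ℝ) < 1 by linarith)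
  have hpos : 0 < (1 - (p₀ : ℝ)) ^ k := pow_pos (by linarith) _
  obtain ⟨m, n, h⟩ := exists_seeded_contact (d := d) hp hp1 hδ
    (mul_pos (half_pos hε) hpos)
  refine ⟨m, n, fun c b i σ R hR => ?_⟩
  refine (measureReal_goals_eq_empty_le hp1 (h c b i σ) hR k).trans ?_
  rw [mul_div_cancel_right₀ _ hpos.ne']
  linarith

end Step

section Exploration

open Relation

variable {d : ℕ}

/-- A planar renormalisation frame: seeds of radius `m`, boxes of radius `n`, two oriented
coordinate axes and an origin. -/
structure Frame (d : ℕ) where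
  m : ℕ
  n : ℕ
  o : ZVec d
  i₁ : Fin d
  i₂ : Fin d
  s₁ : ℤˣ
  s₂ : ℤˣ
  ne : i₁ ≠ i₂

/-- Sites of the coarse lattice. -/
abbrev Site := ℤ × ℤ

namespace Frame

variable (𝔣 : Frame d)

/-- Lattice spacing of the coarse lattice. -/
def spacing : ℕ := 𝔣.n + 𝔣.m + 1

/-- The microscopic centre of a coarse site. -/
def center (z : Site) : ZVec d := fun l => 𝔣.o l + 𝔣.spacing *
  ((if l = 𝔣.i₁ then 𝔣.s₁ * z.1 else 0) + (if l = 𝔣.i₂ then 𝔣.s₂ * z.2 else 0))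

/-- The colour of a coarse site. -/
def col (z : Site) : Color := (z.1, z.2)

/-- The exploration order of coarse sites. -/
def rank (z : Site) : ℤ := 8 * (z.1 + z.2) + z.1 % 8

/-- The box around a coarse site. -/
def box (z : Site) : Set (ZVec d) := Bx (𝔣.center z) (3 * 𝔣.spacing + 𝔣.n)

lemma finite_box (z : Site) : (𝔣.box z).Finite := finite_Bx _ _

lemma center_i₁ (z : Site) : 𝔣.center z 𝔣.i₁ = 𝔣.o 𝔣.i₁ + 𝔣.spacing * (𝔣.s₁ * z.1) := by
  simp [center, 𝔣.ne]

lemma center_i₂ (z : Site) : 𝔣.center z 𝔣.i₂ = 𝔣.o 𝔣.i₂ + 𝔣.spacing * (𝔣.s₂ * z.2) := by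
  simp [center, 𝔣.ne.symm]

lemma disjoint_box {z z' : Site} (hne : z ≠ z') (h : col z = col z') :
    Disjoint (𝔣.box z) (𝔣.box z') := by
  have key : ∀ (s : ℤˣ) (a b o : ℤ), a ≠ b → (a : ZMod 8) = b →
      2 * ((3 * 𝔣.spacing + 𝔣.n : ℕ) : ℤ) <
        |o + 𝔣.spacing * ((s : ℤ) * a) - (o + 𝔣.spacing * (s * b))| := by
    intro s a b o hab h
    have h1 : (8 : ℤ) ∣ a - b := by
      rw [← sub_eq_zero, ← Int.cast_sub, ZMod.intCast_zmod_eq_zero_iff_dvd] at h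
      exact h
    have h2 : 8 ≤ |a - b| := Int.le_of_dvd (abs_pos.2 (sub_ne_zero.2 hab)) ((dvd_abs _ _).2 h1)
    have h3 : o + 𝔣.spacing * ((s : ℤ) * a) - (o + 𝔣.spacing * (s * b)) =
        𝔣.spacing * (s * (a - b)) := by ring
    rw [h3, abs_mul, abs_units_mul, Nat.abs_cast]
    have h4 : (𝔣.spacing : ℤ) * 8 ≤ 𝔣.spacing * |a - b| :=
      mul_le_mul_of_nonneg_left h2 (by positivity)
    have h5 : (𝔣.spacing : ℤ) = 𝔣.n + 𝔣.m + 1 := by simp [spacing]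
    push_cast
    linarith
  simp only [col, Prod.mk.injEq] at h
  by_cases h1 : z.1 = z'.1
  · have h2 : z.2 ≠ z'.2 := fun h2 => hne (Prod.ext h1 h2)
    refine disjoint_Bx (l := 𝔣.i₂) ?_
    rw [center_i₂, center_i₂]
    exact key _ _ _ _ h2 h.2
  · refine disjoint_Bx (l := 𝔣.i₁) ?_
    rw [center_i₁, center_i₁]
    exact key _ _ _ _ h1 h.1

lemma disjoint_box_of_rank_eq {z z' : Site} (hne : z ≠ z') (h : rank z = rank z') :
    Disjoint (𝔣.box z) (𝔣.box z') := by
  refine 𝔣.disjoint_box hne ?_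
  unfold rank at h
  have h1 : z.1 % 8 = z'.1 % 8 := by omega
  have h2 : z.2 % 8 = z'.2 % 8 := by omega
  have key : ∀ a b : ℤ, a % 8 = b % 8 → (a : ZMod 8) = b := fun a b hab =>
    (ZMod.intCast_eq_intCast_iff a b 8).2 hab
  exact Prod.ext (key _ _ h1) (key _ _ h2)

/-- Exploration states: revealed vertices, seeds with their sites, failed sites. -/
abbrev St (d : ℕ) := Finset (ZVec d) × Finset (Site × ZVec d) × Finset Site

/-- The axis, orientation and seed used to explore a site. -/
def launch (s : St d) (z : Site) : Option (Fin d × ℤˣ × ZVec d) :=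
  if h : ∃ b, ((z.1 - 1, z.2), b) ∈ s.2.1 then some (𝔣.i₁, 𝔣.s₁, h.choose)
  else if h : ∃ b, ((z.1, z.2 - 1), b) ∈ s.2.1 then some (𝔣.i₂, 𝔣.s₂, h.choose) else none

/-- The orthant used to explore `z`, steering towards its centre. -/
def aim (z : Site) (i : Fin d) (s : ℤˣ) (b : ZVec d) : Fin d → ℤˣ := fun l =>
  if l = i then s else if 𝔣.center z l ≤ b l then -1 else 1

/-- The successful target vertices in the exploration of a site. -/
def wins (z : Site) (R : Finset (ZVec d)) (q : Fin d × ℤˣ × ZVec d) (ω : Bit d → Bool) :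
    Finset (ZVec d) :=
  (finite_Bx q.2.2 𝔣.n).toFinset.filter fun v =>
    v ∈ goals (col z) 𝔣.m 𝔣.n q.2.2 q.1 (𝔣.aim z q.1 q.2.1 q.2.2) R ω

/-- The vertices reached in the exploration of a site. -/
def reached (z : Site) (R : Finset (ZVec d)) (q : Fin d × ℤˣ × ZVec d) (ω : Bit d → Bool) :
    Finset (ZVec d) :=
  (finite_Bx q.2.2 𝔣.n).toFinset.filter fun v => v ∈ grow (col z) (Bx q.2.2 𝔣.n) R ω

/-- The centres of the new seeds in the exploration of a site. -/
def newSeeds (z : Site) (R : Finset (ZVec d)) (q : Fin d × ℤˣ × ZVec d) (ω : Bit d → Bool) :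
    Finset (ZVec d) :=
  (𝔣.wins z R q ω).image (nxt 𝔣.m q.1 (𝔣.aim z q.1 q.2.1 q.2.2))

/-- One step of the exploration. -/
def step (z : Site) (s : St d) (ω : Bit d → Bool) : St d :=
  match 𝔣.launch s z with
  | none => s
  | some q => (s.1 ∪ 𝔣.reached z s.1 q ω ∪
        (𝔣.newSeeds z s.1 q ω).biUnion fun b => (finite_Bx b 𝔣.m).toFinset,
      s.2.1 ∪ (𝔣.newSeeds z s.1 q ω).image fun b => (z, b),
      if 𝔣.newSeeds z s.1 q ω = ∅ then insert z s.2.2 else s.2.2)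

/-- The exploration started from `s₀` of a list of sites, the head being explored last. -/
def run (s₀ : St d) : List Site → (Bit d → Bool) → St d
  | [], _ => s₀
  | z :: l, ω => 𝔣.step z (run s₀ l ω) ω

/-- The seeds are revealed and close to the centres of their sites. -/
def Valid (s : St d) : Prop := ∀ z b, (z, b) ∈ s.2.1 →
  Bx b 𝔣.m ⊆ s.1 ∧ ∀ l, |b l - 𝔣.center z l| ≤ 𝔣.n

lemma mem_newSeeds {z : Site} {R : Finset (ZVec d)} {q : Fin d × ℤˣ × ZVec d}
    {ω : Bit d → Bool} {b : ZVec d} : b ∈ 𝔣.newSeeds z R q ω ↔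
      ∃ v ∈ goals (col z) 𝔣.m 𝔣.n q.2.2 q.1 (𝔣.aim z q.1 q.2.1 q.2.2) R ω,
        nxt 𝔣.m q.1 (𝔣.aim z q.1 q.2.1 q.2.2) v = b := by
  simp only [newSeeds, wins, Finset.mem_image, Finset.mem_filter, Set.Finite.mem_toFinset]
  exact exists_congr fun v => and_congr_left fun _ =>
    ⟨fun h => h.2, fun h => ⟨Tgt_subset_Bx _ _ _ _ h.1, h⟩⟩

lemma mem_reached {z : Site} {R : Finset (ZVec d)} {q : Fin d × ℤˣ × ZVec d}
    {ω : Bit d → Bool} {v : ZVec d} :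
    v ∈ 𝔣.reached z R q ω ↔ v ∈ grow (col z) (Bx q.2.2 𝔣.n) R ω := by
  simp only [reached, Finset.mem_filter, Set.Finite.mem_toFinset]
  exact ⟨fun h => h.2, fun h => ⟨(grow_subset _ _ _ _ h).1, h⟩⟩

/-- Displacement from the centre in terms of the parent site. -/
lemma launch_spec {s : St d} {z : Site} {q : Fin d × ℤˣ × ZVec d} (h : 𝔣.launch s z = some q) :
    ∃ z', (z', q.2.2) ∈ s.2.1 ∧ ∀ l, 𝔣.center z l = 𝔣.center z' l +
      if l = q.1 then (q.2.1 : ℤ) * 𝔣.spacing else 0 := by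
  unfold launch at h
  split_ifs at h with h1 h2
  · rw [Option.some.injEq] at h
    subst h
    refine ⟨_, h1.choose_spec, fun l => ?_⟩
    simp only [center]
    split_ifs <;> ring
  · rw [Option.some.injEq] at h
    subst h
    refine ⟨_, h2.choose_spec, fun l => ?_⟩
    simp only [center]
    split_ifs <;> ring

lemma launch_isSome_iff {s : St d} {z : Site} : (∃ q, 𝔣.launch s z = some q) ↔
    (∃ b, ((z.1 - 1, z.2), b) ∈ s.2.1) ∨ ∃ b, ((z.1, z.2 - 1), b) ∈ s.2.1 := by
  unfold launch
  split_ifs with h1 h2 <;> simp_all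

lemma Bx_launch_subset {s : St d} (hs : 𝔣.Valid s) {z : Site} {q : Fin d × ℤˣ × ZVec d}
    (h : 𝔣.launch s z = some q) : Bx q.2.2 (2 * 𝔣.spacing) ⊆ 𝔣.box z := by
  obtain ⟨z', hz', hc⟩ := 𝔣.launch_spec h
  intro v hv l
  have h1 := hv l
  have h2 := (hs _ _ hz').2 l
  have h3 := hc l
  have h4 : |if l = q.1 then (q.2.1 : ℤ) * 𝔣.spacing else 0| ≤ 𝔣.spacing := by
    split_ifs
    · rw [abs_units_mul, Nat.abs_cast]
    · simp
  rw [abs_le] at *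
  push_cast at *
  omega

lemma Bx_launch_subset' {s : St d} (hs : 𝔣.Valid s) {z : Site} {q : Fin d × ℤˣ × ZVec d}
    (h : 𝔣.launch s z = some q) : Bx q.2.2 𝔣.n ⊆ 𝔣.box z :=
  (Bx_mono _ (by unfold spacing; omega)).trans (𝔣.Bx_launch_subset hs h)

lemma newSeed_near {s : St d} (hs : 𝔣.Valid s) {z : Site} {q : Fin d × ℤˣ × ZVec d}
    (h : 𝔣.launch s z = some q) {v : ZVec d}
    (hv : v ∈ Tgt 𝔣.n q.2.2 q.1 (𝔣.aim z q.1 q.2.1 q.2.2)) (l : Fin d) :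
    |nxt 𝔣.m q.1 (𝔣.aim z q.1 q.2.1 q.2.2) v l - 𝔣.center z l| ≤ 𝔣.n := by
  obtain ⟨z', hz', hc⟩ := 𝔣.launch_spec h
  have h2 := (hs _ _ hz').2 l
  have h3 := hc l
  by_cases hl : l = q.1
  · have h4 := hv.1
    subst hl
    simp only [aim, nxt, if_true] at *
    have h5 : (q.2.1 : ℤ) * (q.2.1 * (v q.1 - q.2.2 q.1)) = q.2.1 * 𝔣.n := by rw [h4]
    rw [units_mul_units_mul] at h5
    have h6 : v q.1 + (q.2.1 : ℤ) * (𝔣.m + 1) - 𝔣.center z q.1 =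
        q.2.2 q.1 - 𝔣.center z' q.1 := by
      rw [h3, spacing]
      push_cast
      linear_combination h5
    rw [h6]
    exact h2
  · have h4 := hv.2 l
    simp only [aim, nxt, if_neg hl, add_zero] at *
    rw [← h3] at h2
    rw [abs_le] at *
    split_ifs at h4 with hle <;> simp only [Units.val_neg, Units.val_one] at h4 <;> omega

lemma subset_step (z : Site) (s : St d) (ω : Bit d → Bool) :
    s.1 ⊆ (𝔣.step z s ω).1 ∧ s.2.1 ⊆ (𝔣.step z s ω).2.1 ∧ s.2.2 ⊆ (𝔣.step z s ω).2.2 := by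
  unfold step
  split
  · exact ⟨subset_rfl, subset_rfl, subset_rfl⟩
  · refine ⟨Finset.subset_union_left.trans Finset.subset_union_left, Finset.subset_union_left, ?_⟩
    dsimp only
    split_ifs
    · exact Finset.subset_insert _ _
    · exact subset_rfl

lemma Valid.step {s : St d} (hs : 𝔣.Valid s) (z : Site) (ω : Bit d → Bool) :
    𝔣.Valid (𝔣.step z s ω) := by
  intro z' b hb
  by_cases h : (z', b) ∈ s.2.1
  · exact ⟨(hs _ _ h).1.trans (Finset.coe_subset.2 (𝔣.subset_step z s ω).1), (hs _ _ h).2⟩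
  · unfold Frame.step at hb ⊢
    split at hb
    · exact absurd hb h
    · rename_i q hq
      rw [Finset.mem_union] at hb
      replace hb := hb.resolve_left h
      obtain ⟨b', hb', he⟩ := Finset.mem_image.1 hb
      obtain ⟨rfl, rfl⟩ := Prod.mk.inj he
      refine ⟨fun w hw => ?_, ?_⟩
      · refine Finset.mem_coe.2 (Finset.mem_union_right _ (Finset.mem_biUnion.2 ⟨_, hb', ?_⟩))
        simpa using hw
      · obtain ⟨v, hv, rfl⟩ := 𝔣.mem_newSeeds.1 hb'
        exact 𝔣.newSeed_near hs hq hv.1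

lemma Valid.run {s₀ : St d} (hs : 𝔣.Valid s₀) (l : List Site) (ω : Bit d → Bool) :
    𝔣.Valid (𝔣.run s₀ l ω) := by
  induction l with
  | nil => exact hs
  | cons z l ih => exact ih.step 𝔣 z ω

/-- The bits revealed by an exploration of the sites in `l` with revealed vertices `R`. -/
def known (l : List Site) (R : Finset (ZVec d)) : Set (Bit d) :=
  ⋃ z ∈ {z | z ∈ l}, ({e ∈ bitsIn none (𝔣.box z) | ∃ u ∈ e.1, u ∈ R} ∪
      bitsIn (some (col z)) (𝔣.box z))

lemma known_mono {l l' : List Site} (hl : l ⊆ l') {R R' : Finset (ZVec d)} (hR : R ⊆ R') :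
    𝔣.known l R ⊆ 𝔣.known l' R' := by
  intro e he
  simp only [known, Set.mem_iUnion] at he ⊢
  obtain ⟨z, hz, he⟩ := he
  exact ⟨z, hl hz, he.imp (fun h => ⟨h.1, h.2.imp fun u hu => ⟨hu.1, hR hu.2⟩⟩) id⟩

lemma finite_known (l : List Site) (R : Finset (ZVec d)) : (𝔣.known l R).Finite :=
  (List.finite_toSet l).biUnion fun z _ =>
    ((finite_bitsIn none (𝔣.finite_box z)).subset fun _ h => h.1).union
      (finite_bitsIn _ (𝔣.finite_box z))

end Frame

lemma grow_eq_of_agree {c : Color} {B R : Set (ZVec d)} {ω ω' : Bit d → Bool}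
    (hc : ∀ e ∈ bitsIn (some c) B, ω e = ω' e)
    (hn : ∀ e ∈ bitsIn none B, (∃ u ∈ e.1, u ∈ grow c B R ω) → ω e = ω' e) :
    grow c B R ω = grow c B R ω' := by
  have hstart : ∀ u ∈ R ∩ B, ∀ w ∈ B \ R, (Opn (some c) ω u w ↔ Opn (some c) ω' u w) := by
    intro u hu w hw
    unfold Opn
    rw [hc _ (mem_bitsIn hu.2 hw.1)]
  ext w
  constructor
  · rintro ⟨u, hu, w₀, hw₀, ho, h⟩
    refine ⟨u, hu, w₀, hw₀, (hstart u hu w₀ hw₀).1 ho, ?_⟩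
    induction h with
    | refl => exact ReflTransGen.refl
    | @tail a b hab hb ih =>
      refine ih.tail ⟨⟨hb.1.1, ?_⟩, hb.2⟩
      rw [← hn _ (mem_bitsIn hb.2.1.1 hb.2.2.1) ⟨a, by simp, u, hu, w₀, hw₀, ho, hab⟩]
      exact hb.1.2
  · rintro ⟨u, hu, w₀, hw₀, ho, h⟩
    have ho' := (hstart u hu w₀ hw₀).2 ho
    induction h with
    | refl => exact ⟨u, hu, w₀, hw₀, ho', ReflTransGen.refl⟩
    | @tail a b hab hb ih =>
      have he := hn (s(a, b), none) (mem_bitsIn hb.2.1.1 hb.2.2.1) ⟨a, by simp, ih⟩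
      obtain ⟨u', hu', w', hw', ho'', h'⟩ := ih
      exact ⟨u', hu', w', hw', ho'', h'.tail ⟨⟨hb.1.1, he.trans hb.1.2⟩, hb.2⟩⟩

end Exploration

section Failure

open Relation

variable {d : ℕ}

namespace Frame

variable (𝔣 : Frame d)

lemma step_of_none {z : Site} {s : St d} (h : 𝔣.launch s z = none) (ω : Bit d → Bool) :
    𝔣.step z s ω = s := by
  simp only [step, h]

lemma step_of_some {z : Site} {s : St d} {q : Fin d × ℤˣ × ZVec d} (h : 𝔣.launch s z = some q)
    (ω : Bit d → Bool) : 𝔣.step z s ω = (s.1 ∪ 𝔣.reached z s.1 q ω ∪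
        (𝔣.newSeeds z s.1 q ω).biUnion fun b => (finite_Bx b 𝔣.m).toFinset,
      s.2.1 ∪ (𝔣.newSeeds z s.1 q ω).image fun b => (z, b),
      if 𝔣.newSeeds z s.1 q ω = ∅ then insert z s.2.2 else s.2.2) := by
  simp only [step, h]

lemma step_congr {s : St d} (hs : 𝔣.Valid s) {z : Site} {ω ω' : Bit d → Bool}
    (h : ∀ e ∈ 𝔣.known [z] (𝔣.step z s ω).1, ω e = ω' e) :
    𝔣.step z s ω' = 𝔣.step z s ω := by
  rcases hq : 𝔣.launch s z with _ | q
  · rw [𝔣.step_of_none hq, 𝔣.step_of_none hq]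
  have hB := 𝔣.Bx_launch_subset' hs hq
  have hc : ∀ e ∈ bitsIn (some (col z)) (𝔣.box z), ω e = ω' e := fun e he =>
    h e (Set.mem_biUnion (by simp : z ∈ {z' | z' ∈ [z]}) (Or.inr he))
  have hn : ∀ e ∈ bitsIn none (𝔣.box z), (∃ u ∈ e.1, u ∈ (𝔣.step z s ω).1) → ω e = ω' e :=
    fun e he hu => h e (Set.mem_biUnion (by simp : z ∈ {z' | z' ∈ [z]}) (Or.inl ⟨he, hu⟩))
  have hg : grow (col z) (Bx q.2.2 𝔣.n) s.1 ω = grow (col z) (Bx q.2.2 𝔣.n) s.1 ω' := by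
    refine grow_eq_of_agree (fun e he => hc e (bitsIn_mono _ hB he)) fun e he => ?_
    rintro ⟨u, hu, hu'⟩
    refine hn e (bitsIn_mono _ hB he) ⟨u, hu, ?_⟩
    rw [𝔣.step_of_some hq]
    exact Finset.mem_union_left _ (Finset.mem_union_right _ (𝔣.mem_reached.2 hu'))
  have h1 : 𝔣.reached z s.1 q ω' = 𝔣.reached z s.1 q ω := by
    unfold reached
    rw [hg]
  have h2 : 𝔣.newSeeds z s.1 q ω' = 𝔣.newSeeds z s.1 q ω := by
    ext b
    rw [mem_newSeeds, mem_newSeeds]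
    refine exists_congr fun v => and_congr_left fun _ => ?_
    refine and_congr_right fun hv => and_congr (seedOpen_congr fun e he => ?_) (by rw [hg])
    refine (hc e (bitsIn_mono _ (𝔣.Bx_launch_subset hs hq) ?_)).symm
    exact seedBits_subset (Tgt_subset_Bx _ _ _ _ hv) he
  rw [𝔣.step_of_some hq, 𝔣.step_of_some hq, h1, h2]

lemma run_congr {s₀ : St d} (hs : 𝔣.Valid s₀) (l : List Site) {ω ω' : Bit d → Bool}
    (h : ∀ e ∈ 𝔣.known l (𝔣.run s₀ l ω).1, ω e = ω' e) : 𝔣.run s₀ l ω' = 𝔣.run s₀ l ω := by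
  induction l with
  | nil => rfl
  | cons z l ih =>
    have h1 : 𝔣.run s₀ l ω' = 𝔣.run s₀ l ω := ih fun e he =>
      h e (𝔣.known_mono (List.subset_cons_self _ _) (𝔣.subset_step _ _ _).1 he)
    simp only [run]
    rw [h1]
    exact 𝔣.step_congr (hs.run 𝔣 l ω) fun e he => h e (𝔣.known_mono (by simp) subset_rfl he)

lemma dep_run {s₀ : St d} (hs : 𝔣.Valid s₀) (l : List Site) (s : St d) :
    Dep (𝔣.known l s.1) {ω | 𝔣.run s₀ l ω = s} := by
  rintro ω ω' h rfl
  exact 𝔣.run_congr hs l h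

/-- The bits examined when exploring `z` with revealed vertices `R`. -/
def fresh (z : Site) (R : Set (ZVec d)) : Set (Bit d) :=
  bitsIn none (𝔣.box z \ R) ∪ bitsIn (some (col z)) (𝔣.box z)

lemma disjoint_known_fresh {l : List Site} {z : Site} (hz : z ∉ l) (R : Finset (ZVec d)) :
    Disjoint (𝔣.known l R) (𝔣.fresh z R) := by
  rw [Set.disjoint_left]
  intro e he he'
  simp only [known, Set.mem_iUnion] at he
  obtain ⟨z', hz', he⟩ := he
  rcases he with ⟨h1, u, hu, huR⟩ | h1 <;> rcases he' with h2 | h2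
  · exact (h2.2 u hu).2 huR
  · exact absurd (h1.1.symm.trans h2.1) (by simp)
  · exact absurd (h1.1.symm.trans h2.1) (by simp)
  · have hc : col z' = col z := Option.some.inj (h1.1.symm.trans h2.1)
    have hne : z' ≠ z := by
      rintro rfl
      exact hz hz'
    rw [hc] at h1
    exact Set.disjoint_left.1 (disjoint_bitsIn (𝔣.disjoint_box hne hc)) h1 h2

lemma finite_fresh (z : Site) (R : Set (ZVec d)) : (𝔣.fresh z R).Finite :=
  (finite_bitsIn none ((𝔣.finite_box z).sdiff)).union (finite_bitsIn _ (𝔣.finite_box z))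

/-- The exploration of `z` fails. -/
def Fails (z : Site) (s : St d) (ω : Bit d → Bool) : Prop :=
  ∃ q, 𝔣.launch s z = some q ∧ 𝔣.newSeeds z s.1 q ω = ∅

lemma mem_failed_step {z z' : Site} {s : St d} {ω : Bit d → Bool} :
    z' ∈ (𝔣.step z s ω).2.2 ↔ z' ∈ s.2.2 ∨ (z' = z ∧ 𝔣.Fails z s ω) := by
  unfold Fails
  rcases hq : 𝔣.launch s z with _ | q
  · simp [𝔣.step_of_none hq]
  · rw [𝔣.step_of_some hq]
    dsimp only
    split_ifs with h <;> simp [h, or_comm]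

lemma newSeeds_eq_empty_iff {z : Site} {R : Finset (ZVec d)} {q : Fin d × ℤˣ × ZVec d}
    {ω : Bit d → Bool} : 𝔣.newSeeds z R q ω = ∅ ↔
      goals (col z) 𝔣.m 𝔣.n q.2.2 q.1 (𝔣.aim z q.1 q.2.1 q.2.2) R ω = ∅ := by
  simp only [Finset.eq_empty_iff_forall_notMem, Set.eq_empty_iff_forall_notMem, mem_newSeeds]
  constructor
  · exact fun h v hv => h _ ⟨v, hv, rfl⟩
  · rintro h _ ⟨v, hv, -⟩
    exact h v hv

lemma dep_fails {s : St d} (hs : 𝔣.Valid s) (z : Site) :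
    Dep (𝔣.fresh z s.1) {ω | 𝔣.Fails z s ω} := by
  refine dep_of_congr fun ω ω' h => exists_congr fun q => and_congr_right fun hq => ?_
  rw [newSeeds_eq_empty_iff, newSeeds_eq_empty_iff, goals_congr fun e he => h e ?_]
  refine he.imp (fun h1 => bitsIn_mono _ ?_ h1) fun h1 =>
    bitsIn_mono _ (𝔣.Bx_launch_subset hs hq) h1
  exact Set.sdiff_subset_sdiff_left (𝔣.Bx_launch_subset' hs hq)

lemma failed_run_subset {s₀ : St d} (h₀ : s₀.2.2 = ∅) (l : List Site) (ω : Bit d → Bool) :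
    ∀ z ∈ (𝔣.run s₀ l ω).2.2, z ∈ l := by
  induction l with
  | nil => simp [run, h₀]
  | cons a l ih =>
    intro z hz
    rcases 𝔣.mem_failed_step.1 hz with h | ⟨rfl, -⟩
    · exact List.mem_cons_of_mem _ (ih z h)
    · simp

lemma measureReal_failed_le {r : Bit d → unitInterval} {ε : ℝ}
    (hε : ∀ c b i σ (R : Set (ZVec d)), Bx b 𝔣.m ⊆ R →
      (bits r).real {ω | goals c 𝔣.m 𝔣.n b i σ R ω = ∅} ≤ ε)
    {s₀ : St d} (hs : 𝔣.Valid s₀) (h₀ : s₀.2.2 = ∅) {l : List Site} (hl : l.Nodup)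
    (F : Finset Site) :
    (bits r).real {ω | F ⊆ (𝔣.run s₀ l ω).2.2} ≤ ε ^ F.card := by
  have hε0 : 0 ≤ ε := measureReal_nonneg.trans (hε 0 0 𝔣.i₁ 1 Set.univ (Set.subset_univ _))
  induction l generalizing F with
  | nil =>
    rcases F.eq_empty_or_nonempty with rfl | hF
    · simp
    · have : {ω : Bit d → Bool | F ⊆ (𝔣.run s₀ [] ω).2.2} = ∅ := by
        ext ω
        simp only [run, h₀, Set.mem_ofPred_eq, Finset.subset_empty, Set.mem_empty_iff_false,
          iff_false]
        exact hF.ne_empty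
      rw [this]
      simpa using pow_nonneg hε0 _
  | cons z l ih =>
    have hzl := (List.nodup_cons.1 hl).1
    replace ih := ih (List.nodup_cons.1 hl).2
    by_cases hz : z ∈ F
    · have hsub : {ω | F ⊆ (𝔣.run s₀ (z :: l) ω).2.2} ⊆
          {ω | 𝔣.run s₀ l ω ∈ {s | 𝔣.Valid s ∧ F.erase z ⊆ s.2.2} ∧
            ω ∈ {ω | 𝔣.Valid (𝔣.run s₀ l ω) ∧ 𝔣.Fails z (𝔣.run s₀ l ω) ω}} := by
        intro ω hω
        have hv := hs.run 𝔣 l ω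
        refine ⟨⟨hv, fun a ha => ?_⟩, hv, ?_⟩
        · rcases 𝔣.mem_failed_step.1 (hω (Finset.mem_of_mem_erase ha)) with h | ⟨rfl, -⟩
          · exact h
          · exact absurd rfl (Finset.ne_of_mem_erase ha)
        · rcases 𝔣.mem_failed_step.1 (hω hz) with h | ⟨-, h⟩
          · exact absurd (𝔣.failed_run_subset h₀ l ω z h) hzl
          · exact h
      have hrev := reveal_le r (𝔣.run s₀ l) (fun s => {ω | 𝔣.Valid s ∧ 𝔣.Fails z s ω})
        (fun s => 𝔣.known l s.1) (fun s => 𝔣.fresh z s.1) (fun s => 𝔣.finite_known l s.1)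
        (fun s => 𝔣.finite_fresh z s.1) (fun s => 𝔣.disjoint_known_fresh hzl s.1)
        (fun s => 𝔣.dep_run hs l s) (fun s => dep_of_congr fun ω ω' h =>
          and_congr_right fun hv => (𝔣.dep_fails hv z).mem_iff h)
        {s | 𝔣.Valid s ∧ F.erase z ⊆ s.2.2} ε (by
          rintro ω ⟨hv, -⟩
          rcases hq : 𝔣.launch (𝔣.run s₀ l ω) z with _ | q
          · simp [Fails, hq, hε0]
          · obtain ⟨z', hz', -⟩ := 𝔣.launch_spec hq
            refine (measureReal_mono ?_ (measure_ne_top _ _)).trans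
              (hε (col z) q.2.2 q.1 (𝔣.aim z q.1 q.2.1 q.2.2) (𝔣.run s₀ l ω).1 (hv _ _ hz').1)
            rintro ω' ⟨-, q', hq', hn⟩
            rw [hq, Option.some.injEq] at hq'
            subst hq'
            exact 𝔣.newSeeds_eq_empty_iff.1 hn)
      calc (bits r).real {ω | F ⊆ (𝔣.run s₀ (z :: l) ω).2.2}
          ≤ ε * (bits r).real {ω | 𝔣.run s₀ l ω ∈ {s | 𝔣.Valid s ∧ F.erase z ⊆ s.2.2}} :=
            (measureReal_mono hsub (measure_ne_top _ _)).trans hrev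
        _ ≤ ε * ε ^ (F.erase z).card := by
            refine mul_le_mul_of_nonneg_left ?_ hε0
            exact (measureReal_mono (fun ω h => h.2) (measure_ne_top _ _)).trans (ih _)
        _ = ε ^ F.card := by
            rw [← pow_succ', Finset.card_erase_add_one hz]
    · refine (measureReal_mono ?_ (measure_ne_top _ _)).trans (ih F)
      intro ω hω a ha
      rcases 𝔣.mem_failed_step.1 (hω ha) with h | ⟨rfl, -⟩
      · exact h
      · exact absurd ha hz

end Frame

end Failure

section Cost

open Relation

variable {d : ℕ}

lemma le_add_length_of_isChain {V : Type*} {rel : V → V → Prop} {f : V → ℝ} {U : Set V}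
    (hf : ∀ u v, rel u v → f v ≤ f u + 1 ∧ v ∈ U) {x y : V} {l : List V}
    (hl : (x :: l).IsChain rel) (hy : (x :: l).getLast? = some y) :
    f y ≤ f x + l.length ∧ ∀ v ∈ l, v ∈ U := by
  induction l generalizing x with
  | nil =>
    simp only [List.getLast?_singleton, Option.some.injEq] at hy
    subst hy
    simp
  | cons a l ih =>
    rw [List.isChain_cons_cons] at hl
    rw [List.getLast?_cons_cons] at hy
    obtain ⟨h1, h2⟩ := ih hl.2 hy
    obtain ⟨h3, h4⟩ := hf _ _ hl.1
    refine ⟨?_, ?_⟩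
    · push_cast [List.length_cons]
      linarith
    · intro v hv
      rcases List.mem_cons.1 hv with rfl | hv
      · exact h4
      · exact h2 v hv

lemma ConnIn.le_add_card {V : Type*} {rel : V → V → Prop} {f : V → ℝ} {U : Finset V} {x y : V}
    (hf : ∀ u v, rel u v → f v ≤ f u + 1) (h : ConnIn rel U x y) :
    f y ≤ f x + U.card := by
  obtain ⟨l, hnd, hch, hl⟩ := exists_nodup_chain h
  obtain ⟨h1, h2⟩ := le_add_length_of_isChain (U := (U : Set V))
    (fun u v huv => ⟨hf u v huv.1, huv.2.2⟩) hch hl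
  have h3 : l.toFinset ⊆ U := fun v hv => h2 v (List.mem_toFinset.1 hv)
  have h4 := Finset.card_le_card h3
  rw [List.toFinset_card_of_nodup (List.nodup_cons.1 hnd).2] at h4
  have h5 : (l.length : ℝ) ≤ U.card := by exact_mod_cast h4
  linarith

lemma norm1_update_sub {u v : ZVec d} {i : Fin d} {a : ℤ} :
    norm1 d (Function.update u i a - v) + (u i - v i).natAbs =
      norm1 d (u - v) + (a - v i).natAbs := by
  unfold norm1
  rw [← Finset.add_sum_erase _ _ (Finset.mem_univ i), ← Finset.add_sum_erase _
    (fun j => ((u - v) j).natAbs) (Finset.mem_univ i), Finset.sum_congr rfl (g := fun j =>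
      ((u - v) j).natAbs) fun j hj => ?_]
  · simp only [Pi.sub_apply, Function.update_self]
    omega
  · simp [Function.update_of_ne (Finset.ne_of_mem_erase hj)]

lemma le_add_norm1 {f : ZVec d → ℝ} {W : ℝ} {b : ZVec d} {r : ℕ}
    (h : ∀ u ∈ Bx b r, ∀ v ∈ Bx b r, Adj d u v → f v ≤ f u + W) {u v : ZVec d}
    (hu : u ∈ Bx b r) (hv : v ∈ Bx b r) : f u ≤ f v + norm1 d (u - v) * W := by
  generalize hN : norm1 d (u - v) = N
  induction N generalizing u with
  | zero =>
    have : u = v := by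
      funext l
      have := Finset.sum_eq_zero_iff.1 hN l (Finset.mem_univ l)
      simpa [sub_eq_zero] using this
    simp [this]
  | succ N ih =>
    obtain ⟨i, -, hi⟩ := Finset.exists_ne_zero_of_sum_ne_zero (hN.trans_ne N.succ_ne_zero)
    simp only [Pi.sub_apply, ne_eq, Int.natAbs_eq_zero] at hi
    obtain ⟨a, ha, ha'⟩ : ∃ a : ℤ, (a - v i).natAbs + 1 = (u i - v i).natAbs ∧
        (a - u i).natAbs = 1 := by
      rcases lt_or_gt_of_ne hi with h | h
      · exact ⟨u i + 1, by omega, by omega⟩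
      · exact ⟨u i - 1, by omega, by omega⟩
    have hN' : norm1 d (Function.update u i a - v) = N := by
      have := norm1_update_sub (u := u) (v := v) (i := i) (a := a)
      omega
    have hadj : Adj d (Function.update u i a) u := by
      have h1 := norm1_update_sub (u := u) (v := u) (i := i) (a := a)
      have h2 : norm1 d (u - u) = 0 := by simp [norm1]
      simp only [sub_self, Int.natAbs_zero, add_zero] at h1 h2
      unfold Adj
      omega
    have hmem : Function.update u i a ∈ Bx b r := by
      intro l
      rcases eq_or_ne l i with rfl | hl
      · have h1 := hu l
        have h2 := hv l
        rw [Function.update_self, abs_le] at *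
        omega
      · rw [Function.update_of_ne hl]
        exact hu l
    have h1 := ih hmem hN'
    have h2 := h _ hmem _ hu hadj
    push_cast
    linarith

namespace Frame

variable (𝔣 : Frame d)

/-- A site with a seed. -/
def Wet (s : St d) (z : Site) : Prop := ∃ b, (z, b) ∈ s.2.1

/-- Parents of a coarse site. -/
def Parent (z' z : Site) : Prop := z' = (z.1 - 1, z.2) ∨ z' = (z.1, z.2 - 1)

lemma Parent.rank_lt {z' z : Site} (h : Parent z' z) : rank z' < rank z := by
  unfold rank
  rcases h with rfl | rfl <;> dsimp only <;> omega

lemma wet_step {s : St d} {z z' : Site} {ω : Bit d → Bool} (h : Wet (𝔣.step z s ω) z') :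
    Wet s z' ∨ z' = z := by
  obtain ⟨b, hb⟩ := h
  rcases hq : 𝔣.launch s z with _ | q
  · rw [𝔣.step_of_none hq] at hb
    exact Or.inl ⟨b, hb⟩
  · rw [𝔣.step_of_some hq] at hb
    rcases Finset.mem_union.1 hb with h | h
    · exact Or.inl ⟨b, h⟩
    · obtain ⟨b', -, he⟩ := Finset.mem_image.1 h
      exact Or.inr (Prod.mk.inj he).1.symm

lemma wet_mono_step {s : St d} {z z' : Site} {ω : Bit d → Bool} (h : Wet s z') :
    Wet (𝔣.step z s ω) z' :=
  h.imp fun _ hb => (𝔣.subset_step z s ω).2.1 hb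

lemma wet_run_of_parent {s₀ : St d} {l : List Site} (hl : l.Pairwise fun a b => rank b ≤ rank a)
    {ω : Bit d → Bool} {z z' : Site} (hz : z ∈ l) (hp : Parent z' z)
    (hw : Wet (𝔣.run s₀ l ω) z') (hF : z ∉ (𝔣.run s₀ l ω).2.2) : Wet (𝔣.run s₀ l ω) z := by
  induction l with
  | nil => simp at hz
  | cons a l ih =>
    simp only [run] at hw hF ⊢
    rw [𝔣.mem_failed_step, not_or] at hF
    have hw' : Wet (𝔣.run s₀ l ω) z' := by
      refine (𝔣.wet_step hw).resolve_right ?_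
      rintro rfl
      have h1 := hp.rank_lt
      rcases List.mem_cons.1 hz with rfl | hz
      · exact lt_irrefl _ h1
      · exact absurd ((List.pairwise_cons.1 hl).1 z hz) (not_le.2 h1)
    by_cases hza : z = a
    · subst hza
      obtain ⟨q, hq⟩ : ∃ q, 𝔣.launch (𝔣.run s₀ l ω) z = some q := by
        rw [𝔣.launch_isSome_iff]
        rcases hp with rfl | rfl
        · exact Or.inl hw'
        · exact Or.inr hw'
      have hne : (𝔣.newSeeds z (𝔣.run s₀ l ω).1 q ω).Nonempty :=
        Finset.nonempty_iff_ne_empty.2 fun h => hF.2 ⟨rfl, q, hq, h⟩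
      obtain ⟨b, hb⟩ := hne
      refine ⟨b, ?_⟩
      rw [𝔣.step_of_some hq]
      exact Finset.mem_union_right _ (Finset.mem_image_of_mem _ hb)
    · exact 𝔣.wet_mono_step (ih (List.pairwise_cons.1 hl).2
        ((List.mem_cons.1 hz).resolve_left hza) hw' hF.1)

lemma wet_mono_run {s₀ : St d} (l : List Site) {ω : Bit d → Bool} {z : Site} (h : Wet s₀ z) :
    Wet (𝔣.run s₀ l ω) z := by
  induction l with
  | nil => exact h
  | cons a l ih => exact 𝔣.wet_mono_step ih

/-- The cost of the exploration of one site. -/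
def toll : ℕ := (2 * 𝔣.n + 1) ^ d + d * (2 * 𝔣.m) + 2

lemma norm1_le_of_mem_Bx {b u v : ZVec d} {r : ℕ} (hu : u ∈ Bx b r) (hv : v ∈ Bx b r) :
    norm1 d (u - v) ≤ d * (2 * r) := by
  have h : ∀ l ∈ Finset.univ, ((u - v) l).natAbs ≤ 2 * r := fun l _ => by
    have h1 := hu l
    have h2 := hv l
    rw [abs_le] at *
    rw [Pi.sub_apply]
    omega
  simpa [norm1] using Finset.sum_le_card_nsmul _ _ _ h

lemma le_of_mem_step {f : ZVec d → ℝ} {ω : Bit d → Bool}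
    (hf : ∀ o u v, Opn o ω u v → f v ≤ f u + 1) {s : St d} (hs : 𝔣.Valid s) {z : Site}
    {v : ZVec d} (hv : v ∈ (𝔣.step z s ω).1) :
    v ∈ s.1 ∨ v ∈ 𝔣.box z ∧ ∃ u ∈ s.1, u ∈ 𝔣.box z ∧ f v ≤ f u + 𝔣.toll := by
  rcases hq : 𝔣.launch s z with _ | q
  · rw [𝔣.step_of_none hq] at hv
    exact Or.inl hv
  have hB := 𝔣.Bx_launch_subset' hs hq
  have hgrow : ∀ w ∈ grow (col z) (Bx q.2.2 𝔣.n) s.1 ω, ∃ u ∈ s.1, u ∈ 𝔣.box z ∧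
      f w ≤ f u + ((2 * 𝔣.n + 1) ^ d + 1) := by
    rintro w ⟨u, hu, w₀, hw₀, ho, hc⟩
    refine ⟨u, hu.1, hB hu.2, ?_⟩
    have h1 := ConnIn.le_add_card (f := f) (U := (finite_Bx q.2.2 𝔣.n).toFinset) (hf none)
      (hc.mono (by simp))
    have h2 := hf _ _ _ ho
    rw [card_Bx] at h1
    push_cast at h1
    linarith
  rw [𝔣.step_of_some hq] at hv
  simp only [Finset.mem_union, Finset.mem_biUnion] at hv
  rcases hv with (hv | hv) | ⟨b, hb, hv⟩
  · exact Or.inl hv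
  · rw [𝔣.mem_reached] at hv
    obtain ⟨u, hu, hub, hle⟩ := hgrow v hv
    refine Or.inr ⟨hB (grow_subset _ _ _ _ hv).1, u, hu, hub, hle.trans ?_⟩
    unfold toll
    push_cast
    have : (0 : ℝ) ≤ d * (2 * 𝔣.m) := by positivity
    linarith
  · obtain ⟨w, ⟨hwT, hseed, hw⟩, rfl⟩ := 𝔣.mem_newSeeds.1 hb
    rw [Set.Finite.mem_toFinset] at hv
    set σ := 𝔣.aim z q.1 q.2.1 q.2.2 with hσ
    have hwB := Tgt_subset_Bx _ _ _ _ hwT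
    refine Or.inr ⟨?_, ?_⟩
    · refine 𝔣.Bx_launch_subset hs hq fun l => ?_
      have h1 := hv l
      have h2 := abs_nxt_sub 𝔣.m q.1 σ w l
      have h3 := hwB l
      rw [abs_le] at *
      unfold spacing
      push_cast
      omega
    · obtain ⟨u, hu, hub, hle⟩ : ∃ u ∈ s.1, u ∈ 𝔣.box z ∧
          f w ≤ f u + ((2 * 𝔣.n + 1) ^ d + 1) := by
        rcases hw with hw | hw
        · exact ⟨w, hw, hB hwB, le_add_of_nonneg_right (by positivity)⟩
        · exact hgrow w hw
      refine ⟨u, hu, hub, ?_⟩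
      set w' : ZVec d := Function.update w q.1 (w q.1 + σ q.1) with hw'
      have hw'b : w' ∈ Bx (nxt 𝔣.m q.1 σ w) 𝔣.m := by
        intro l
        rcases eq_or_ne l q.1 with rfl | hl
        · rw [hw', Function.update_self]
          have : w q.1 + (σ q.1 : ℤ) - nxt 𝔣.m q.1 σ w q.1 = σ q.1 * (-𝔣.m) := by
            simp only [nxt, if_true]
            ring
          rw [this, abs_units_mul, abs_neg, Nat.abs_cast]
        · rw [hw', Function.update_of_ne hl]
          simp [nxt, hl]
      have hadj : Adj d w w' := by
        refine Adj.symm ?_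
        have h1 := norm1_update_sub (u := w) (v := w) (i := q.1) (a := w q.1 + σ q.1)
        have h2 : norm1 d (w - w) = 0 := by simp [norm1]
        have h3 : (w q.1 + (σ q.1 : ℤ) - w q.1).natAbs = 1 := by
          rw [add_sub_cancel_left, Int.units_natAbs]
        simp only [sub_self, Int.natAbs_zero, add_zero] at h1 h2
        unfold Adj
        rw [hw']
        omega
      have hopn : Opn (some (col z)) ω w w' := ⟨hadj, hseed _
        ⟨mem_bitsIn (Set.mem_insert _ _) (Set.mem_insert_of_mem _ hw'b), w', by simp, hw'b⟩⟩
      have h1 := hf _ _ _ hopn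
      have h2 := le_add_norm1 (f := f) (W := 1) (b := nxt 𝔣.m q.1 σ w) (r := 𝔣.m)
        (fun a ha a' ha' hadj => hf (some (col z)) _ _ ⟨hadj, hseed _
          ⟨mem_bitsIn (Set.mem_insert_of_mem _ ha) (Set.mem_insert_of_mem _ ha'), a, by simp, ha⟩⟩)
        hv hw'b
      have h3 : (norm1 d (v - w') : ℝ) ≤ d * (2 * 𝔣.m) := by
        exact_mod_cast norm1_le_of_mem_Bx hv hw'b
      unfold toll
      push_cast
      linarith

lemma le_of_mem_run {f : ZVec d → ℝ} {ω : Bit d → Bool}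
    (hf : ∀ o u v, Opn o ω u v → f v ≤ f u + 1) {s₀ : St d} (hs : 𝔣.Valid s₀) {A : ℝ}
    (h₀ : ∀ v ∈ s₀.1, f v ≤ A) {l : List Site} (hl : l.Pairwise fun a b => rank b ≤ rank a)
    (hnd : l.Nodup) (hr : ∀ z ∈ l, 0 ≤ rank z) {v : ZVec d} (hv : v ∈ (𝔣.run s₀ l ω).1) :
    f v ≤ A ∨ ∃ z ∈ l, v ∈ 𝔣.box z ∧ f v ≤ A + 𝔣.toll * (rank z + 1) := by
  induction l generalizing v with
  | nil => exact Or.inl (h₀ v hv)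
  | cons z l ih =>
    rw [List.pairwise_cons] at hl
    rw [List.nodup_cons] at hnd
    replace ih := fun v => ih hl.2 hnd.2 (fun a ha => hr a (List.mem_cons_of_mem _ ha)) (v := v)
    rcases 𝔣.le_of_mem_step hf (hs.run 𝔣 l ω) hv with h | ⟨hvz, u, hu, huz, hle⟩
    · rcases ih v h with h | ⟨a, ha, h⟩
      · exact Or.inl h
      · exact Or.inr ⟨a, List.mem_cons_of_mem _ ha, h⟩
    · refine Or.inr ⟨z, by simp, hvz, hle.trans ?_⟩
      have ht : (0 : ℝ) ≤ 𝔣.toll := by positivity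
      rcases ih u hu with h | ⟨a, ha, haz, h⟩
      · have : (0 : ℝ) ≤ 𝔣.toll * rank z := mul_nonneg ht (by exact_mod_cast hr z (by simp))
        linarith
      · have hne : a ≠ z := by
          rintro rfl
          exact hnd.1 ha
        have hlt : rank a < rank z := lt_of_le_of_ne (hl.1 a ha) fun he =>
          Set.disjoint_left.1 (𝔣.disjoint_box_of_rank_eq hne he) haz huz
        have h1 : ((rank a + 1 : ℤ) : ℝ) ≤ rank z := by exact_mod_cast hlt
        have h2 := mul_le_mul_of_nonneg_left h1 ht
        push_cast at h2
        linarith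

end Frame

end Cost

section Contour

open Relation

/-- Backward moves of the left contour of the wet region. -/
def Move (B : Set Site) (z z' : Site) : Prop :=
  z' = (z.1, z.2 - 1) ∨ z' = (z.1 + 1, z.2) ∨ (z ∈ B ∧ z' = (z.1 - 1, z.2 + 1))

/-- Sites enclosed by the left contour. -/
def Reach (B : Set Site) (z : Site) : Prop := ∃ z' : Site, z'.1 < z'.2 ∧ ReflTransGen (Move B) z z'

lemma Reach.of_move {B : Set Site} {z z' : Site} (h : Reach B z') (hm : Move B z z') :
    Reach B z := by
  obtain ⟨a, ha, h⟩ := h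
  exact ⟨a, ha, h.head hm⟩

lemma Reach.of_lt {B : Set Site} {z : Site} (h : z.1 < z.2) : Reach B z := ⟨z, h, .refl⟩

lemma Reach.up {B : Set Site} {i j : ℤ} (h : Reach B (i, j)) : Reach B (i, j + 1) :=
  h.of_move (Or.inl (by simp))

lemma Reach.left {B : Set Site} {i j : ℤ} (h : Reach B (i + 1, j)) : Reach B (i, j) :=
  h.of_move (Or.inr (Or.inl rfl))

lemma Reach.diag {B : Set Site} {i j : ℤ} (h : Reach B (i, j + 1)) (hB : (i + 1, j) ∈ B) :
    Reach B (i + 1, j) :=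
  h.of_move (Or.inr (Or.inr ⟨hB, by simp⟩))

/-- A wet site between the two contours at every level. -/
lemma exists_wet_of_not_reach {B : Set Site} {W : Site → Prop} {k M : ℕ}
    (h₀ : ∀ h : ℤ, 0 ≤ h → h ≤ k → W (h, -h))
    (hW : ∀ z z' : Site, Frame.Parent z' z → W z' → z ∉ B → 0 ≤ z.1 → z.1 ≤ k + 2 * M → -k ≤ z.2 →
      z.2 ≤ 2 * M → 1 ≤ z.1 + z.2 → z.1 + z.2 ≤ 2 * M → W z)
    (hk : ¬ Reach B (k, -k)) (hM : ¬ Reach B (M + k, M - k)) :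
    ∃ i : ℤ, M ≤ i ∧ i ≤ M + k ∧ W (i, 2 * M - i) := by
  have hstart : ∃ h : ℤ, 0 ≤ h ∧ h ≤ k ∧ ¬ Reach B (h, -h) ∧ Reach B (h - 1, -h + 1) := by
    have key : ∀ a : ℕ, ¬ Reach B (a, -a) → ∃ h : ℤ, 0 ≤ h ∧ h ≤ a ∧ ¬ Reach B (h, -h) ∧
        Reach B (h - 1, -h + 1) := by
      intro a
      induction a with
      | zero => exact fun h => ⟨0, le_rfl, le_rfl, by simpa using h, Reach.of_lt (by simp)⟩
      | succ a ih =>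
        intro h
        by_cases h' : Reach B (a, -a)
        · refine ⟨a + 1, by positivity, by simp, by simpa using h, by simpa using h'⟩
        · obtain ⟨h, h1, h2, h3⟩ := ih h'
          exact ⟨h, h1, by push_cast; omega, h3⟩
    exact key k hk
  have hlevel : ∀ t : ℕ, t ≤ 2 * M → ∃ i j : ℤ, i + j = t ∧ -k ≤ j ∧ W (i, j) ∧
      ¬ Reach B (i, j) ∧ Reach B (i - 1, j + 1) := by
    intro t
    induction t with
    | zero =>
      intro _
      obtain ⟨h, h1, h2, h3, h4⟩ := hstart
      exact ⟨h, -h, by simp, by omega, h₀ h h1 h2, h3, h4⟩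
    | succ t ih =>
      intro ht
      obtain ⟨i, j, hij, hj, hw, hn, hr⟩ := ih (by omega)
      have hle : j ≤ i := by
        by_contra hlt
        exact hn (Reach.of_lt (by simpa using hlt))
      by_cases h : Reach B (i, j + 1)
      · have h1 : ¬ Reach B (i + 1, j) := fun h' => hn h'.left
        have h2 : (i + 1, j) ∉ B := fun h' => h1 (h.diag h')
        refine ⟨i + 1, j, by push_cast; omega, hj, ?_, h1, by simpa using h⟩
        refine hW _ (i, j) (Or.inl (by simp)) hw h2 ?_ ?_ ?_ ?_ ?_ ?_ <;> dsimp only <;> omega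
      · have h1 : Reach B (i - 1, j + 1 + 1) := hr.up
        have h2 : (i, j + 1) ∉ B := fun h' => h (by
          have := Reach.diag (i := i - 1) (j := j + 1) h1 (by simpa using h')
          simpa using this)
        refine ⟨i, j + 1, by push_cast; omega, by omega, ?_, h, h1⟩
        refine hW _ (i, j) (Or.inr (by simp)) hw h2 ?_ ?_ ?_ ?_ ?_ ?_ <;> dsimp only <;> omega
  obtain ⟨i, j, hij, hj, hw, hn, hr⟩ := hlevel (2 * M) le_rfl
  have hle : j ≤ i := by
    by_contra hlt
    exact hn (Reach.of_lt (by simpa using hlt))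
  push_cast at hij
  refine ⟨i, by omega, ?_, ?_⟩
  · by_contra hlt
    have key : ∀ (a : ℕ) (i j : ℤ), Reach B (i + a, j) → Reach B (i, j + a) := by
      intro a
      induction a with
      | zero => simp
      | succ a ih =>
        intro i j h
        have h1 := ih i (j + 1) (Reach.up (Reach.left (by simpa [add_assoc] using h)))
        have h2 : j + 1 + a = j + (a + 1 : ℕ) := by push_cast; ring
        rwa [h2] at h1
    refine hM ?_
    obtain ⟨a, ha⟩ := Int.eq_ofNat_of_zero_le (show 0 ≤ i - 1 - (M + k) by omega)
    have h1 := key a (M + k) (j + 1) (by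
      have : (M : ℤ) + k + a = i - 1 := by omega
      rwa [this])
    have h2 : j + 1 + a = (M : ℤ) - k := by omega
    rwa [h2] at h1
  · have : (2 : ℤ) * M - i = j := by omega
    rwa [this]

/-- Contours of `ℓ` moves whose diagonal moves start at distinct sites outside `F`. -/
def Cont (B : Set Site) : ℕ → Site → Finset Site → Prop
  | 0, z, _ => z.1 < z.2
  | ℓ + 1, z, F => Cont B ℓ (z.1, z.2 - 1) F ∨ Cont B ℓ (z.1 + 1, z.2) F ∨
      (z ∈ B ∧ z ∉ F ∧ Cont B ℓ (z.1 - 1, z.2 + 1) (insert z F))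

lemma cont_of_chain {B : Set Site} {z z' : Site} {l : List Site} {F : Finset Site}
    (hnd : (z :: l).Nodup) (hch : (z :: l).IsChain (Move B)) (hl : (z :: l).getLast? = some z')
    (hz' : z'.1 < z'.2) (hF : ∀ a ∈ z :: l, a ∉ F) : Cont B l.length z F := by
  induction l generalizing z F with
  | nil =>
    simp only [List.getLast?_singleton, Option.some.injEq] at hl
    subst hl
    exact hz'
  | cons a l ih =>
    rw [List.isChain_cons_cons] at hch
    rw [List.getLast?_cons_cons] at hl
    rw [List.nodup_cons] at hnd
    have hF' : ∀ b ∈ a :: l, b ∉ F := fun b hb => hF b (List.mem_cons_of_mem _ hb)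
    rcases hch.1 with rfl | rfl | ⟨hB, rfl⟩
    · exact Or.inl (ih hnd.2 hch.2 hl hF')
    · exact Or.inr (Or.inl (ih hnd.2 hch.2 hl hF'))
    · refine Or.inr (Or.inr ⟨hB, hF z (by simp), ih hnd.2 hch.2 hl fun b hb h => ?_⟩)
      rcases Finset.mem_insert.1 h with rfl | h
      · exact hnd.1 hb
      · exact hF' b hb h

lemma Reach.exists_cont {B : Set Site} {z : Site} (h : Reach B z) : ∃ ℓ, Cont B ℓ z ∅ := by
  obtain ⟨z', hz', h⟩ := h
  obtain ⟨l, hnd, hch, hl⟩ := exists_nodup_chain h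
  exact ⟨_, cont_of_chain hnd hch hl hz' (by simp)⟩

variable {Ω : Type*} [MeasurableSpace Ω] {P : Measure Ω} [IsProbabilityMeasure P]

lemma measureReal_cont_le {B : Ω → Finset Site}
    (hB : ∀ F, P.real {ω | F ⊆ B ω} ≤ (1 / 256 : ℝ) ^ F.card) (ℓ : ℕ) (z : Site)
    (F : Finset Site) : P.real {ω | F ⊆ B ω ∧ Cont (B ω) ℓ z F} ≤
      (1 / 256 : ℝ) ^ F.card * (1 / 2) ^ ℓ * 8 ^ (z.2 - z.1) := by
  induction ℓ generalizing z F with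
  | zero =>
    by_cases hz : z.1 < z.2
    · refine (measureReal_mono (fun ω h => h.1) (measure_ne_top _ _)).trans ((hB F).trans ?_)
      rw [pow_zero, mul_one]
      exact le_mul_of_one_le_right (by positivity) (one_le_zpow₀ (by norm_num) (by omega))
    · have : {ω | F ⊆ B ω ∧ Cont (B ω) 0 z F} = ∅ := by
        ext ω
        simp [Cont, hz]
      rw [this]
      simp only [measureReal_empty]
      positivity
  | succ ℓ ih =>
    have hsub : {ω | F ⊆ B ω ∧ Cont (B ω) (ℓ + 1) z F} ⊆
        ({ω | F ⊆ B ω ∧ Cont (B ω) ℓ (z.1, z.2 - 1) F} ∪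
          {ω | F ⊆ B ω ∧ Cont (B ω) ℓ (z.1 + 1, z.2) F}) ∪
          {ω | z ∉ F ∧ insert z F ⊆ B ω ∧ Cont (B ω) ℓ (z.1 - 1, z.2 + 1) (insert z F)} := by
      rintro ω ⟨h1, h2 | h2 | ⟨h2, h3, h4⟩⟩
      · exact Or.inl (Or.inl ⟨h1, h2⟩)
      · exact Or.inl (Or.inr ⟨h1, h2⟩)
      · exact Or.inr ⟨h3, Finset.insert_subset h2 h1, h4⟩
    have h3 : P.real {ω | z ∉ F ∧ insert z F ⊆ B ω ∧
        Cont (B ω) ℓ (z.1 - 1, z.2 + 1) (insert z F)} ≤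
        (1 / 256 : ℝ) ^ F.card * (1 / 2) ^ ℓ * (8 ^ (z.2 - z.1) / 4) := by
      by_cases hz : z ∈ F
      · simp only [hz, not_true_eq_false, false_and, Set.ofPred_false, measureReal_empty]
        positivity
      · refine (measureReal_mono (fun ω h => h.2) (measure_ne_top _ _)).trans
          ((ih (z.1 - 1, z.2 + 1) (insert z F)).trans (le_of_eq ?_))
        have he : z.2 + 1 - (z.1 - 1) = z.2 - z.1 + 2 := by ring
        rw [Finset.card_insert_of_notMem hz, he, zpow_add₀ (by norm_num)]
        norm_num
        ring
    have h1 := ih (z.1, z.2 - 1) F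
    have h2 := ih (z.1 + 1, z.2) F
    have e1 : z.2 - 1 - z.1 = z.2 - z.1 - 1 := by ring
    have e2 : z.2 - (z.1 + 1) = z.2 - z.1 - 1 := by ring
    dsimp only at h1 h2
    rw [e1, zpow_sub_one₀ (by norm_num)] at h1
    rw [e2, zpow_sub_one₀ (by norm_num)] at h2
    calc _ ≤ _ := measureReal_mono hsub (measure_ne_top _ _)
      _ ≤ _ := measureReal_union_le _ _
      _ ≤ _ := add_le_add_left (measureReal_union_le _ _) _
      _ ≤ _ := add_le_add (add_le_add h1 h2) h3
      _ = _ := by rw [pow_succ]; ring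

lemma measureReal_reach_le {B : Ω → Finset Site}
    (hB : ∀ F, P.real {ω | F ⊆ B ω} ≤ (1 / 256 : ℝ) ^ F.card) (z : Site) :
    P.real {ω | Reach (B ω) z} ≤ 2 * 8 ^ (z.2 - z.1) := by
  have h1 : P {ω | Reach (B ω) z} ≤ ∑' ℓ : ℕ, ENNReal.ofReal ((1 / 2) ^ ℓ * 8 ^ (z.2 - z.1)) := by
    refine (measure_mono (t := ⋃ ℓ, {ω | Cont (B ω) ℓ z ∅}) fun ω h => ?_).trans
      ((measure_iUnion_le _).trans (ENNReal.tsum_le_tsum fun ℓ => ?_))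
    · exact Set.mem_iUnion.2 h.exists_cont
    · have := measureReal_cont_le hB ℓ z ∅
      simp only [Finset.empty_subset, true_and, Finset.card_empty, pow_zero, one_mul] at this
      rw [← ofReal_measureReal]
      exact ENNReal.ofReal_le_ofReal this
  rw [← ENNReal.ofReal_tsum_of_nonneg (fun _ => by positivity)
    (summable_geometric_two.mul_right _), tsum_mul_right, tsum_geometric_two] at h1
  exact ENNReal.toReal_le_of_le_ofReal (by positivity) h1

end Contour

section Passage

open Relation

variable {d : ℕ} (n : ℕ) (ω : Config d)

lemma pairWeight_nonneg (x y : ZVec d) : 0 ≤ pairWeight d n ω x y := by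
  unfold pairWeight
  split_ifs <;> positivity

lemma pairWeight_le (x y : ZVec d) : pairWeight d n ω x y ≤ max 1 (Real.log n ^ 2) := by
  unfold pairWeight
  split_ifs
  · exact le_max_left _ _
  · exact le_max_right _ _

lemma pathCost_nonneg (γ : List (ZVec d)) : 0 ≤ pathCost d n ω γ := by
  induction γ with
  | nil => exact le_rfl
  | cons a γ ih =>
    cases γ with
    | nil => exact le_rfl
    | cons b γ => exact add_nonneg (pairWeight_nonneg n ω a b) ih

lemma pathCost_append (l : List (ZVec d)) (y : ZVec d) (r : List (ZVec d)) :
    pathCost d n ω (l ++ y :: r) = pathCost d n ω (l ++ [y]) + pathCost d n ω (y :: r) := by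
  induction l with
  | nil => simp [pathCost]
  | cons a l ih =>
    cases l with
    | nil => simp [pathCost]
    | cons b l =>
      simp only [List.cons_append, pathCost] at ih ⊢
      rw [ih, add_assoc]

/-- The costs of the paths from `x` to `y`. -/
def costs (x y : ZVec d) : Set ℝ :=
  {c : ℝ | ∃ γ : List (ZVec d), IsPath d γ ∧ γ.head? = some x ∧
    γ.getLast? = some y ∧ pathCost d n ω γ = c}

lemma bddBelow_costs (x y : ZVec d) : BddBelow (costs n ω x y) :=
  ⟨0, by rintro c ⟨γ, -, -, -, rfl⟩; exact pathCost_nonneg n ω γ⟩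

lemma reflTransGen_adj (x y : ZVec d) : ReflTransGen (Adj d) x y := by
  have hx : x ∈ Bx y (norm1 d (x - y)) := fun l => by
    have := natAbs_le_norm1 (x - y) l
    rw [Pi.sub_apply] at this
    rw [Int.abs_eq_natAbs]
    exact_mod_cast this
  have h := le_add_norm1 (f := fun u => if ReflTransGen (Adj d) u y then (0 : ℝ) else 1) (W := 0)
    (b := y) (r := norm1 d (x - y)) (fun u _ v _ huv => by
      split_ifs with h1 h2 h2
      · norm_num
      · norm_num
      · exact absurd (h2.head huv.symm) h1
      · simp) hx (self_mem_Bx y _)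
  by_contra hn
  simp only [hn, if_false, mul_zero, add_zero, ReflTransGen.refl, if_true] at h
  norm_num at h

lemma costs_nonempty (x y : ZVec d) : (costs n ω x y).Nonempty := by
  obtain ⟨l, hnd, hch, hl⟩ := exists_nodup_chain (reflTransGen_adj x y)
  exact ⟨_, x :: l, ⟨by simp, hnd, hch⟩, by simp, hl, rfl⟩

/-- Loop erasure does not increase the cost. -/
lemma exists_path_le {x y : ZVec d} {l : List (ZVec d)} (hch : (x :: l).IsChain (Adj d))
    (hl : (x :: l).getLast? = some y) :
    ∃ γ : List (ZVec d), IsPath d γ ∧ γ.head? = some x ∧ γ.getLast? = some y ∧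
      pathCost d n ω γ ≤ pathCost d n ω (x :: l) := by
  induction l generalizing x with
  | nil => exact ⟨[x], ⟨by simp, by simp, hch⟩, rfl, hl, le_rfl⟩
  | cons a l ih =>
    rw [List.isChain_cons_cons] at hch
    rw [List.getLast?_cons_cons] at hl
    obtain ⟨γ, ⟨hγ0, hγn, hγc⟩, hγh, hγl, hc⟩ := ih hch.2 hl
    have hle : pathCost d n ω γ ≤ pathCost d n ω (x :: a :: l) :=
      hc.trans (le_add_of_nonneg_left (pairWeight_nonneg n ω x a))
    by_cases hx : x ∈ γ
    · obtain ⟨l₁, l₂, rfl⟩ := List.append_of_mem hx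
      refine ⟨x :: l₂, ⟨by simp, (List.nodup_append.1 hγn).2.1, ?_⟩, rfl, ?_, ?_⟩
      · exact (List.isChain_append.1 hγc).2.1
      · rwa [List.getLast?_append_of_ne_nil _ (by simp)] at hγl
      · rw [pathCost_append] at hle
        linarith [pathCost_nonneg n ω (l₁ ++ [x])]
    · obtain ⟨γ', rfl⟩ := List.head?_eq_some_iff.1 hγh
      refine ⟨x :: a :: γ', ⟨by simp, List.nodup_cons.2 ⟨hx, hγn⟩, ?_⟩, rfl, ?_, ?_⟩
      · exact List.isChain_cons_cons.2 ⟨hch.1, hγc⟩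
      · rwa [List.getLast?_cons_cons]
      · exact add_le_add_right hc _

lemma passageTime_le {x y : ZVec d} {l : List (ZVec d)} (hch : (x :: l).IsChain (Adj d))
    (hl : (x :: l).getLast? = some y) : passageTime d n ω x y ≤ pathCost d n ω (x :: l) := by
  obtain ⟨γ, h1, h2, h3, h4⟩ := exists_path_le n ω hch hl
  exact (csInf_le (bddBelow_costs n ω x y) ⟨γ, h1, h2, h3, rfl⟩).trans h4

lemma passageTime_self (x : ZVec d) : passageTime d n ω x x ≤ 0 :=
  passageTime_le n ω (l := []) (by simp) (by simp)

lemma passageTime_le_pairWeight {x y : ZVec d} (h : Adj d x y) :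
    passageTime d n ω x y ≤ pairWeight d n ω x y := by
  have := passageTime_le n ω (x := x) (y := y) (l := [y]) (by simpa using h) (by simp)
  simpa [pathCost] using this

lemma passageTime_triangle (x y z : ZVec d) :
    passageTime d n ω x z ≤ passageTime d n ω x y + passageTime d n ω y z := by
  rw [← sub_le_iff_le_add]
  refine le_csInf (costs_nonempty n ω x y) ?_
  rintro c ⟨γ₁, ⟨-, -, hc₁⟩, hh₁, hl₁, rfl⟩
  rw [sub_le_iff_le_add, ← sub_le_iff_le_add']
  refine le_csInf (costs_nonempty n ω y z) ?_
  rintro c ⟨γ₂, ⟨-, -, hc₂⟩, hh₂, hl₂, rfl⟩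
  rw [sub_le_iff_le_add']
  obtain ⟨γ₂, rfl⟩ := List.head?_eq_some_iff.1 hh₂
  obtain ⟨γ₁, rfl⟩ := List.getLast?_eq_some_iff.1 hl₁
  have hhead : ∃ l, γ₁ ++ y :: γ₂ = x :: l := by
    cases γ₁ with
    | nil =>
      simp only [List.nil_append, List.head?_cons, Option.some.injEq] at hh₁
      exact ⟨γ₂, by simp [hh₁]⟩
    | cons a γ₁ =>
      simp only [List.cons_append, List.head?_cons, Option.some.injEq] at hh₁
      exact ⟨γ₁ ++ y :: γ₂, by simp [hh₁]⟩
  obtain ⟨l, hl⟩ := hhead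
  have hch : (γ₁ ++ y :: γ₂).IsChain (Adj d) := List.isChain_split.2 ⟨hc₁, hc₂⟩
  have hlast : (γ₁ ++ y :: γ₂).getLast? = some z := by
    rw [List.getLast?_append_of_ne_nil _ (by simp), hl₂]
  rw [← pathCost_append, hl]
  rw [hl] at hch hlast
  exact passageTime_le n ω hch hlast

lemma passageTime_le_norm1 (x y : ZVec d) :
    passageTime d n ω x y ≤ norm1 d (x - y) * max 1 (Real.log n ^ 2) := by
  have hx : x ∈ Bx y (norm1 d (x - y)) := fun l => by
    have := natAbs_le_norm1 (x - y) l
    rw [Pi.sub_apply] at this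
    rw [Int.abs_eq_natAbs]
    exact_mod_cast this
  have h := le_add_norm1 (f := fun u => passageTime d n ω u y) (W := max 1 (Real.log n ^ 2))
    (b := y) (r := norm1 d (x - y)) (fun u _ v _ huv => by
      have h1 := passageTime_triangle n ω v u y
      have h2 := passageTime_le_pairWeight n ω huv.symm
      have h3 := pairWeight_le n ω v u
      linarith) hx (self_mem_Bx y _)
  have := passageTime_self n ω y
  linarith

lemma measurableSet_le_passageTime (t : ℝ) (x y : ZVec d) :
    MeasurableSet {ω : Config d | t ≤ passageTime d n ω x y} := by
  have hm : ∀ γ : List (ZVec d), Measurable fun ω : Config d => pathCost d n ω γ := by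
    intro γ
    induction γ with
    | nil => exact measurable_const
    | cons a γ ih =>
      cases γ with
      | nil => exact measurable_const
      | cons b γ =>
        exact (Measurable.ite (measurableSet_edgeOpen a b) measurable_const measurable_const).add ih
  have : {ω : Config d | t ≤ passageTime d n ω x y} =
      ⋂ γ : {γ : List (ZVec d) // IsPath d γ ∧ γ.head? = some x ∧ γ.getLast? = some y},
        {ω : Config d | t ≤ pathCost d n ω γ} := by
    ext ω
    simp only [Set.mem_ofPred_eq, Set.mem_iInter, Subtype.forall]
    constructor
    · exact fun h γ hγ => h.trans (csInf_le (bddBelow_costs n ω x y) ⟨γ, hγ.1, hγ.2.1, hγ.2.2, rfl⟩)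
    · intro h
      refine le_csInf (costs_nonempty n ω x y) ?_
      rintro c ⟨γ, h1, h2, h3, rfl⟩
      exact h γ ⟨h1, h2, h3⟩
  rw [this]
  exact MeasurableSet.iInter fun γ => measurableSet_le measurable_const (hm γ)

end Passage

section Crossing

variable {d : ℕ}

/-- The sites explored in a run of length `M` started from `k + 1` seeds. -/
def domain (k M : ℕ) : Finset Site :=
  (Finset.Icc 0 (k + 2 * M : ℤ) ×ˢ Finset.Icc (-k : ℤ) (2 * M)).filter fun z =>
    1 ≤ z.1 + z.2 ∧ z.1 + z.2 ≤ 2 * M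

/-- The sites of `domain`, in decreasing exploration order. -/
def sites (k M : ℕ) : List Site :=
  (domain k M).toList.insertionSort fun a b => Frame.rank b ≤ Frame.rank a

lemma mem_sites {k M : ℕ} {z : Site} : z ∈ sites k M ↔ z ∈ domain k M := by
  simp [sites, List.mem_insertionSort]

lemma nodup_sites (k M : ℕ) : (sites k M).Nodup :=
  (List.perm_insertionSort _ _).nodup_iff.2 (Finset.nodup_toList _)

lemma pairwise_sites (k M : ℕ) :
    (sites k M).Pairwise fun a b => Frame.rank b ≤ Frame.rank a := by
  have h1 : Std.Total fun a b : Site => Frame.rank b ≤ Frame.rank a :=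
    ⟨fun a b => le_total _ _⟩
  have h2 : IsTrans Site fun a b => Frame.rank b ≤ Frame.rank a :=
    ⟨fun a b c hab hbc => hbc.trans hab⟩
  exact List.pairwise_insertionSort _ _

namespace Frame

variable (𝔣 : Frame d)

/-- The initial state: seeds at the first `k + 1` sites of the antidiagonal. -/
def initial (k : ℕ) : St d :=
  ((Finset.range (k + 1)).biUnion fun h => (finite_Bx (𝔣.center (h, -h)) 𝔣.m).toFinset,
    (Finset.range (k + 1)).image fun h : ℕ => (((h : ℤ), -(h : ℤ)), 𝔣.center (h, -h)), ∅)

lemma valid_initial (k : ℕ) : 𝔣.Valid (𝔣.initial k) := by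
  intro z b hb
  obtain ⟨h, hh, he⟩ := Finset.mem_image.1 hb
  obtain ⟨rfl, rfl⟩ := Prod.mk.inj he
  refine ⟨fun v hv => ?_, fun l => by simp⟩
  exact Finset.mem_coe.2 (Finset.mem_biUnion.2 ⟨h, hh, by simpa using hv⟩)

/-- The failed sites of the run. -/
def failed (k M : ℕ) (ω : Bit d → Bool) : Finset Site :=
  (𝔣.run (𝔣.initial k) (sites k M) ω).2.2

lemma center_zero : 𝔣.center (0, 0) = 𝔣.o := by
  funext l
  simp [center]

lemma abs_center_sub_le {z z' : Site} {k : ℕ} (h₁ : |z.1 - z'.1| ≤ k) (h₂ : |z.2 - z'.2| ≤ k)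
    (l : Fin d) : |𝔣.center z l - 𝔣.center z' l| ≤ 𝔣.spacing * k := by
  have key : ∀ (s : ℤˣ) (a b : ℤ), |a - b| ≤ k →
      |(𝔣.spacing : ℤ) * (s * a) - 𝔣.spacing * (s * b)| ≤ 𝔣.spacing * k := by
    intro s a b h
    rw [← mul_sub, ← mul_sub, abs_mul, abs_units_mul, Nat.abs_cast]
    exact mul_le_mul_of_nonneg_left h (by positivity)
  unfold center
  rw [add_sub_add_left_eq_sub]
  by_cases h1 : l = 𝔣.i₁
  · have h2 : l ≠ 𝔣.i₂ := h1 ▸ 𝔣.ne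
    simpa [h1, 𝔣.ne] using key _ _ _ h₁
  · by_cases h2 : l = 𝔣.i₂
    · simpa [h1, h2, 𝔣.ne.symm] using key _ _ _ h₂
    · simp only [h1, h2, if_false, add_zero, mul_zero, sub_zero, abs_zero]
      positivity

lemma norm1_le_mul {x : ZVec d} {r : ℕ} (h : ∀ l, |x l| ≤ r) : norm1 d x ≤ d * r := by
  have h : ∀ l ∈ Finset.univ, (x l).natAbs ≤ r := fun l _ => by
    have := h l
    rw [abs_le] at this
    omega
  simpa [norm1] using Finset.sum_le_card_nsmul _ _ _ h

lemma le_center {f : ZVec d → ℝ} {W : ℝ} {ω : Bit d → Bool}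
    (hf : ∀ o u v, Opn o ω u v → f v ≤ f u + 1) (hW : ∀ x y, f x ≤ f y + norm1 d (x - y) * W)
    (hW0 : 0 ≤ W) (h₀ : f 𝔣.o ≤ 0) {k M : ℕ}
    (hk : ¬ Reach (𝔣.failed k M ω) (k, -k)) (hM : ¬ Reach (𝔣.failed k M ω) (M + k, M - k)) :
    f (𝔣.center (M, M)) ≤ d * 𝔣.spacing * (2 * k + 1) * W + 𝔣.toll * (16 * M + 8) := by
  have hval := (𝔣.valid_initial k).run 𝔣 (sites k M) ω
  have hdom : ∀ z ∈ sites k M, 1 ≤ z.1 + z.2 ∧ z.1 + z.2 ≤ 2 * M := fun z hz =>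
    (Finset.mem_filter.1 (mem_sites.1 hz)).2
  obtain ⟨i, hi1, hi2, b, hb⟩ := exists_wet_of_not_reach
    (W := Wet (𝔣.run (𝔣.initial k) (sites k M) ω)) (fun h h1 h2 => by
      refine 𝔣.wet_mono_run _ ⟨𝔣.center (h, -h), Finset.mem_image.2 ⟨h.toNat, ?_, ?_⟩⟩
      · rw [Finset.mem_range]
        omega
      · rw [Int.toNat_of_nonneg h1])
    (fun z z' hp hw hB h1 h2 h3 h4 h5 h6 => by
      refine 𝔣.wet_run_of_parent (pairwise_sites k M) (mem_sites.2 ?_) hp hw hB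
      simp only [domain, Finset.mem_filter, Finset.mem_product, Finset.mem_Icc]
      exact ⟨⟨⟨h1, h2⟩, h3, h4⟩, h5, h6⟩) hk hM
  have hA : ∀ v ∈ (𝔣.initial k).1, f v ≤ (d * (𝔣.m + 𝔣.spacing * k) : ℕ) * W := by
    intro v hv
    obtain ⟨h, hh, hv⟩ := Finset.mem_biUnion.1 hv
    rw [Set.Finite.mem_toFinset] at hv
    rw [Finset.mem_range] at hh
    have h1 : norm1 d (v - 𝔣.o) ≤ d * (𝔣.m + 𝔣.spacing * k) := by
      refine norm1_le_mul fun l => ?_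
      have h2 := hv l
      have h3 := 𝔣.abs_center_sub_le (z := (h, -h)) (z' := (0, 0)) (k := k)
        (by rw [abs_le]; dsimp only; omega) (by rw [abs_le]; dsimp only; omega) l
      rw [center_zero] at h3
      rw [Pi.sub_apply]
      rw [abs_le] at *
      push_cast
      omega
    have h2 := hW v 𝔣.o
    have h3 : (norm1 d (v - 𝔣.o) : ℝ) ≤ (d * (𝔣.m + 𝔣.spacing * k) : ℕ) := by exact_mod_cast h1
    have h4 := mul_le_mul_of_nonneg_right h3 hW0
    linarith
  have hbR : b ∈ (𝔣.run (𝔣.initial k) (sites k M) ω).1 := (hval _ _ hb).1 (self_mem_Bx b _)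
  have hA0 : 0 ≤ ((d * (𝔣.m + 𝔣.spacing * k) : ℕ) : ℝ) * W := mul_nonneg (by positivity) hW0
  have hfb : f b ≤ (d * (𝔣.m + 𝔣.spacing * k) : ℕ) * W + 𝔣.toll * (16 * M + 8) := by
    rcases 𝔣.le_of_mem_run hf (𝔣.valid_initial k) hA (pairwise_sites k M) (nodup_sites k M)
      (fun z hz => by
        have := hdom z hz
        unfold rank
        omega) hbR with h | ⟨z, hz, -, h⟩
    · have : (0 : ℝ) ≤ 𝔣.toll * (16 * M + 8) := by positivity
      linarith
    · refine h.trans (add_le_add_right (mul_le_mul_of_nonneg_left ?_ (by positivity)) _)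
      have h1 : rank z + 1 ≤ 16 * M + 8 := by
        have := hdom z hz
        unfold rank
        omega
      exact_mod_cast h1
  have h1 : norm1 d (𝔣.center (M, M) - b) ≤ d * (𝔣.n + 𝔣.spacing * k) := by
    refine norm1_le_mul fun l => ?_
    have h2 := (hval _ _ hb).2 l
    have h3 := 𝔣.abs_center_sub_le (z := (i, 2 * M - i)) (z' := (M, M)) (k := k)
      (by rw [abs_le]; dsimp only; omega) (by rw [abs_le]; dsimp only; omega) l
    rw [Pi.sub_apply]
    rw [abs_le] at *
    push_cast
    omega
  have h2 : (norm1 d (𝔣.center (M, M) - b) : ℝ) ≤ (d * (𝔣.n + 𝔣.spacing * k) : ℕ) := by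
    exact_mod_cast h1
  have h3 := mul_le_mul_of_nonneg_right h2 hW0
  have h4 := hW (𝔣.center (M, M)) b
  have h5 : (d * (𝔣.m + 𝔣.spacing * k) : ℕ) + (d * (𝔣.n + 𝔣.spacing * k) : ℕ) ≤
      d * 𝔣.spacing * (2 * k + 1) := by
    have : 𝔣.m + 𝔣.n ≤ 𝔣.spacing := by unfold spacing; omega
    nlinarith [Nat.mul_le_mul_left d this]
  have h6 : ((d * (𝔣.m + 𝔣.spacing * k) : ℕ) : ℝ) + (d * (𝔣.n + 𝔣.spacing * k) : ℕ) ≤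
      d * 𝔣.spacing * (2 * k + 1) := by exact_mod_cast h5
  have h7 := mul_le_mul_of_nonneg_right h6 hW0
  linarith

lemma measureReal_reach_failed_le {r : Bit d → unitInterval}
    (hε : ∀ c b i σ (R : Set (ZVec d)), Bx b 𝔣.m ⊆ R →
      (bits r).real {ω | goals c 𝔣.m 𝔣.n b i σ R ω = ∅} ≤ 1 / 256) (k M : ℕ) :
    (bits r).real {ω | Reach (𝔣.failed k M ω) (k, -k) ∨ Reach (𝔣.failed k M ω) (M + k, M - k)} ≤
      4 * (1 / 64) ^ k := by
  have hB := 𝔣.measureReal_failed_le hε (𝔣.valid_initial k) rfl (nodup_sites k M)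
  have h1 := measureReal_reach_le hB (k, -k)
  have h2 := measureReal_reach_le hB (M + k, M - k)
  have h3 : (8 : ℝ) ^ (-k - k : ℤ) = (1 / 64) ^ k := by
    rw [show (-k - k : ℤ) = -((2 * k : ℕ) : ℤ) by push_cast; ring,
      zpow_neg, zpow_natCast, pow_mul, one_div,
      inv_pow]
    norm_num
  have h4 : (M - k - (M + k) : ℤ) = -k - k := by ring
  dsimp only at h1 h2
  rw [h4] at h2
  rw [h3] at h1 h2
  exact (measureReal_union_le {ω | Reach (𝔣.failed k M ω) (k, -k)}
    {ω | Reach (𝔣.failed k M ω) (M + k, M - k)}).trans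
    ((add_le_add h1 h2).trans_eq (by ring))

end Frame

end Crossing

section Overlay

variable {d : ℕ}

/-- The configuration whose open edges are those open in at least one layer. -/
def overlay (ω : Bit d → Bool) : Config d := fun e => decide (∃ o, ω (e.pair, o) = true)

lemma edgeOpen_overlay {o : Option Color} {ω : Bit d → Bool} {u v : ZVec d} (h : Opn o ω u v) :
    EdgeOpen d (overlay ω) u v := by
  obtain ⟨e, he⟩ := h.1.exists_edge
  refine ⟨e, he, decide_eq_true ⟨o, ?_⟩⟩
  have : e.pair = s(u, v) := by
    rcases he with he | he
    · rw [EdgeD.pair, he]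
    · rw [EdgeD.pair, he, Sym2.eq_swap]
  rw [this]
  exact h.2

lemma map_overlay {p p₀ δ : unitInterval} (h : (1 - p₀ : ℝ) * (1 - δ) ^ 64 = 1 - p) :
    Measurable (overlay (d := d)) ∧
      (bits (layerProb p₀ δ)).map (overlay (d := d)) = bits fun _ => p := by
  refine map_bits _ _ (I := fun e : EdgeD d => Set.range (Prod.mk e.pair))
    (fun e => Set.finite_range _) (fun e e' he => ?_) (fun e => ?_) fun e => ?_
  · refine Set.disjoint_left.2 ?_
    rintro _ ⟨o, rfl⟩ ⟨o', h'⟩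
    exact he (EdgeD.pair_injective (Prod.mk.inj h').1.symm)
  · refine dep_of_congr fun ω ω' hω => ?_
    have : overlay ω e = overlay ω' e := by
      unfold overlay
      simp only [hω _ (Set.mem_range_self _)]
    rw [this]
  · have hset : {ω : Bit d → Bool | overlay ω e = true} =
        (⋂ o ∈ (Finset.univ : Finset (Option Color)), {ω | ω (e.pair, o) = false})ᶜ := by
      ext ω
      simp [overlay]
    have hdep : ∀ o : Option Color, Dep {((e.pair, o) : Bit d)} {ω | ω (e.pair, o) = false} :=
      fun o => dep_bit (Set.mem_singleton _) false
    have hmeas : MeasurableSet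
        (⋂ o ∈ (Finset.univ : Finset (Option Color)), {ω : Bit d → Bool | ω (e.pair, o) = false}) :=
      Finset.measurableSet_biInter _ fun o _ => (hdep o).measurableSet (Set.finite_singleton _)
    have hcard : Fintype.card Color = 64 := by simp [Color, ZMod.card]
    rw [hset, probReal_compl_eq_one_sub hmeas,
      measureReal_iInter_of_dep _ (fun o => Set.finite_singleton _)
        (fun o o' ho => by simpa using ho) hdep, Fintype.prod_option]
    simp only [measureReal_bit, layerProb, if_true, reduceCtorEq, if_false, Bool.false_eq_true,
      Finset.prod_const, Finset.card_univ, hcard, h, sub_sub_cancel]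

lemma exists_sprinkling {p p₀ : ℝ} (hp : p₀ < p) (hp1 : p < 1) :
    ∃ δ : unitInterval, 0 < (δ : ℝ) ∧ (1 - p₀) * (1 - δ) ^ 64 = 1 - p := by
  have h0 : 0 < 1 - p₀ := by linarith
  have hq : 0 ≤ (1 - p) / (1 - p₀) := div_nonneg (by linarith) h0.le
  have hq1 : (1 - p) / (1 - p₀) < 1 := (div_lt_one h0).2 (by linarith)
  have h1 : ((1 - p) / (1 - p₀)) ^ (1 / 64 : ℝ) < 1 := Real.rpow_lt_one hq hq1 (by norm_num)
  have h2 : 0 ≤ ((1 - p) / (1 - p₀)) ^ (1 / 64 : ℝ) := Real.rpow_nonneg hq _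
  refine ⟨⟨1 - ((1 - p) / (1 - p₀)) ^ (1 / 64 : ℝ), by linarith, by linarith⟩, sub_pos.2 h1, ?_⟩
  rw [sub_sub_cancel, ← Real.rpow_mul_natCast hq]
  norm_num
  field_simp

lemma Frame.measureReal_lt_passageTime_le (𝔣 : Frame d) {p p₀ δ : unitInterval}
    (h : (1 - p₀ : ℝ) * (1 - δ) ^ 64 = 1 - p)
    (hε : ∀ c b i σ (R : Set (ZVec d)), Bx b 𝔣.m ⊆ R →
      (bits (layerProb p₀ δ)).real {ω | goals c 𝔣.m 𝔣.n b i σ R ω = ∅} ≤ 1 / 256) (n k M : ℕ) :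
    (bits fun _ => p).real {ω | d * 𝔣.spacing * (2 * k + 1) * max 1 (Real.log n ^ 2) +
      𝔣.toll * (16 * M + 8) < passageTime d n ω 𝔣.o (𝔣.center (M, M))} ≤ 4 * (1 / 64) ^ k := by
  obtain ⟨hm, hmap⟩ := map_overlay (d := d) h
  have hT : Measurable fun ω : Config d => passageTime d n ω 𝔣.o (𝔣.center (M, M)) :=
    measurable_of_Ici fun t => measurableSet_le_passageTime n t _ _
  refine le_trans ?_ (𝔣.measureReal_reach_failed_le hε k M)
  rw [← hmap, map_measureReal_apply hm (measurableSet_lt measurable_const hT)]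
  refine measureReal_mono (fun ω hω => ?_) (measure_ne_top _ _)
  by_contra hn
  rw [Set.mem_ofPred_eq, not_or] at hn
  refine (not_le.2 hω) (𝔣.le_center (f := passageTime d n (overlay ω) 𝔣.o) (fun o u v huv => ?_)
    (fun x y => ?_) (le_max_of_le_left zero_le_one) (passageTime_self n _ _) hn.1 hn.2)
  · have h1 := passageTime_triangle n (overlay ω) 𝔣.o u v
    have h2 := passageTime_le_pairWeight n (overlay ω) huv.1
    rw [pairWeight, if_pos (edgeOpen_overlay huv)] at h2
    linarith
  · have h1 := passageTime_triangle n (overlay ω) 𝔣.o y x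
    have h2 := passageTime_le_norm1 n (overlay ω) y x
    rw [show norm1 d (y - x) = norm1 d (x - y) by
      unfold norm1
      refine Finset.sum_congr rfl fun i _ => ?_
      simp only [Pi.sub_apply]
      omega] at h2
    linarith

end Overlay

section Tails

variable {d : ℕ}

lemma measureReal_lt_passageTime_add_le {μ : Measure (Config d)} [IsFiniteMeasure μ] {n : ℕ}
    {x y z : ZVec d} {A B q r : ℝ} (hA : μ.real {ω | A < passageTime d n ω x y} ≤ q)
    (hB : μ.real {ω | B < passageTime d n ω y z} ≤ r) :
    μ.real {ω | A + B < passageTime d n ω x z} ≤ q + r := by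
  have h : {ω | A + B < passageTime d n ω x z} ⊆
      {ω | A < passageTime d n ω x y} ∪ {ω | B < passageTime d n ω y z} := by
    intro ω hω
    by_contra hn
    rw [Set.mem_union, not_or] at hn
    simp only [Set.mem_ofPred_eq, not_lt] at hn hω
    linarith [passageTime_triangle n ω x y z]
  exact (measureReal_mono h (measure_ne_top _ _)).trans
    ((measureReal_union_le _ _).trans (add_le_add hA hB))

lemma measureReal_lt_passageTime_mono {μ : Measure (Config d)} [IsFiniteMeasure μ] {n : ℕ}
    {x y : ZVec d} {A B q : ℝ} (hA : μ.real {ω | A < passageTime d n ω x y} ≤ q) (h : A ≤ B) :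
    μ.real {ω | B < passageTime d n ω x y} ≤ q :=
  (measureReal_mono (fun _ hω => h.trans_lt hω) (measure_ne_top _ _)).trans hA

lemma measureReal_lt_passageTime_eq_zero (μ : Measure (Config d)) {n : ℕ} {x y : ZVec d} {A : ℝ}
    (h : norm1 d (x - y) * max 1 (Real.log n ^ 2) ≤ A) :
    μ.real {ω | A < passageTime d n ω x y} = 0 := by
  have : {ω | A < passageTime d n ω x y} = ∅ := by
    ext ω
    simpa using (passageTime_le_norm1 n ω x y).trans h
  rw [this, measureReal_empty]

/-- Tail bound for displacements along a coordinate axis. -/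
lemma exists_axis_tail (hd : 2 ≤ d) {p : unitInterval} (hp : pc d < p) (hp1 : (p : ℝ) < 1) :
    ∃ A B : ℝ, 0 ≤ A ∧ 0 ≤ B ∧ ∀ (n k : ℕ) (x y : ZVec d) (l : Fin d), (∀ i ≠ l, x i = y i) →
      (bits fun _ => p).real {ω | A * (y l - x l).natAbs + B * (k + 1) * max 1 (Real.log n ^ 2) <
        passageTime d n ω x y} ≤ 8 * (1 / 64) ^ k := by
  obtain ⟨p₀, hp₀, hp₀p⟩ := exists_between hp
  have hpc : 0 ≤ pc d := Real.sSup_nonneg fun q hq => hq.1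
  obtain ⟨δ, hδ, hδp⟩ := exists_sprinkling hp₀p hp1
  lift p₀ to unitInterval using ⟨by linarith, by linarith⟩
  obtain ⟨m, n', hε⟩ := exists_step (d := d) hp₀ (hp₀p.trans hp1) hδ (ε := 1 / 256) (by norm_num)
  obtain ⟨S, hS⟩ : ∃ S : ℕ, S = n' + m + 1 := ⟨_, rfl⟩
  obtain ⟨τ, hτ⟩ : ∃ τ : ℕ, τ = (2 * n' + 1) ^ d + d * (2 * m) + 2 := ⟨_, rfl⟩
  refine ⟨32 * τ, 4 * d * S + 16 * τ + d * (2 * S), by positivity, by positivity,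
    fun n k x y l hxy => ?_⟩
  obtain ⟨l', hl'⟩ : ∃ l' : Fin d, l ≠ l' := by
    have : Nontrivial (Fin d) := Fin.nontrivial_iff_two_le.2 hd
    exact (exists_ne l).imp fun _ h => h.symm
  obtain ⟨s, hs⟩ : ∃ s : ℤˣ, y l - x l = (s : ℤ) * (y l - x l).natAbs := by
    rcases Int.natAbs_eq (y l - x l) with h | h
    · exact ⟨1, by simpa using h⟩
    · exact ⟨-1, by simpa using h⟩
  set N := (y l - x l).natAbs
  set W := max 1 (Real.log n ^ 2)
  have hW : 1 ≤ W := le_max_left _ _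
  set M := N / (2 * S)
  have hM : 2 * S * M ≤ N := Nat.mul_div_le _ _
  have hM' : N < 2 * S * M + 2 * S := Nat.lt_mul_div_succ N (by omega)
  let 𝔣 : Frame d := ⟨m, n', x, l, l', s, 1, hl'⟩
  let 𝔤 : Frame d := ⟨m, n', 𝔣.center (M, M), l, l', s, -1, hl'⟩
  have h1 := 𝔣.measureReal_lt_passageTime_le hδp hε n k M
  have h2 := 𝔤.measureReal_lt_passageTime_le hδp hε n k M
  have hw : norm1 d (𝔤.center (M, M) - y) ≤ d * (2 * S) := by
    refine Frame.norm1_le_mul fun i => ?_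
    have hspf : (𝔣.spacing : ℤ) = S := by rw [hS]; rfl
    have hspg : (𝔤.spacing : ℤ) = S := by rw [hS]; rfl
    have hi : 𝔤.center (M, M) i = x i + if i = l then (s : ℤ) * (2 * S * M) else 0 := by
      simp only [Frame.center, hspg]
      change (x i + 𝔣.spacing * _) + _ = _
      rw [hspf]
      by_cases h : i = l
      · subst h
        simp [𝔣, 𝔤, hl']
        ring
      · simp [𝔣, 𝔤, h]
        split_ifs <;> simp
    rw [Pi.sub_apply, hi]
    split_ifs with h
    · subst h
      rw [show x i + s * (2 * S * M) - y i = (s : ℤ) * (2 * S * M) - (y i - x i) by ring,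
        hs, ← mul_sub,
        abs_mul, show |((s : ℤˣ) : ℤ)| = 1 by rcases Int.units_eq_one_or s with h | h <;> simp [h],
        one_mul, abs_le]
      push_cast
      zify at hM hM'
      constructor <;> linarith
    · rw [hxy i h, add_zero, sub_self, abs_zero]
      positivity
  have h3 := measureReal_lt_passageTime_eq_zero (bits fun _ => p) (n := n) (x := 𝔤.center (M, M))
    (y := y) (A := (d * (2 * S) : ℕ) * W) (by gcongr)
  have h12 := measureReal_lt_passageTime_add_le h1 h2
  have h123 := measureReal_lt_passageTime_add_le h12 h3.le
  refine (measureReal_lt_passageTime_mono h123 ?_).trans_eq (by ring)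
  have hspf : (𝔣.spacing : ℝ) = S := by rw [hS]; rfl
  have hspg : (𝔤.spacing : ℝ) = S := by rw [hS]; rfl
  have htf : (𝔣.toll : ℝ) = τ := by rw [hτ]; rfl
  have htg : (𝔤.toll : ℝ) = τ := by rw [hτ]; rfl
  rw [hspf, hspg, htf, htg]
  have hMN : (M : ℝ) ≤ N := by exact_mod_cast Nat.div_le_self _ _
  have hk : (1 : ℝ) ≤ (k + 1) * W := by
    have : (0 : ℝ) ≤ k := by positivity
    nlinarith
  have hkW : W ≤ (k + 1) * W := le_mul_of_one_le_left (by linarith) (by simp)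
  have e1 : (τ : ℝ) * M ≤ τ * N := by gcongr
  have e2 : (τ : ℝ) * 1 ≤ τ * ((k + 1) * W) := by gcongr
  have e3 : (d * (2 * S) : ℝ) * W ≤ d * (2 * S) * ((k + 1) * W) := by gcongr
  have e4 : (0 : ℝ) ≤ d * S * W := by positivity
  push_cast
  linarith

/-- Tail bound for displacements within a box of radius `D`. -/
lemma exists_box_tail (hd : 2 ≤ d) {p : unitInterval} (hp : pc d < p) (hp1 : (p : ℝ) < 1) :
    ∃ A B : ℝ, 0 ≤ A ∧ 0 ≤ B ∧ ∀ (n k D : ℕ) (x y : ZVec d), (∀ i, (y i - x i).natAbs ≤ D) →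
      (bits fun _ => p).real {ω | A * D + B * (k + 1) * max 1 (Real.log n ^ 2) <
        passageTime d n ω x y} ≤ 8 * d * (1 / 64) ^ k := by
  obtain ⟨A, B, hA, hB, h⟩ := exists_axis_tail hd hp hp1
  refine ⟨d * A, d * B, by positivity, by positivity, fun n k D x y hxy => ?_⟩
  have key : ∀ (s : Finset (Fin d)) (x : ZVec d), (∀ i, (y i - x i).natAbs ≤ D) →
      (∀ i ∉ s, x i = y i) →
      (bits fun _ => p).real {ω | s.card * (A * D + B * (k + 1) * max 1 (Real.log n ^ 2)) <
        passageTime d n ω x y} ≤ s.card * (8 * (1 / 64) ^ k) := by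
    intro s
    induction s using Finset.induction_on with
    | empty =>
      intro x _ hx
      obtain rfl : x = y := funext fun i => hx i (Finset.notMem_empty i)
      rw [measureReal_lt_passageTime_eq_zero]
      · simp
      · simp [norm1]
    | insert a s ha ih =>
      intro x hD hx
      have h1 := h n k x (Function.update x a (y a)) a fun i hi => by simp [hi]
      rw [Function.update_self] at h1
      have h1' := measureReal_lt_passageTime_mono h1
        (B := A * D + B * (k + 1) * max 1 (Real.log n ^ 2)) (by gcongr; exact hD a)
      have h2 := ih (Function.update x a (y a)) (fun i => by
          by_cases hi : i = a
          · subst hi; simp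
          · simpa [hi] using hD i) (fun i hi => by
          by_cases hia : i = a
          · subst hia; simp
          · simpa [hia] using hx i (by simp [hia, hi]))
      refine (measureReal_lt_passageTime_mono (measureReal_lt_passageTime_add_le h1' h2)
        (le_of_eq ?_)).trans_eq ?_
      · rw [Finset.card_insert_of_notMem ha]; push_cast; ring
      · rw [Finset.card_insert_of_notMem ha]; push_cast; ring
  have := key Finset.univ x hxy (by simp)
  rw [Finset.card_univ, Fintype.card_fin] at this
  exact (measureReal_lt_passageTime_mono this (le_of_eq (by ring))).trans_eq (by ring)

end Tails

/-- Lemma 4.5: large deviation estimate for the truncated passage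
time: there are `C, c > 0` such that for all `x, y ∈ ℤ^d` and all `t ≥ C ‖x−y‖_∞`,
`P(T(x,y) ≥ t) ≤ c⁻¹ exp(−ct/log² n)`. -/
theorem truncated_passage_time_large_deviation
    (d : ℕ) (hd : 2 ≤ d) (p : ℝ) (hp : pc d < p) (hp1 : p < 1)
    (μ : Measure (Config d)) (hμ : IsBernoulli d p μ) :
    ∃ C c : ℝ, 0 < C ∧ 0 < c ∧ ∀ n : ℕ, 2 ≤ n → ∀ x y : ZVec d, ∀ t : ℝ,
      C * (normInf d (x - y) : ℝ) ≤ t →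
      μ {ω | t ≤ passageTime d n ω x y}
        ≤ ENNReal.ofReal (c⁻¹ * Real.exp (-c * t / (Real.log n) ^ 2)) := by
  have hpc : 0 ≤ pc d := Real.sSup_nonneg fun q hq => hq.1
  lift p to unitInterval using ⟨by linarith, hp1.le⟩
  obtain rfl := hμ.eq_bits
  obtain ⟨A, B, hA, hB, h⟩ := exists_box_tail hd hp hp1
  obtain ⟨K, hK⟩ : ∃ K : ℝ, K = max (8 * d : ℝ) 1 * Real.exp 2 := ⟨_, rfl⟩
  have hKpos : 0 < K := by rw [hK]; positivity
  have hD0 : (0 : ℝ) < 12 * (B + 1) := by positivity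
  refine ⟨2 * A + 1, min (12 * (B + 1))⁻¹ K⁻¹, by positivity, by positivity,
    fun n hn x y t ht => ?_⟩
  have hL : 1 ≤ 3 * Real.log n ^ 2 := by
    have h1 := Real.log_two_gt_d9
    have h2 : Real.log 2 ≤ Real.log n := Real.log_le_log (by norm_num) (by exact_mod_cast hn)
    nlinarith
  have hLpos : 0 < Real.log n ^ 2 := by linarith
  have ht0 : 0 ≤ t := le_trans (by positivity) ht
  obtain ⟨r, hr⟩ : ∃ r : ℝ, r = t / (12 * (B + 1) * Real.log n ^ 2) := ⟨_, rfl⟩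
  have hr0 : 0 ≤ r := by rw [hr]; positivity
  have htr : t = r * (12 * (B + 1) * Real.log n ^ 2) := by
    rw [hr, div_mul_cancel₀ _ (by positivity)]
  have hmain : (bits fun _ : EdgeD d => p).real {ω | t ≤ passageTime d n ω x y} ≤
      K * Real.exp (-r) := by
    rcases lt_or_ge r 2 with hr2 | hr2
    · refine measureReal_le_one.trans ?_
      rw [hK, mul_assoc, ← Real.exp_add]
      exact one_le_mul_of_one_le_of_one_le (le_max_right _ _) (Real.one_le_exp (by linarith))
    · have hk := Nat.floor_le hr0
      have hk' := Nat.lt_floor_add_one r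
      set k := ⌊r⌋₊
      have hbox := h n k (normInf d (x - y)) x y fun i => by
        have : ((x - y) i).natAbs ≤ normInf d (x - y) :=
          Finset.le_sup (f := fun i => ((x - y) i).natAbs) (Finset.mem_univ i)
        rw [Pi.sub_apply] at this
        omega
      have hlt : A * normInf d (x - y) + B * (k + 1) * max 1 (Real.log n ^ 2) < t := by
        have e1 : max 1 (Real.log n ^ 2) ≤ 3 * Real.log n ^ 2 := max_le hL (by linarith)
        have e2 : (k : ℝ) + 1 ≤ 2 * r := by linarith
        have e3 : B * (k + 1) * max 1 (Real.log n ^ 2) ≤ B * (2 * r) * (3 * Real.log n ^ 2) := by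
          gcongr
        have e4 : 0 < r * Real.log n ^ 2 := by positivity
        have e5 : (0 : ℝ) ≤ normInf d (x - y) := by positivity
        nlinarith
      calc _ ≤ _ := measureReal_mono (fun ω hω => hlt.trans_le hω) (measure_ne_top _ _)
        _ ≤ 8 * d * (1 / 64) ^ k := hbox
        _ ≤ max (8 * d : ℝ) 1 * Real.exp (2 - r) := by
          have e1 : (1 / 64 : ℝ) ^ k ≤ Real.exp (-1) ^ k := by
            have : (1 / 64 : ℝ) ≤ Real.exp (-1) := by
              rw [Real.exp_neg, ← one_div]
              exact one_div_le_one_div_of_le (Real.exp_pos 1) (by linarith [Real.exp_one_lt_d9])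
            gcongr
          rw [← Real.exp_nat_mul] at e1
          refine mul_le_mul (le_max_left _ _) (e1.trans (Real.exp_le_exp.2 (by linarith)))
            (by positivity) (by positivity)
        _ = K * Real.exp (-r) := by rw [hK, mul_assoc, ← Real.exp_add, sub_eq_add_neg]
  rw [← ENNReal.ofReal_toReal (measure_ne_top _ _)]
  refine ENNReal.ofReal_le_ofReal (hmain.trans (mul_le_mul ?_ (Real.exp_le_exp.2 ?_)
    (Real.exp_pos _).le (by positivity)))
  · rw [le_inv_comm₀ hKpos (by positivity)]
    exact min_le_right _ _
  · have e1 : min (12 * (B + 1))⁻¹ K⁻¹ * t ≤ (12 * (B + 1))⁻¹ * t := by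
      gcongr
      exact min_le_left _ _
    rw [neg_mul, neg_div, neg_le_neg_iff, div_le_iff₀ hLpos]
    refine e1.trans_eq ?_
    rw [htr]
    field_simp

end Perco
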